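/- Let ℓ > 5 be an odd integer and let v be a positive integer with v ≡ 1 (mod 2ℓ) or v ≡ ℓ (mod 2ℓ). Then the complete graph K_v admits an equitably 2-colourable ℓ-cycle decomposition. -/

import Mathlib

set_option linter.unusedSimpArgs false
set_option linter.unusedVariables false
set_option linter.unreachableTactic false
set_option linter.unusedTactic false
set_option linter.unusedSectionVars false

/-- The edge set of the cycle represented by `c : ZMod n → V`
(vertices listed in cyclic order). -/
def cycEdges {V : Type} {n : ℕ} [NeZero n] (c : ZMod n → V) : Set (Sym2 V) :=
  Set.range fun j => s(c j, c (j + 1))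

/-- The family `cyc` of `n`-cycles is an `n`-cycle decomposition of the graph `G`:
each `cyc i` is an injective cyclic sequence of adjacent vertices, and every edge
of `G` lies on exactly one of the cycles. -/
def IsCycleDecomp {V : Type} {n : ℕ} [NeZero n] (G : SimpleGraph V)
    {ι : Type} (cyc : ι → ZMod n → V) : Prop :=
  (∀ i, Function.Injective (cyc i)) ∧
  (∀ i j, G.Adj (cyc i j) (cyc i (j + 1))) ∧
  (∀ e, e ∈ G.edgeSet ↔ ∃! i, e ∈ cycEdges (cyc i))

/-- Number of vertices of the cycle `c` coloured `true` (red). -/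
def redCount {V : Type} {n : ℕ} [NeZero n] (colour : V → Bool) (c : ZMod n → V) : ℕ :=
  (Finset.univ.filter fun j => colour (c j) = true).card

/-- The cycle `c` is equitably 2-coloured: each colour appears on
`⌊n/2⌋` or `⌈n/2⌉` of its vertices. -/
def IsEquitable {V : Type} {n : ℕ} [NeZero n] (colour : V → Bool) (c : ZMod n → V) : Prop :=
  redCount colour c = n / 2 ∨ redCount colour c = (n + 1) / 2

/-- `G` admits an equitably 2-colourable decomposition into cycles of length `n`. -/
def HasEquitable2Decomp {V : Type} (G : SimpleGraph V) (n : ℕ) [NeZero n] : Prop :=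
  ∃ (ι : Type) (cyc : ι → ZMod n → V) (colour : V → Bool),
    IsCycleDecomp G cyc ∧ ∀ i, IsEquitable colour (cyc i)


namespace EqDec

def Adj {α : Type} (L : List α) (u v : α) : Prop :=
  [u, v] <:+: L ++ L.take 1 ∨ [v, u] <:+: L ++ L.take 1

instance {α : Type} [DecidableEq α] (L : List α) (u v : α) : Decidable (Adj L u v) := by
  unfold Adj; infer_instance

theorem Adj.symm {α : Type} {L : List α} {u v : α} (h : Adj L u v) : Adj L v u := Or.symm h

theorem Adj.map {α β : Type} (f : α → β) {L : List α} {u v : α} (h : Adj L u v) :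
    Adj (L.map f) (f u) (f v) := by
  unfold Adj at *
  rw [← List.map_take, ← List.map_append]
  exact h.imp (fun h => by simpa using h.map f) (fun h => by simpa using h.map f)

theorem pair_index {α : Type} {L : List α} {u v : α} (hL : 0 < L.length)
    (h : [u, v] <:+: L ++ L.take 1) :
    ∃ j, ∃ h : j < L.length, L[j] = u ∧
      L[(j + 1) % L.length]'(Nat.mod_lt _ hL) = v := by
  obtain ⟨s, t, h⟩ := h
  have hlen := congrArg List.length h
  simp only [List.length_append, List.length_cons, List.length_nil, List.length_take] at hlen
  have h1 : min 1 L.length = 1 := by omega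
  have hs : s.length < L.length := by omega
  refine ⟨s.length, hs, ?_, ?_⟩
  · have : (L ++ L.take 1)[s.length]? = some u := by
      rw [← h]; simp
    rw [List.getElem?_append_left hs] at this
    rw [List.getElem?_eq_getElem hs] at this
    exact Option.some.inj this
  · have h2 : (L ++ L.take 1)[s.length + 1]? = some v := by
      rw [← h]; simp
    by_cases hc : s.length + 1 < L.length
    · rw [List.getElem?_append_left hc, List.getElem?_eq_getElem hc] at h2
      have h3 := Option.some.inj h2
      simp only [Nat.mod_eq_of_lt hc]
      exact h3
    · have he : s.length + 1 = L.length := by omega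
      rw [List.getElem?_append_right (by omega)] at h2
      simp only [he, Nat.sub_self, Nat.mod_self] at h2 ⊢
      rw [List.getElem?_take_of_lt (by omega), List.getElem?_eq_getElem hL] at h2
      exact Option.some.inj h2

theorem core {V ι : Type} [Fintype V] [Fintype ι] (n v : ℕ) [NeZero n] (hn : 3 ≤ n)
    (C : ι → List V) (hlen : ∀ i, (C i).length = n) (hnd : ∀ i, (C i).Nodup)
    (hcov : ∀ x y, x ≠ y → ∃ i, Adj (C i) x y)
    (hv : Fintype.card V = v)
    (hcard : Fintype.card ι * n = v.choose 2) (col : V → Bool)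
    (heq : ∀ i, (C i).countP col = n / 2 ∨ (C i).countP col = (n + 1) / 2) :
    HasEquitable2Decomp (⊤ : SimpleGraph (Fin v)) n := by
  classical
  haveI : Fact (1 < n) := ⟨by omega⟩
  let e : V ≃ Fin v := Fintype.equivFinOfCardEq hv
  let c : ι → ZMod n → V := fun i j => (C i)[j.val]'(by rw [hlen]; exact ZMod.val_lt j)
  have hcinj : ∀ i, Function.Injective (c i) := by
    intro i j j' h
    have := (List.Nodup.getElem_inj_iff (hnd i)).1 h
    exact ZMod.val_injective n this
  have hsucc : ∀ j : ZMod n, (j + 1).val = (j.val + 1) % n := by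
    intro j; rw [ZMod.val_add, ZMod.val_one]
  have hne : ∀ i j, c i j ≠ c i (j + 1) := by
    intro i j h
    have := hcinj i h
    simp at this
  let Φ : ι × ZMod n → (⊤ : SimpleGraph (Fin v)).edgeSet := fun p =>
    ⟨s(e (c p.1 p.2), e (c p.1 (p.2 + 1))), by
      rw [SimpleGraph.mem_edgeSet, SimpleGraph.top_adj]
      exact fun h => hne _ _ (e.injective h)⟩
  have hpair : ∀ i x y, [x, y] <:+: C i ++ (C i).take 1 → ∃ j, c i j = x ∧ c i (j + 1) = y := by
    intro i x y h
    obtain ⟨j, hj, h1, h2⟩ := pair_index (by rw [hlen]; omega) h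
    have hj' : j < n := by rw [hlen] at hj; exact hj
    have hjv : ((j : ℕ) : ZMod n).val = j := ZMod.val_cast_of_lt hj'
    refine ⟨(j : ZMod n), ?_, ?_⟩
    · simp only [c, hjv]; exact h1
    · simp only [c, hsucc, hjv]
      rw [← h2]; simp only [hlen]
  have hsurj : Function.Surjective Φ := by
    rintro ⟨s, hs⟩
    induction s using Sym2.ind with
    | _ x y =>
      rw [SimpleGraph.mem_edgeSet, SimpleGraph.top_adj] at hs
      obtain ⟨i, h | h⟩ := hcov (e.symm x) (e.symm y) (fun h => hs (e.symm.injective h))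
      · obtain ⟨j, h1, h2⟩ := hpair i _ _ h
        exact ⟨(i, j), by apply Subtype.ext; simp [Φ, h1, h2]⟩
      · obtain ⟨j, h1, h2⟩ := hpair i _ _ h
        exact ⟨(i, j), by apply Subtype.ext; simp [Φ, h1, h2, Sym2.eq_swap]⟩
  have hbij : Function.Bijective Φ := by
    rw [Fintype.bijective_iff_surjective_and_card]
    refine ⟨hsurj, ?_⟩
    rw [Fintype.card_prod, ZMod.card, hcard, ← SimpleGraph.edgeFinset_card,
      SimpleGraph.card_edgeFinset_top_eq_card_choose_two, Fintype.card_fin]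
  refine ⟨ι, fun i j => e (c i j), fun x => col (e.symm x), ⟨?_, ?_, ?_⟩, ?_⟩
  · intro i; exact e.injective.comp (hcinj i)
  · intro i j; rw [SimpleGraph.top_adj]; exact fun h => hne _ _ (e.injective h)
  · intro s
    constructor
    · intro hs
      obtain ⟨⟨i, j⟩, hij⟩ := hsurj ⟨s, hs⟩
      refine ⟨i, ⟨j, congrArg Subtype.val hij⟩, ?_⟩
      rintro i' ⟨j', hj'⟩
      have : Φ (i', j') = Φ (i, j) := by rw [hij]; exact Subtype.ext hj'
      exact (Prod.ext_iff.1 (hbij.1 this)).1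
    · rintro ⟨i, ⟨j, rfl⟩, _⟩
      exact (Φ (i, j)).2
  · intro i
    have : redCount (fun x => col (e.symm x)) (fun j => e (c i j)) = (C i).countP col := by
      unfold redCount
      simp only [Equiv.symm_apply_apply]
      have h1 : (C i).countP col = ((C i).filter col).toFinset.card := by
        rw [List.countP_eq_length_filter, List.toFinset_card_of_nodup ((hnd i).filter _)]
      rw [h1, ← Finset.card_image_of_injective _ (hcinj i)]
      congr 1
      ext x
      simp only [Finset.mem_image, Finset.mem_filter, Finset.mem_univ, true_and,
        List.mem_toFinset, List.mem_filter]
      constructor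
      · rintro ⟨j, hj, rfl⟩
        exact ⟨List.getElem_mem _, hj⟩
      · rintro ⟨hx, hc⟩
        obtain ⟨j, hj, rfl⟩ := List.mem_iff_getElem.1 hx
        have hj' : j < n := by rw [hlen] at hj; exact hj
        have hjv : ((j : ℕ) : ZMod n).val = j := ZMod.val_cast_of_lt hj'
        have : c i (j : ZMod n) = (C i)[j] := by simp only [c, hjv]
        exact ⟨j, by rw [this]; exact hc, this⟩
    unfold IsEquitable
    rw [this]; exact heq i

inductive Kd | a | b | A | B | za | zb | w
  deriving DecidableEq

def vm {ℓ m : ℕ} {E : Type} (e : ZMod ℓ → E) (X Y Z : Fin m) :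
    Kd × ZMod ℓ → (Fin m × Bool × ZMod ℓ) ⊕ E
  | (.a, x) => .inl (X, false, x)
  | (.b, x) => .inl (X, true, x)
  | (.A, x) => .inl (Y, false, x)
  | (.B, x) => .inl (Y, true, x)
  | (.za, x) => .inl (Z, false, x)
  | (.zb, x) => .inl (Z, true, x)
  | (.w, x) => .inr (e x)

def kcol {ℓ : ℕ} (ρ κ : ZMod ℓ → Bool) : Kd × ZMod ℓ → Bool
  | (.a, x) => ρ x
  | (.b, x) => !ρ x
  | (.A, x) => ρ x
  | (.B, x) => !ρ x
  | (.za, x) => ρ x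
  | (.zb, x) => !ρ x
  | (.w, x) => κ x

structure Good {ℓ : ℕ} (ρ κ : ZMod ℓ → Bool) (k : ℕ) (L : List (Kd × ZMod ℓ)) : Prop where
  len : L.length = ℓ
  nd : L.Nodup
  zc : ∀ x, ((Kd.zb, x) ∈ L → (Kd.b, x) ∉ L ∧ (Kd.B, x) ∉ L) ∧
    ((Kd.za, x) ∈ L → (Kd.a, x) ∉ L ∧ (Kd.A, x) ∉ L)
  eq : L.countP (kcol ρ κ) = k ∨ L.countP (kcol ρ κ) = k + 1

theorem vm_col {ℓ m : ℕ} {E : Type} (e : ZMod ℓ → E) (X Y Z : Fin m) (ρ κ : ZMod ℓ → Bool)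
    (colE : E → Bool) (hκ : ∀ x, colE (e x) = κ x) (u : Kd × ZMod ℓ) :
    Sum.elim (fun p : Fin m × Bool × ZMod ℓ => if p.2.1 then !ρ p.2.2 else ρ p.2.2) colE
      (vm e X Y Z u) = kcol ρ κ u := by
  obtain ⟨c, x⟩ := u
  cases c <;> simp [vm, kcol, hκ]

def Covd {ι α : Type} (M : ι → List α) (u v : α) : Prop := ∃ i, Adj (M i) u v

theorem card_lt_pairs (m : ℕ) :
    2 * Fintype.card {p : Fin m × Fin m // p.1 < p.2} + m = m * m := by
  classical
  have h1 : Fintype.card {p : Fin m × Fin m // p.1 < p.2} =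
      Fintype.card {p : Fin m × Fin m // p.2 < p.1} :=
    Fintype.card_congr ((Equiv.prodComm _ _).subtypeEquiv (by simp))
  have h2 : (Finset.univ.filter fun p : Fin m × Fin m => p.1 < p.2).card +
      (Finset.univ.filter fun p : Fin m × Fin m => p.2 < p.1).card +
      (Finset.univ.filter fun p : Fin m × Fin m => p.1 = p.2).card = m * m := by
    rw [← Finset.card_union_of_disjoint, ← Finset.card_union_of_disjoint]
    · have : m * m = (Finset.univ : Finset (Fin m × Fin m)).card := by simp
      rw [this]
      congr 1
      ext p
      simp only [Finset.mem_union, Finset.mem_filter, Finset.mem_univ, true_and, iff_true]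
      rcases lt_trichotomy p.1 p.2 with h | h | h <;> simp [h]
    · rw [Finset.disjoint_left]; intro p
      simp only [Finset.mem_union, Finset.mem_filter, Finset.mem_univ, true_and]
      rintro (h | h) h' <;> simp [h'] at h
    · rw [Finset.disjoint_left]; intro p
      simp only [Finset.mem_filter, Finset.mem_univ, true_and]
      intro h h'; exact absurd h (not_lt.2 h'.le)
  have h3 : (Finset.univ.filter fun p : Fin m × Fin m => p.1 = p.2).card = m := by
    have : (Finset.univ.filter fun p : Fin m × Fin m => p.1 = p.2) =
        (Finset.univ : Finset (Fin m)).image (fun x => (x, x)) := by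
      ext ⟨x, y⟩; simp [Prod.ext_iff]
    rw [this, Finset.card_image_of_injective _ (fun x y h => (Prod.ext_iff.1 h).1)]; simp
  rw [Fintype.card_subtype] at h1 ⊢
  rw [Fintype.card_subtype] at h1
  omega

theorem vm_inj1 {ℓ m : ℕ} {E : Type} (e : ZMod ℓ → E) (X Y Z : Fin m) (hne : X ≠ Y)
    (L : List (Kd × ZMod ℓ)) (hw : ∀ x, (Kd.w, x) ∉ L)
    (zc : ∀ x, ((Kd.zb, x) ∈ L → (Kd.b, x) ∉ L ∧ (Kd.B, x) ∉ L) ∧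
      ((Kd.za, x) ∈ L → (Kd.a, x) ∉ L ∧ (Kd.A, x) ∉ L)) :
    ∀ u ∈ L, ∀ w ∈ L, vm e X Y Z u = vm e X Y Z w → u = w := by
  rintro ⟨c, x⟩ h1 ⟨c', y⟩ h2 h3
  have z1 := zc x
  have w1 := hw x
  have w2 := hw y
  clear zc hw
  cases c <;> cases c' <;>
    simp only [vm, Sum.inl.injEq, Prod.mk.injEq, reduceCtorEq, and_false, false_and] at h3 <;>
    first
    | exact absurd h1 w1
    | exact absurd h2 w2
    | (obtain ⟨h3, _, h4⟩ := h3; subst h4; first | rfl | exact absurd h3 hne | exact absurd h3.symm hne | tauto)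

theorem vm_inj2 {ℓ m : ℕ} {E : Type} (e : ZMod ℓ → E) (X Z : Fin m)
    (L : List (Kd × ZMod ℓ))
    (hw : ∀ x y, (Kd.w, x) ∈ L → (Kd.w, y) ∈ L → e x = e y → x = y)
    (hA : ∀ x, (Kd.A, x) ∉ L ∧ (Kd.B, x) ∉ L)
    (zc : ∀ x, ((Kd.zb, x) ∈ L → (Kd.b, x) ∉ L ∧ (Kd.B, x) ∉ L) ∧
      ((Kd.za, x) ∈ L → (Kd.a, x) ∉ L ∧ (Kd.A, x) ∉ L)) :
    ∀ u ∈ L, ∀ w ∈ L, vm e X X Z u = vm e X X Z w → u = w := by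
  rintro ⟨c, x⟩ h1 ⟨c', y⟩ h2 h3
  have z1 := zc x
  have w1 := hA x
  have w2 := hA y
  clear zc hA
  cases c <;> cases c' <;>
    simp only [vm, Sum.inl.injEq, Sum.inr.injEq, Prod.mk.injEq, reduceCtorEq, and_false,
      false_and] at h3 <;>
    first
    | exact congrArg _ (hw x y h1 h2 h3)
    | (obtain ⟨h3, _, h4⟩ := h3; subst h4; first | rfl | tauto)

theorem glue {k ℓ m v : ℕ} [NeZero ℓ] (hℓ : ℓ = 2 * k + 1) (hk : 1 ≤ k) {E ιM ι0 ι1 : Type}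
    [Fintype E] [Fintype ιM] [Fintype ι0] [Fintype ι1]
    (q : Fin m → Fin m → Fin m) (qc : ∀ X Y, q X Y = q Y X) (qs : ∀ X Z, ∃ Y, q X Y = Z)
    (e : ZMod ℓ → E) (ρ κ : ZMod ℓ → Bool) (colE : E → Bool) (hκ : ∀ x, colE (e x) = κ x)
    (M : ιM → List (Kd × ZMod ℓ)) (N : ι0 → List (Kd × ZMod ℓ)) (W : ι1 → List E)
    (D1 D2 : ZMod ℓ → Prop)
    (hM : ∀ i, Good ρ κ k (M i)) (hMw : ∀ i x, (Kd.w, x) ∉ M i)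
    (hN : ∀ i, Good ρ κ k (N i)) (hNA : ∀ i x, (Kd.A, x) ∉ N i ∧ (Kd.B, x) ∉ N i)
    (hNe : ∀ i x y, (Kd.w, x) ∈ N i → (Kd.w, y) ∈ N i → e x = e y → x = y)
    (hW : ∀ i, (W i).length = ℓ ∧ (W i).Nodup ∧
      ((W i).countP colE = k ∨ (W i).countP colE = k + 1))
    (caA : ∀ x y, Covd M (.a, x) (.A, y)) (cbB : ∀ x y, Covd M (.b, x) (.B, y))
    (caB : ∀ x y, ¬ D1 (y - x) → ¬ D2 (x - y) → Covd M (.a, x) (.B, y) ∧ Covd M (.A, x) (.b, y))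
    (caz : ∀ x y, D1 (y - x) → Covd M (.a, x) (.zb, y) ∧ Covd M (.A, x) (.zb, y))
    (cbz : ∀ x y, D2 (y - x) → Covd M (.b, x) (.za, y) ∧ Covd M (.B, x) (.za, y))
    (laa : ∀ x y, x ≠ y → Covd N (.a, x) (.a, y))
    (lbb : ∀ x y, x ≠ y → Covd N (.b, x) (.b, y))
    (lab : ∀ x y, ¬ D1 (y - x) → ¬ D2 (x - y) → Covd N (.a, x) (.b, y))
    (laz : ∀ x y, D1 (y - x) → Covd N (.a, x) (.zb, y))
    (lbz : ∀ x y, D2 (y - x) → Covd N (.b, x) (.za, y))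
    (law : ∀ x y, ∃ z, e z = y ∧ Covd N (.a, x) (.w, z))
    (lbw : ∀ x y, ∃ z, e z = y ∧ Covd N (.b, x) (.w, z))
    (lww : ∀ x y, x ≠ y → Covd W x y)
    (hv : 2 * ℓ * m + Fintype.card E = v)
    (hcM : Fintype.card ιM = 4 * ℓ)
    (hcard : (2 * ℓ * m * (m - 1) + m * Fintype.card ι0 + Fintype.card ι1) * ℓ = v.choose 2) :
    HasEquitable2Decomp (⊤ : SimpleGraph (Fin v)) ℓ := by
  classical
  let P := {p : Fin m × Fin m // p.1 < p.2}
  let f : P → _ := fun p => vm e p.1.1 p.1.2 (q p.1.1 p.1.2)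
  let g : Fin m → _ := fun X => vm e X X (q X X)
  let C : (P × ιM) ⊕ (Fin m × ι0) ⊕ ι1 → List ((Fin m × Bool × ZMod ℓ) ⊕ E) :=
    Sum.elim (fun p => (M p.2).map (f p.1))
      (Sum.elim (fun p => (N p.2).map (g p.1)) (fun i => (W i).map Sum.inr))
  have hcolM : ∀ (X Y Z : Fin m) (L : List (Kd × ZMod ℓ)),
      (L.map (vm e X Y Z)).countP (Sum.elim (fun p : Fin m × Bool × ZMod ℓ =>
        if p.2.1 then !ρ p.2.2 else ρ p.2.2) colE) = L.countP (kcol ρ κ) := by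
    intro X Y Z L
    rw [List.countP_map]
    congr 1
    funext u
    exact vm_col e X Y Z ρ κ colE hκ u
  have covM : ∀ (p : P) (u w : Kd × ZMod ℓ), Covd M u w → ∃ i, Adj (C i) (f p u) (f p w) := by
    rintro p u w ⟨i, hi⟩
    exact ⟨.inl (p, i), hi.map _⟩
  have covN : ∀ (X : Fin m) (u w : Kd × ZMod ℓ), Covd N u w → ∃ i, Adj (C i) (g X u) (g X w) := by
    rintro p u w ⟨i, hi⟩
    exact ⟨.inr (.inl (p, i)), hi.map _⟩
  have sym : ∀ {u w}, (∃ i, Adj (C i) u w) → ∃ i, Adj (C i) w u := fun ⟨i, h⟩ => ⟨i, h.symm⟩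
  have T1 : ∀ (X Z : Fin m) (x y : ZMod ℓ), D1 (y - x) →
      ∃ i, Adj (C i) (.inl (X, false, x)) (.inl (Z, true, y)) := by
    intro X Z x y h
    obtain ⟨Y, rfl⟩ := qs X Z
    rcases lt_trichotomy X Y with hl | rfl | hl
    · exact covM ⟨(X, Y), hl⟩ _ _ (caz x y h).1
    · exact covN X _ _ (laz x y h)
    · rw [qc]; exact covM ⟨(Y, X), hl⟩ _ _ (caz x y h).2
  have T2 : ∀ (X Z : Fin m) (x y : ZMod ℓ), D2 (y - x) →
      ∃ i, Adj (C i) (.inl (X, true, x)) (.inl (Z, false, y)) := by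
    intro X Z x y h
    obtain ⟨Y, rfl⟩ := qs X Z
    rcases lt_trichotomy X Y with hl | rfl | hl
    · exact covM ⟨(X, Y), hl⟩ _ _ (cbz x y h).1
    · exact covN X _ _ (lbz x y h)
    · rw [qc]; exact covM ⟨(Y, X), hl⟩ _ _ (cbz x y h).2
  have Tab : ∀ (X Y : Fin m) (x y : ZMod ℓ),
      ∃ i, Adj (C i) (.inl (X, false, x)) (.inl (Y, true, y)) := by
    intro X Y x y
    by_cases h1 : D1 (y - x)
    · exact T1 X Y x y h1
    by_cases h2 : D2 (x - y)
    · exact sym (T2 Y X y x h2)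
    rcases lt_trichotomy X Y with hl | rfl | hl
    · exact covM ⟨(X, Y), hl⟩ _ _ (caB x y h1 h2).1
    · exact covN X _ _ (lab x y h1 h2)
    · exact covM ⟨(Y, X), hl⟩ _ _ (caB x y h1 h2).2
  refine core ℓ v (by omega) C ?_ ?_ ?_ ?_ ?_
    (Sum.elim (fun p => if p.2.1 then !ρ p.2.2 else ρ p.2.2) colE) ?_
  · rintro (⟨p, i⟩ | ⟨X, i⟩ | i)
    · simp [C, (hM i).len]
    · simp [C, (hN i).len]
    · simp [C, (hW i).1]
  · rintro (⟨⟨⟨X, Y⟩, hXY⟩, i⟩ | ⟨X, i⟩ | i)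
    · exact List.Nodup.map_on (vm_inj1 e X Y _ hXY.ne _ (hMw i) (hM i).zc) (hM i).nd
    · exact List.Nodup.map_on (vm_inj2 e X _ _ (hNe i) (hNA i) (hN i).zc) (hN i).nd
    · exact (hW i).2.1.map Sum.inr_injective
  · rintro (⟨X, c, x⟩ | x) (⟨Y, c', y⟩ | y) hne
    · cases c <;> cases c'
      · rcases lt_trichotomy X Y with hl | rfl | hl
        · exact covM ⟨(X, Y), hl⟩ _ _ (caA x y)
        · exact covN X _ _ (laa x y (by rintro rfl; exact hne rfl))
        · exact sym (covM ⟨(Y, X), hl⟩ _ _ (caA y x))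
      · exact Tab X Y x y
      · exact sym (Tab Y X y x)
      · rcases lt_trichotomy X Y with hl | rfl | hl
        · exact covM ⟨(X, Y), hl⟩ _ _ (cbB x y)
        · exact covN X _ _ (lbb x y (by rintro rfl; exact hne rfl))
        · exact sym (covM ⟨(Y, X), hl⟩ _ _ (cbB y x))
    · cases c
      · obtain ⟨z, rfl, h⟩ := law x y
        exact covN X _ _ h
      · obtain ⟨z, rfl, h⟩ := lbw x y
        exact covN X _ _ h
    · cases c'
      · obtain ⟨z, rfl, h⟩ := law y x
        exact sym (covN Y _ _ h)
      · obtain ⟨z, rfl, h⟩ := lbw y x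
        exact sym (covN Y _ _ h)
    · obtain ⟨i, hi⟩ := lww x y (by rintro rfl; exact hne rfl)
      exact ⟨.inr (.inr i), hi.map _⟩
  · rw [← hv]
    simp only [Fintype.card_sum, Fintype.card_prod, Fintype.card_fin, Fintype.card_bool, ZMod.card]
    ring
  · rw [← hcard]
    congr 1
    simp only [Fintype.card_sum, Fintype.card_prod, Fintype.card_fin, hcM]
    have h := card_lt_pairs m
    change Fintype.card P * _ + _ = _
    change 2 * Fintype.card P + m = m * m at h
    have h2 : 2 * Fintype.card P = m * (m - 1) := by
      rw [Nat.mul_sub, mul_one]; omega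
    rw [← add_assoc]
    congr 2
    calc Fintype.card P * (4 * ℓ) = 2 * ℓ * (2 * Fintype.card P) := by ring
      _ = 2 * ℓ * m * (m - 1) := by rw [h2]; ring
  · have hd1 : ℓ / 2 = k := by omega
    have hd2 : (ℓ + 1) / 2 = k + 1 := by omega
    rw [hd1, hd2]
    rintro (⟨p, i⟩ | ⟨X, i⟩ | i)
    · change ((M i).map (vm e _ _ _)).countP _ = _ ∨ ((M i).map (vm e _ _ _)).countP _ = _
      rw [hcolM]; exact (hM i).eq
    · change ((N i).map (vm e _ _ _)).countP _ = _ ∨ ((N i).map (vm e _ _ _)).countP _ = _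
      rw [hcolM]; exact (hN i).eq
    · change ((W i).map Sum.inr).countP _ = _ ∨ ((W i).map Sum.inr).countP _ = _
      rw [List.countP_map]; exact (hW i).2.2

theorem infix_get {α : Type} {L : List α} {u v : α} (j : ℕ) (h1 : L[j]? = some u)
    (h2 : L[j + 1]? = some v) : [u, v] <:+: L := by
  obtain ⟨hj, h1⟩ := List.getElem?_eq_some_iff.1 h1
  obtain ⟨hj2, h2⟩ := List.getElem?_eq_some_iff.1 h2
  refine ⟨L.take j, L.drop (j + 2), ?_⟩
  rw [List.append_assoc]
  conv_rhs => rw [← List.take_append_drop j L]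
  congr 1
  rw [List.drop_eq_getElem_cons hj, List.drop_eq_getElem_cons hj2, h1, h2]
  rfl

def zig (p q : Kd) (x dx y dy : ℤ) : ℕ → List (Kd × ℤ)
  | 0 => []
  | N + 1 => (p, x) :: (q, y) :: zig p q (x + dx) dx (y + dy) dy N

theorem zig_len (p q : Kd) (x dx y dy : ℤ) (N : ℕ) : (zig p q x dx y dy N).length = 2 * N := by
  induction N generalizing x y with
  | zero => rfl
  | succ N ih => simp only [zig, List.length_cons, ih]; ring

theorem zig_all {P : Kd × ℤ → Prop} (p q : Kd) (x dx y dy : ℤ) (N : ℕ) :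
    (∀ u ∈ zig p q x dx y dy N, P u) ↔
      ∀ i : ℕ, i < N → P (p, x + dx * i) ∧ P (q, y + dy * i) := by
  induction N generalizing x y with
  | zero => simp [zig]
  | succ N ih =>
    simp only [zig, List.forall_mem_cons, ih]
    constructor
    · rintro ⟨h1, h2, h3⟩ i hi
      cases i with
      | zero => simpa using ⟨h1, h2⟩
      | succ i =>
        have := h3 i (by omega)
        rw [show x + dx * ((i + 1 : ℕ) : ℤ) = x + dx + dx * i by push_cast; ring,
          show y + dy * ((i + 1 : ℕ) : ℤ) = y + dy + dy * i by push_cast; ring]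
        exact this
    · intro h
      refine ⟨by simpa using (h 0 (by omega)).1, by simpa using (h 0 (by omega)).2, fun i hi => ?_⟩
      have := h (i + 1) (by omega)
      rwa [show x + dx * ((i + 1 : ℕ) : ℤ) = x + dx + dx * i by push_cast; ring,
          show y + dy * ((i + 1 : ℕ) : ℤ) = y + dy + dy * i by push_cast; ring] at this

theorem zig_mem {c : Kd} {z : ℤ} (p q : Kd) (x dx y dy : ℤ) (N : ℕ) :
    (c, z) ∈ zig p q x dx y dy N ↔
      ∃ i : ℕ, i < N ∧ ((c = p ∧ z = x + dx * i) ∨ (c = q ∧ z = y + dy * i)) := by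
  have := not_congr (zig_all (P := fun u => u ≠ (c, z)) p q x dx y dy N)
  simp only [not_forall, ne_eq, Prod.mk.injEq] at this
  constructor
  · intro h
    obtain ⟨i, hi, h⟩ := this.1 ⟨_, h, by simp⟩
    refine ⟨i, hi, ?_⟩
    by_contra hh
    apply h
    refine ⟨fun h' => hh (Or.inl ⟨h'.1.symm, h'.2.symm⟩), fun h' => hh (Or.inr ⟨h'.1.symm, h'.2.symm⟩)⟩
  · rintro ⟨i, hi, h⟩
    obtain ⟨u, hu, h⟩ := this.2 ⟨i, hi, fun h' => by
      rcases h with h | h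
      · exact h'.1 ⟨h.1.symm, h.2.symm⟩
      · exact h'.2 ⟨h.1.symm, h.2.symm⟩⟩
    simp only [not_not] at h
    exact h ▸ hu

theorem zig_nodup (p q : Kd) (x dx y dy : ℤ) (N : ℕ) (hx : dx ≠ 0) (hy : dy ≠ 0)
    (h : p ≠ q ∨ ∀ i j : ℕ, i < N → j < N → x + dx * i ≠ y + dy * j) :
    (zig p q x dx y dy N).Nodup := by
  have key : ∀ (d z : ℤ) (i : ℕ), d ≠ 0 → z ≠ z + d + d * i := by
    intro d z i hd h
    have : d * (1 + i) = 0 := by linarith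
    rcases mul_eq_zero.1 this with h | h
    · exact hd h
    · omega
  induction N generalizing x y with
  | zero => simp [zig]
  | succ N ih =>
    simp only [zig, List.nodup_cons, List.mem_cons, zig_mem, Prod.mk.injEq]
    refine ⟨?_, ?_, ih _ _ ?_⟩
    · rintro (⟨h1, h2⟩ | ⟨i, hi, ⟨h1, h2⟩ | ⟨h1, h2⟩⟩)
      · rcases h with h | h
        · exact h h1
        · exact h 0 0 (by omega) (by omega) (by simpa using h2)
      · exact key _ _ _ hx h2
      · rcases h with h | h
        · exact h h1
        · exact h 0 (i + 1) (by omega) (by omega) (by push_cast; linarith)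
    · rintro ⟨i, hi, ⟨h1, h2⟩ | ⟨h1, h2⟩⟩
      · rcases h with h | h
        · exact h h1.symm
        · exact h (i + 1) 0 (by omega) (by omega) (by push_cast; linarith)
      · exact key _ _ _ hy h2
    · rcases h with h | h
      · exact Or.inl h
      · right
        intro i j hi hj h'
        exact h (i + 1) (j + 1) (by omega) (by omega) (by push_cast; linarith)

theorem zig_e1 (p q : Kd) (x dx y dy : ℤ) (N : ℕ) (i : ℕ) (hi : i < N) :
    [(p, x + dx * i), (q, y + dy * i)] <:+: zig p q x dx y dy N := by
  induction N generalizing x y i with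
  | zero => omega
  | succ N ih =>
    simp only [zig]
    cases i with
    | zero =>
      simp only [Nat.cast_zero, mul_zero, add_zero]
      exact ⟨[], _, rfl⟩
    | succ i =>
      rw [show x + dx * ((i + 1 : ℕ) : ℤ) = x + dx + dx * i by push_cast; ring,
          show y + dy * ((i + 1 : ℕ) : ℤ) = y + dy + dy * i by push_cast; ring]
      obtain ⟨s, t, h⟩ := ih (x + dx) (y + dy) i (by omega)
      exact ⟨(p, x) :: (q, y) :: s, t, by rw [← h]; rfl⟩

theorem zig_e2 (p q : Kd) (x dx y dy : ℤ) (N : ℕ) (i : ℕ) (hi : i ≤ N) :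
    [(q, y - dy + dy * i), (p, x + dx * i)] <:+:
      [(q, y - dy)] ++ zig p q x dx y dy N ++ [(p, x + dx * N)] := by
  induction N generalizing x y i with
  | zero =>
    have : i = 0 := by omega
    subst this
    simp [zig]
  | succ N ih =>
    simp only [zig]
    cases i with
    | zero =>
      simp only [Nat.cast_zero, mul_zero, add_zero]
      exact ⟨[], _, rfl⟩
    | succ i =>
      obtain ⟨s, t, h⟩ := ih (x + dx) (y + dy) i (by omega)
      refine ⟨(q, y - dy) :: (p, x) :: s, t, ?_⟩
      rw [show x + dx * ((i + 1 : ℕ) : ℤ) = x + dx + dx * i by push_cast; ring,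
          show y - dy + dy * ((i + 1 : ℕ) : ℤ) = y + dy - dy + dy * i by push_cast; ring]
      have h2 : [(q, y - dy)] ++ (p, x) :: (q, y) :: zig p q (x + dx) dx (y + dy) dy N ++
          [(p, x + dx * ((N + 1 : ℕ) : ℤ))] = (q, y - dy) :: (p, x) ::
          ([(q, y + dy - dy)] ++ zig p q (x + dx) dx (y + dy) dy N ++
          [(p, x + dx + dx * (N : ℤ))]) := by
        rw [show x + dx * ((N + 1 : ℕ) : ℤ) = x + dx + dx * N by push_cast; ring,
          show y + dy - dy = y by ring]
        rfl
      rw [h2, ← h]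
      simp only [List.cons_append]

theorem zig_sum (f : Kd × ℤ → ℤ) (p q : Kd) (x dx y dy : ℤ) (N : ℕ) :
    ((zig p q x dx y dy N).map f).sum =
      ∑ i ∈ Finset.range N, f (p, x + dx * i) + ∑ i ∈ Finset.range N, f (q, y + dy * i) := by
  induction N generalizing x y with
  | zero => simp [zig]
  | succ N ih =>
    simp only [zig, List.map_cons, List.sum_cons, ih, Finset.sum_range_succ', Nat.cast_zero,
      mul_zero, add_zero]
    have h (z d : ℤ) (i : ℕ) : z + d * ((i + 1 : ℕ) : ℤ) = z + d + d * i := by push_cast; ring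
    simp only [h]
    ring

theorem cast_inj_win {ℓ : ℕ} (c x y : ℤ) (hx : c ≤ x ∧ x < c + ℓ) (hy : c ≤ y ∧ y < c + ℓ)
    (h : (x : ZMod ℓ) = (y : ZMod ℓ)) : x = y := by
  rw [ZMod.intCast_eq_intCast_iff_dvd_sub] at h
  obtain ⟨q, hq⟩ := h
  have h1 : -(1 : ℤ) < q := by nlinarith
  have h2 : q < 1 := by nlinarith
  have : q = 0 := by omega
  subst this
  omega

theorem walecki (k ℓ : ℕ) [NeZero ℓ] (hℓ : ℓ = 2 * k + 1) (hk : 1 ≤ k) :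
    ∃ W : Fin k → List (ZMod ℓ), (∀ i, (W i).length = ℓ ∧ (W i).Nodup) ∧
      ∀ x y, x ≠ y → Covd W x y := by
  have hmod : ∀ z : ℤ, 0 ≤ z % (2 * k) ∧ z % (2 * k) < 2 * k := fun z =>
    ⟨Int.emod_nonneg _ (by omega), Int.emod_lt_of_pos _ (by omega)⟩
  let E : Kd × ℤ → ZMod ℓ := fun u => ((u.2 % (2 * k) : ℤ) : ZMod ℓ)
  have hE : ∀ c c' x y, x % (2 * (k : ℤ)) = y → E (c, x) = E (c', y) := by
    intro c c' x y h; simp only [E]; rw [← h, Int.emod_emod]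
  let W : Fin k → List (ZMod ℓ) := fun t =>
    ((2 * k : ℤ) : ZMod ℓ) :: (zig .a .a (t : ℤ) (-1) (t + 1) 1 k).map E
  have hbad : ∀ u, E u ≠ ((2 * k : ℤ) : ZMod ℓ) := by
    intro u h
    have := hmod u.2
    have := cast_inj_win 0 _ _ (by omega) (by omega) h
    omega
  refine ⟨W, fun t => ⟨?_, ?_⟩, ?_⟩
  · simp only [W, List.length_cons, List.length_map, zig_len, hℓ]
  · simp only [W, List.nodup_cons, List.mem_map, not_exists, not_and]
    refine ⟨fun u _ => hbad u, ?_⟩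
    apply List.Nodup.map_on
    · have hall := (zig_all (P := fun u => u.1 = .a ∧ t - k + 1 ≤ u.2 ∧ u.2 ≤ t + k) .a .a (t : ℤ) (-1) (t + 1) 1 k).2
        (fun i hi => ⟨⟨rfl, by omega⟩, ⟨rfl, by omega⟩⟩)
      rintro ⟨c, x⟩ hx ⟨c', y⟩ hy h
      have h1 := hall _ hx
      have h2 := hall _ hy
      simp only at h1 h2
      have := hmod x
      have := hmod y
      have h3 := cast_inj_win 0 (x % (2 * k)) (y % (2 * k)) (by omega) (by omega) h
      have h4 : x = y := by
        have e1 := Int.emod_add_mul_ediv x (2 * k)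
        have e2 := Int.emod_add_mul_ediv y (2 * k)
        set q1 := x / (2 * (k : ℤ))
        set q2 := y / (2 * (k : ℤ))
        have h5 : x - y = 2 * k * (q1 - q2) := by linarith
        have h6 : q1 - q2 < 1 := by nlinarith
        have h7 : -1 < q1 - q2 := by nlinarith
        have : q1 - q2 = 0 := by omega
        rw [this] at h5; omega
      rw [h1.1, h2.1, h4]
    · apply zig_nodup
      · omega
      · omega
      · right; intros; omega
  · -- adjacency facts
    have A0 : ∀ t : Fin k, Adj (W t) ((2 * k : ℤ) : ZMod ℓ) (E (.a, t)) := by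
      intro t
      obtain ⟨k', rfl⟩ : ∃ k', k = k' + 1 := ⟨k - 1, by omega⟩
      left
      exact ⟨[], _, rfl⟩
    have A1 : ∀ (t : Fin k), Adj (W t) ((2 * k : ℤ) : ZMod ℓ) (E (.a, t + k)) := by
      intro t
      right
      simp only [W, List.take_succ_cons, List.take_zero]
      have h := zig_e1 .a .a (t : ℤ) (-1) (t + 1) 1 k (k - 1) (by omega)
      have hlen := zig_len .a .a (t : ℤ) (-1) (t + 1) 1 k
      have hl : ∃ Z, zig .a .a (t : ℤ) (-1) (t + 1) 1 k = Z ++ [(.a, (t : ℤ) + k)] := by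
        have gen : ∀ (N : ℕ) (x y : ℤ), ∃ Z, zig .a .a x (-1) y 1 (N + 1) = Z ++ [(.a, y + N)] := by
          intro N
          induction N with
          | zero => intro x y; exact ⟨[(.a, x)], by simp [zig]⟩
          | succ N ih =>
            intro x y
            obtain ⟨Z, hZ⟩ := ih (x + -1) (y + 1)
            refine ⟨(.a, x) :: (.a, y) :: Z, ?_⟩
            rw [zig, hZ]
            simp only [List.cons_append]
            rw [show y + 1 + (N : ℤ) = y + ((N + 1 : ℕ) : ℤ) by push_cast; ring]
        obtain ⟨Z, hZ⟩ := gen (k - 1) t (t + 1)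
        rw [show k - 1 + 1 = k by omega, show (t : ℤ) + 1 + ((k - 1 : ℕ) : ℤ) = t + k by omega] at hZ
        exact ⟨Z, hZ⟩
      obtain ⟨Z, hZ⟩ := hl
      rw [hZ, List.map_append]
      exact ⟨((2 * k : ℤ) : ZMod ℓ) :: Z.map E, [], by simp⟩
    have A2 : ∀ (t : Fin k) (j : ℕ), j < k → Adj (W t) (E (.a, t - j)) (E (.a, t + 1 + j)) := by
      intro t j hj
      left
      have h := (zig_e1 .a .a (t : ℤ) (-1) (t + 1) 1 k j hj).map E
      simp only [List.map_cons, List.map_nil] at h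
      rw [show (t : ℤ) + -1 * j = t - j by ring, show (t : ℤ) + 1 + 1 * j = t + 1 + j by ring] at h
      exact h.trans ⟨[((2 * k : ℤ) : ZMod ℓ)], [((2 * k : ℤ) : ZMod ℓ)], by simp [W]⟩
    have A3 : ∀ (t : Fin k) (j : ℕ), 0 < j → j < k → Adj (W t) (E (.a, t + j)) (E (.a, t - j)) := by
      intro t j hj0 hj
      left
      obtain ⟨k', hk'⟩ : ∃ k', k = k' + 1 := ⟨k - 1, by omega⟩
      have hz : zig .a .a (t : ℤ) (-1) (t + 1) 1 k =
          (.a, (t : ℤ)) :: (.a, (t : ℤ) + 1) :: zig .a .a ((t : ℤ) + -1) (-1) (t + 1 + 1) 1 k' := by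
        have : ∀ T : ℤ, zig .a .a T (-1) (T + 1) 1 k =
          (.a, T) :: (.a, T + 1) :: zig .a .a (T + -1) (-1) (T + 1 + 1) 1 k' := by
          intro T; rw [hk']; rfl
        exact this _
      obtain ⟨s, r, h⟩ := zig_e2 .a .a ((t : ℤ) + -1) (-1) (t + 1 + 1) 1 k' (j - 1) (by omega)
      rw [show (t : ℤ) + 1 + 1 - 1 + 1 * ((j - 1 : ℕ) : ℤ) = t + j by omega,
        show (t : ℤ) + -1 + -1 * ((j - 1 : ℕ) : ℤ) = t - j by omega] at h
      rcases List.eq_nil_or_concat r with hr | ⟨r', e, hr⟩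
      · subst hr
        -- the pair is at the end, impossible index unless j = k
        exfalso
        rw [List.append_nil] at h
        have h2 := congrArg List.getLast? h
        simp only [List.getLast?_append, List.getLast?_cons_cons, List.getLast?_singleton] at h2
        simp at h2
        omega
      · rw [List.concat_eq_append] at hr
        subst hr
        rw [← List.append_assoc] at h
        have h2 := (List.append_inj' h rfl).1
        have : [(Kd.a, (t : ℤ) + j), (Kd.a, t - j)] <:+: zig .a .a (t : ℤ) (-1) (t + 1) 1 k := by
          refine ⟨(.a, (t : ℤ)) :: s, r', ?_⟩
          rw [hz]
          simp only [List.cons_append, h2]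
          simp
        have h := this.map E
        exact h.trans ⟨[((2 * k : ℤ) : ZMod ℓ)], [((2 * k : ℤ) : ZMod ℓ)], by simp [W]⟩
    have inf : ∀ z : ℤ, 0 ≤ z → z < 2 * k → Covd W ((2 * k : ℤ) : ZMod ℓ) (E (.a, z)) := by
      intro z h0 h1
      by_cases h : z < k
      · have := A0 ⟨z.toNat, by omega⟩
        simp only [Int.toNat_of_nonneg h0] at this
        exact ⟨_, this⟩
      · have := A1 ⟨(z - k).toNat, by omega⟩
        simp only [Int.toNat_of_nonneg (show 0 ≤ z - k by omega), sub_add_cancel] at this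
        exact ⟨_, this⟩
    have fin : ∀ x y : ℤ, 0 ≤ x → x < y → y < 2 * k → Covd W (E (.a, x)) (E (.a, y)) := by
      intro x y hx hxy hy
      -- s = x + y; t with 2t or 2t+1 ≡ s
      have sw : ∀ (p q p' q' : ℤ), p % (2 * k) = p' → q % (2 * k) = q' → (t : Fin k) →
          Adj (W t) (E (.a, p)) (E (.a, q)) → Adj (W t) (E (.a, p')) (E (.a, q')) := by
        intro p q p' q' h1 h2 t h
        rw [← hE .a .a p p' h1, ← hE .a .a q q' h2]; exact h
      have m0 : ∀ z : ℤ, 0 ≤ z → z < 2 * k → z % (2 * k) = z := fun z h1 h2 => Int.emod_eq_of_lt h1 h2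
      have m1 : ∀ z : ℤ, 0 ≤ z → z < 2 * k → (z - 2 * k) % (2 * k) = z := fun z h1 h2 => by
        rw [Int.sub_emod_right]; exact m0 z h1 h2
      have m2 : ∀ z : ℤ, 0 ≤ z → z < 2 * k → (z + 2 * k) % (2 * k) = z := fun z h1 h2 => by
        rw [Int.add_emod_right]; exact m0 z h1 h2
      rcases Int.even_or_odd' (x + y) with ⟨s, hs | hs⟩
      · by_cases h : s < k
        · refine ⟨⟨s.toNat, by omega⟩, ?_⟩
          refine (sw (s + (y - s)) (s - (y - s)) y x ?_ ?_ _ ?_).symm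
          · rw [show s + (y - s) = y by ring]; exact m0 _ (by omega) hy
          · rw [show s - (y - s) = x by omega]; exact m0 _ hx (by omega)
          · have := A3 ⟨s.toNat, by omega⟩ (y - s).toNat (by omega) (by omega)
            simpa only [Int.toNat_of_nonneg (show 0 ≤ y - s by omega), Int.toNat_of_nonneg (show 0 ≤ s by omega)] using this
        · -- t = s - k; labels x = t + j', need y - s = d; t + (k - d) = s - d = x ; t - (k-d) = s + d - 2k = y - 2k
          refine ⟨⟨(s - k).toNat, by omega⟩, ?_⟩
          refine (sw (s - k + (k - (y - s))) (s - k - (k - (y - s))) x y ?_ ?_ _ ?_)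
          · rw [show s - k + (k - (y - s)) = x by omega]; exact m0 _ (by omega) (by omega)
          · rw [show s - k - (k - (y - s)) = y - 2 * k by omega]; exact m1 _ (by omega) (by omega)
          · have := A3 ⟨(s - k).toNat, by omega⟩ (k - (y - s)).toNat (by omega) (by omega)
            simpa only [Int.toNat_of_nonneg (show 0 ≤ k - (y - s) by omega), Int.toNat_of_nonneg (show 0 ≤ s - k by omega)] using this
      · by_cases h : s < k
        · refine ⟨⟨s.toNat, by omega⟩, ?_⟩
          refine (sw (s - (s - x)) (s + 1 + (s - x)) x y ?_ ?_ _ ?_)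
          · rw [show s - (s - x) = x by ring]; exact m0 _ (by omega) (by omega)
          · rw [show s + 1 + (s - x) = y by omega]; exact m0 _ (by omega) hy
          · have := A2 ⟨s.toNat, by omega⟩ (s - x).toNat (by omega)
            simpa only [Int.toNat_of_nonneg (show 0 ≤ s - x by omega), Int.toNat_of_nonneg (show 0 ≤ s by omega)] using this
        · -- t = s - k ; t - j = y - 2k, t+1+j = x + ... : j = s + k - y ; t + 1 + j = 2 s + 1 - y = x
          refine ⟨⟨(s - k).toNat, by omega⟩, ?_⟩
          refine (sw (s - k - (s + k - y)) (s - k + 1 + (s + k - y)) y x ?_ ?_ _ ?_).symm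
          · rw [show s - k - (s + k - y) = y - 2 * k by ring]; exact m1 _ (by omega) (by omega)
          · rw [show s - k + 1 + (s + k - y) = x by omega]; exact m0 _ (by omega) (by omega)
          · have := A2 ⟨(s - k).toNat, by omega⟩ (s + k - y).toNat (by omega)
            simpa only [Int.toNat_of_nonneg (show 0 ≤ s + k - y by omega), Int.toNat_of_nonneg (show 0 ≤ s - k by omega)] using this
    have rep : ∀ x : ZMod ℓ, x = ((2 * k : ℤ) : ZMod ℓ) ∨ ∃ z : ℤ, 0 ≤ z ∧ z < 2 * k ∧ x = E (.a, z) := by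
      intro x
      have hv := ZMod.val_lt x
      have hx : ((x.val : ℤ) : ZMod ℓ) = x := by simp
      by_cases h : x.val = 2 * k
      · left; rw [← hx, h]; push_cast; rfl
      · right
        refine ⟨x.val, by omega, by omega, ?_⟩
        simp only [E]
        rw [Int.emod_eq_of_lt (by omega) (by omega), hx]
    intro x y hxy
    rcases rep x with rfl | ⟨z, h0, h1, rfl⟩ <;> rcases rep y with rfl | ⟨z', h0', h1', rfl⟩
    · exact absurd rfl hxy
    · exact inf _ h0' h1'
    · obtain ⟨i, h⟩ := inf _ h0 h1; exact ⟨i, h.symm⟩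
    · rcases lt_trichotomy z z' with h | h | h
      · exact fin _ _ h0 h h1'
      · subst h; exact absurd rfl hxy
      · obtain ⟨i, h⟩ := fin _ _ h0' h h1; exact ⟨i, h.symm⟩

def sh {ℓ : ℕ} (g : Bool) (t : ZMod ℓ) (u : Kd × ZMod ℓ) : Kd × ZMod ℓ :=
  (u.1, if u.1 = Kd.w ∧ g = false then u.2 else u.2 + t)

theorem sh_inj {ℓ : ℕ} (g : Bool) (t : ZMod ℓ) : Function.Injective (sh g t) := by
  rintro ⟨c, x⟩ ⟨c', y⟩ h
  simp only [sh, Prod.mk.injEq] at h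
  obtain ⟨rfl, h⟩ := h
  by_cases hc : c = Kd.w ∧ g = false
  · simp only [hc, and_self, if_true] at h ⊢; rw [h]
  · simp only [hc, if_false, add_left_inj] at h; rw [h]

structure BG {ℓ : ℕ} (ρ κ : ZMod ℓ → Bool) (k : ℕ) (g : Bool) (L : List (Kd × ZMod ℓ)) : Prop where
  len : L.length = ℓ
  nd : L.Nodup
  zc : ∀ x, ((Kd.zb, x) ∈ L → (Kd.b, x) ∉ L ∧ (Kd.B, x) ∉ L) ∧
    ((Kd.za, x) ∈ L → (Kd.a, x) ∉ L ∧ (Kd.A, x) ∉ L)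
  eq : ∀ t, (L.map (sh g t)).countP (kcol ρ κ) = k ∨ (L.map (sh g t)).countP (kcol ρ κ) = k + 1

theorem mem_sh {ℓ : ℕ} (g : Bool) (t : ZMod ℓ) (L : List (Kd × ZMod ℓ)) (c : Kd) (x : ZMod ℓ)
    (hc : c ≠ .w) : (c, x) ∈ L.map (sh g t) ↔ (c, x - t) ∈ L := by
  rw [List.mem_map]
  constructor
  · rintro ⟨⟨c', y⟩, h, h'⟩
    simp only [sh, Prod.mk.injEq] at h'
    obtain ⟨rfl, h'⟩ := h'
    simp only [hc, false_and, if_false] at h'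
    rw [← h', add_sub_cancel_right]; exact h
  · intro h
    exact ⟨_, h, by simp [sh, hc]⟩

theorem mem_sh_w {ℓ : ℕ} (g : Bool) (t : ZMod ℓ) (L : List (Kd × ZMod ℓ)) (x : ZMod ℓ)
    (h : (Kd.w, x) ∈ L.map (sh g t)) : ∃ y, (Kd.w, y) ∈ L ∧ (g = false → y = x) := by
  obtain ⟨⟨c', y⟩, h, h'⟩ := List.mem_map.1 h
  simp only [sh, Prod.mk.injEq] at h'
  obtain ⟨rfl, h'⟩ := h'
  refine ⟨y, h, ?_⟩
  rintro rfl
  simpa using h'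

theorem BG.good {ℓ : ℕ} {ρ κ : ZMod ℓ → Bool} {k : ℕ} {g : Bool} {L : List (Kd × ZMod ℓ)}
    (h : BG ρ κ k g L) (t : ZMod ℓ) : Good ρ κ k (L.map (sh g t)) where
  len := by rw [List.length_map, h.len]
  nd := h.nd.map (sh_inj g t)
  zc x := by
    simp only [mem_sh g t L _ x (by decide : Kd.zb ≠ .w), mem_sh g t L _ x (by decide : Kd.za ≠ .w),
      mem_sh g t L _ x (by decide : Kd.a ≠ .w), mem_sh g t L _ x (by decide : Kd.b ≠ .w),
      mem_sh g t L _ x (by decide : Kd.A ≠ .w), mem_sh g t L _ x (by decide : Kd.B ≠ .w)]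
    exact h.zc _
  eq := h.eq t

theorem Good.kappa {ℓ : ℕ} {ρ κ κ' : ZMod ℓ → Bool} {k : ℕ} {L : List (Kd × ZMod ℓ)}
    (h : Good ρ κ k L) (hw : ∀ x, (Kd.w, x) ∉ L) : Good ρ κ' k L where
  len := h.len
  nd := h.nd
  zc := h.zc
  eq := by
    have : L.countP (kcol ρ κ') = L.countP (kcol ρ κ) := by
      apply List.countP_congr
      rintro ⟨c, x⟩ hx
      cases c <;> first | exact absurd hx (hw x) | simp [kcol]
    rw [this]; exact h.eq

def Cv {ℓ : ℕ} {β : Type} (B : β → List (Kd × ZMod ℓ)) (p q : Kd) (δ : ZMod ℓ) : Prop :=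
  ∃ i x y, Adj (B i) (p, x) (q, y) ∧ y - x = δ

def fam {ℓ : ℕ} {β : Type} (g : Bool) (B : β → List (Kd × ZMod ℓ)) :
    β × ZMod ℓ → List (Kd × ZMod ℓ) := fun p => (B p.1).map (sh g p.2)

theorem Cv.covd {ℓ : ℕ} {β : Type} {B : β → List (Kd × ZMod ℓ)} {p q : Kd} (g : Bool)
    (hp : g = true ∨ p ≠ .w) (hq : g = true ∨ q ≠ .w)
    {x y : ZMod ℓ} (h : Cv B p q (y - x)) : Covd (fam g B) (p, x) (q, y) := by
  obtain ⟨i, x', y', h, h'⟩ := h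
  refine ⟨(i, x - x'), ?_⟩
  have := h.map (sh g (x - x'))
  have h1 : sh g (x - x') (p, x') = (p, x) := by
    rcases hp with hp | hp <;> simp [sh, hp]
  have h2 : sh g (x - x') (q, y') = (q, y) := by
    have : y' + (x - x') = y := by linear_combination h'
    rcases hq with hq | hq <;> simp [sh, hq, this]
  rw [h1, h2] at this
  exact this

structure MainD {ℓ : ℕ} (ρ : ZMod ℓ → Bool) (k : ℕ) (D1 D2 : List (ZMod ℓ))
    (B : Fin 4 → List (Kd × ZMod ℓ)) : Prop where
  good : ∀ i, BG ρ ρ k true (B i)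
  nw : ∀ i x, (Kd.w, x) ∉ B i
  aA : ∀ δ, Cv B .a .A δ
  bB : ∀ δ, Cv B .b .B δ
  aB : ∀ δ, δ ∉ D1 → -δ ∉ D2 → Cv B .a .B δ ∧ Cv B .A .b δ
  az : ∀ δ, δ ∈ D1 → Cv B .a .zb δ ∧ Cv B .A .zb δ
  bz : ∀ δ, δ ∈ D2 → Cv B .b .za δ ∧ Cv B .B .za δ

structure L1D {ℓ : ℕ} (ρ : ZMod ℓ → Bool) (k : ℕ) (D1 D2 : List (ZMod ℓ)) (f f' : ZMod ℓ)
    (B : Fin 2 → List (Kd × ZMod ℓ)) : Prop where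
  good : ∀ i, BG ρ (fun _ => false) k false (B i)
  nA : ∀ i x, (Kd.A, x) ∉ B i ∧ (Kd.B, x) ∉ B i
  w0 : ∀ i x, (Kd.w, x) ∈ B i → x = 0
  ff : f * f' = 1
  aa : ∀ δ, δ ≠ 0 → δ = f ∨ δ = -f ∨ Cv B .a .a δ
  bb : ∀ δ, δ ≠ 0 → Cv B .b .b δ
  ab : ∀ δ, δ ∉ D1 → -δ ∉ D2 → Cv B .a .b δ
  az : ∀ δ, δ ∈ D1 → Cv B .a .zb δ
  bz : ∀ δ, δ ∈ D2 → Cv B .b .za δ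
  aw : ∃ i x, Adj (B i) (.a, x) (.w, 0)
  bw : ∃ i x, Adj (B i) (.b, x) (.w, 0)

structure LLD {ℓ : ℕ} (ρ : ZMod ℓ → Bool) (k : ℕ) (D1 D2 : List (ZMod ℓ))
    (B : Fin 3 → List (Kd × ZMod ℓ)) : Prop where
  good : ∀ i, BG ρ ρ k true (B i)
  nA : ∀ i x, (Kd.A, x) ∉ B i ∧ (Kd.B, x) ∉ B i
  ab : ∀ δ, δ ∉ D1 → -δ ∉ D2 → Cv B .a .b δ
  az : ∀ δ, δ ∈ D1 → Cv B .a .zb δ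
  bz : ∀ δ, δ ∈ D2 → Cv B .b .za δ
  aw : ∀ δ, Cv B .a .w δ
  bw : ∀ δ, Cv B .b .w δ

theorem col_count {ℓ k : ℕ} [NeZero ℓ] (ρ : ZMod ℓ → Bool)
    (hρ : (Finset.univ.filter fun x => ρ x = true).card = k) (L : List (ZMod ℓ))
    (hl : L.length = ℓ) (hn : L.Nodup) : L.countP ρ = k := by
  have h : L.toFinset = Finset.univ := by
    rw [← Finset.card_eq_iff_eq_univ, List.toFinset_card_of_nodup hn, hl, ZMod.card]
  rw [← hρ, List.countP_eq_length_filter, ← List.toFinset_card_of_nodup (hn.filter _)]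
  congr 1
  ext x
  have hx : x ∈ L := by rw [← List.mem_toFinset, h]; exact Finset.mem_univ x
  simp [hx]

theorem col_good {ℓ k : ℕ} [NeZero ℓ] (hℓ : ℓ = 2 * k + 1) (ρ κ : ZMod ℓ → Bool)
    (hρ : (Finset.univ.filter fun x => ρ x = true).card = k) (L : List (ZMod ℓ))
    (hl : L.length = ℓ) (hn : L.Nodup) (s : Bool) :
    Good ρ κ k (L.map fun x => (if s then Kd.a else Kd.b, x)) where
  len := by rw [List.length_map, hl]
  nd := hn.map (fun x y h => (Prod.ext_iff.1 h).2)
  zc x := by cases s <;> simp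
  eq := by
    have h := col_count ρ hρ L hl hn
    rw [List.countP_map]
    cases s
    · right
      have h2 := List.length_eq_countP_add_countP ρ (l := L)
      have h3 : L.countP (kcol ρ κ ∘ fun x => (if false = true then Kd.a else Kd.b, x)) =
          L.countP (fun a => decide ¬ρ a = true) := by
        congr 1; funext x; simp [kcol]
      rw [h3]; omega
    · left
      rw [← h]; congr 1

theorem fcyc_adj {ℓ : ℕ} [NeZero ℓ] (f f' : ZMod ℓ) (hf : f * f' = 1) (x : ZMod ℓ) :
    Adj ((List.range ℓ).map fun i : ℕ => f * (i : ZMod ℓ)) x (x + f) := by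
  have hpos : 0 < ℓ := Nat.pos_of_ne_zero (NeZero.ne ℓ)
  have h : ((List.range ℓ).map fun i : ℕ => f * (i : ZMod ℓ)) ++
      ((List.range ℓ).map fun i : ℕ => f * (i : ZMod ℓ)).take 1 =
      (List.range (ℓ + 1)).map fun i : ℕ => f * (i : ZMod ℓ) := by
    rw [List.range_succ, List.map_append]
    congr 1
    obtain ⟨l, rfl⟩ : ∃ l, ℓ = l + 1 := ⟨ℓ - 1, by omega⟩
    rw [List.range_succ_eq_map]
    simp
  left
  rw [h]
  have hv : (((f' * x).val : ℕ) : ZMod ℓ) = f' * x := ZMod.natCast_zmod_val _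
  have hlt : (f' * x).val < ℓ := ZMod.val_lt _
  refine infix_get (f' * x).val ?_ ?_
  · rw [List.getElem?_map, List.getElem?_range (by omega)]
    simp only [Option.map_some, Option.some.injEq]
    rw [hv]; linear_combination x * hf
  · rw [List.getElem?_map, List.getElem?_range (by omega)]
    simp only [Option.map_some, Option.some.injEq]
    push_cast
    rw [hv]; linear_combination x * hf

theorem fcyc_nodup {ℓ : ℕ} [NeZero ℓ] (f f' : ZMod ℓ) (hf : f * f' = 1) :
    ((List.range ℓ).map fun i : ℕ => f * (i : ZMod ℓ)).Nodup := by
  refine List.Nodup.map_on ?_ List.nodup_range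
  intro i hi j hj h
  rw [List.mem_range] at hi hj
  have : (i : ZMod ℓ) = j := by
    linear_combination f' * h + (j - i) * hf
  have := congrArg ZMod.val this
  rwa [ZMod.val_cast_of_lt hi, ZMod.val_cast_of_lt hj] at this

theorem exists_q (m : ℕ) : ∃ q : Fin m → Fin m → Fin m, (∀ X Y, q X Y = q Y X) ∧
    ∀ X Z, ∃ Y, q X Y = Z := by
  cases m with
  | zero => exact ⟨fun X _ => X, fun X => X.elim0, fun X => X.elim0⟩
  | succ m => exact ⟨fun X Y => X + Y, add_comm, fun X Z => ⟨Z - X, add_sub_cancel X Z⟩⟩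

theorem final1 {k ℓ : ℕ} [NeZero ℓ] (hℓ : ℓ = 2 * k + 1) (hk : 1 ≤ k) (ρ : ZMod ℓ → Bool)
    (hρ : (Finset.univ.filter fun x => ρ x = true).card = k) (D1 D2 : List (ZMod ℓ))
    (f f' : ZMod ℓ) (B : Fin 4 → List (Kd × ZMod ℓ)) (B1 : Fin 2 → List (Kd × ZMod ℓ))
    (hB : MainD ρ k D1 D2 B) (h1 : L1D ρ k D1 D2 f f' B1) (m : ℕ) :
    HasEquitable2Decomp (⊤ : SimpleGraph (Fin (2 * ℓ * m + 1))) ℓ := by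
  obtain ⟨q, qc, qs⟩ := exists_q m
  let F : List (ZMod ℓ) := (List.range ℓ).map fun i : ℕ => f * (i : ZMod ℓ)
  let N : (Fin 2 × ZMod ℓ) ⊕ Unit → List (Kd × ZMod ℓ) :=
    Sum.elim (fam false B1) (fun _ => F.map fun x => (if true then Kd.a else Kd.b, x))
  have cN : ∀ {u v}, Covd (fam false B1) u v → Covd N u v := fun ⟨i, h⟩ => ⟨.inl i, h⟩
  have hsub : ∀ x y : ZMod ℓ, y - x ∉ D1 → x - y ∉ D2 → y - x ∉ D1 ∧ -(y - x) ∉ D2 := by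
    intro x y h h'; rw [neg_sub]; exact ⟨h, h'⟩
  have hfam : ∀ x y, Covd (fam false B1) (Kd.a, x) (.w, 0) ∧ Covd (fam false B1) (Kd.b, y) (.w, 0) := by
    intro x y
    constructor
    · obtain ⟨i, z, h⟩ := h1.aw
      exact ⟨(i, x - z), by simpa [sh, fam] using h.map (sh false (x - z))⟩
    · obtain ⟨i, z, h⟩ := h1.bw
      exact ⟨(i, y - z), by simpa [sh, fam] using h.map (sh false (y - z))⟩
  refine glue (ιM := Fin 4 × ZMod ℓ) (E := Unit) (ι1 := Empty) hℓ hk q qc qs (fun _ => ()) ρ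
    (fun _ => false) (fun _ => false)
    (fun _ => rfl) (fam true B) N (fun i => i.elim) (· ∈ D1) (· ∈ D2) ?_ ?_ ?_ ?_ ?_ ?_ ?_ ?_ ?_ ?_ ?_ ?_ ?_ ?_
    ?_ ?_ ?_ ?_ ?_ ?_ ?_ ?_
  · intro i
    refine ((hB.good i.1).good i.2).kappa ?_
    intro x hx
    obtain ⟨y, hy, _⟩ := mem_sh_w _ _ _ _ hx
    exact hB.nw _ _ hy
  · intro i x hx
    obtain ⟨y, hy, _⟩ := mem_sh_w _ _ _ _ hx
    exact hB.nw _ _ hy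
  · rintro (i | i)
    · exact (h1.good i.1).good i.2
    · exact col_good hℓ ρ _ hρ F (by simp [F]) (fcyc_nodup f f' h1.ff) true
  · rintro (i | i) x
    · simp only [N, Sum.elim_inl, fam, mem_sh _ _ _ _ x (by decide : Kd.A ≠ .w),
        mem_sh _ _ _ _ x (by decide : Kd.B ≠ .w)]
      exact h1.nA _ _
    · simp [N]
  · rintro (i | i) x y hx hy _
    · obtain ⟨x', hx, hx'⟩ := mem_sh_w _ _ _ _ hx
      obtain ⟨y', hy, hy'⟩ := mem_sh_w _ _ _ _ hy
      rw [← hx' rfl, ← hy' rfl, h1.w0 _ _ hx, h1.w0 _ _ hy]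
    · simp [N] at hx
  · intro i; exact i.elim
  · intro x y; exact (hB.aA _).covd true (.inl rfl) (.inl rfl)
  · intro x y; exact (hB.bB _).covd true (.inl rfl) (.inl rfl)
  · intro x y h h'
    have := hB.aB _ (hsub x y h h').1 (hsub x y h h').2
    exact ⟨this.1.covd true (.inl rfl) (.inl rfl), this.2.covd true (.inl rfl) (.inl rfl)⟩
  · intro x y h
    exact ⟨(hB.az _ h).1.covd true (.inl rfl) (.inl rfl), (hB.az _ h).2.covd true (.inl rfl) (.inl rfl)⟩
  · intro x y h
    exact ⟨(hB.bz _ h).1.covd true (.inl rfl) (.inl rfl), (hB.bz _ h).2.covd true (.inl rfl) (.inl rfl)⟩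
  · intro x y hne
    rcases h1.aa (y - x) (fun h => hne (sub_eq_zero.1 h).symm) with h | h | h
    · refine ⟨.inr (), ?_⟩
      have := (fcyc_adj f f' h1.ff x).map fun x => (if true then Kd.a else Kd.b, x)
      have h2 : x + f = y := by rw [← h]; ring
      rw [h2] at this
      exact this
    · refine ⟨.inr (), ?_⟩
      have := (fcyc_adj f f' h1.ff y).map fun x => (if true then Kd.a else Kd.b, x)
      have h2 : y + f = x := by linear_combination h
      rw [h2] at this
      exact this.symm
    · exact cN (h.covd false (.inr (by decide)) (.inr (by decide)))
  · intro x y hne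
    exact cN ((h1.bb (y - x) (fun h => hne (sub_eq_zero.1 h).symm)).covd false
      (.inr (by decide)) (.inr (by decide)))
  · intro x y h h'
    exact cN ((h1.ab _ (hsub x y h h').1 (hsub x y h h').2).covd false
      (.inr (by decide)) (.inr (by decide)))
  · intro x y h
    exact cN ((h1.az _ h).covd false (.inr (by decide)) (.inr (by decide)))
  · intro x y h
    exact cN ((h1.bz _ h).covd false (.inr (by decide)) (.inr (by decide)))
  · intro x y; exact ⟨0, rfl, cN (hfam x x).1⟩
  · intro x y; exact ⟨0, rfl, cN (hfam x x).2⟩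
  · intro x y h; exact absurd rfl h
  · simp
  · simp [ZMod.card]
  · simp only [Fintype.card_sum, Fintype.card_prod, Fintype.card_fin, ZMod.card, Fintype.card_unit,
      Fintype.card_empty, Nat.choose_two_right, Nat.add_sub_cancel]
    have h3 : (2 * ℓ * m + 1) * (2 * ℓ * m) / 2 = (2 * ℓ * m + 1) * (ℓ * m) := by
      rw [show (2 * ℓ * m + 1) * (2 * ℓ * m) = 2 * ((2 * ℓ * m + 1) * (ℓ * m)) by ring]
      exact Nat.mul_div_cancel_left _ (by norm_num)
    rw [h3]
    cases m with
    | zero => simp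
    | succ m => simp only [Nat.add_sub_cancel]; ring

theorem finall {k ℓ : ℕ} [NeZero ℓ] (hℓ : ℓ = 2 * k + 1) (hk : 1 ≤ k) (ρ : ZMod ℓ → Bool)
    (hρ : (Finset.univ.filter fun x => ρ x = true).card = k) (D1 D2 : List (ZMod ℓ))
    (B : Fin 4 → List (Kd × ZMod ℓ)) (B1 : Fin 3 → List (Kd × ZMod ℓ))
    (hB : MainD ρ k D1 D2 B) (h1 : LLD ρ k D1 D2 B1) (m : ℕ) :
    HasEquitable2Decomp (⊤ : SimpleGraph (Fin (2 * ℓ * m + ℓ))) ℓ := by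
  obtain ⟨q, qc, qs⟩ := exists_q m
  obtain ⟨W, hW, hWc⟩ := walecki k ℓ hℓ hk
  let N : (Fin 3 × ZMod ℓ) ⊕ (Bool × Fin k) → List (Kd × ZMod ℓ) :=
    Sum.elim (fam true B1) (fun p => (W p.2).map fun x => (if p.1 then Kd.a else Kd.b, x))
  have cN : ∀ {u v}, Covd (fam true B1) u v → Covd N u v := fun ⟨i, h⟩ => ⟨.inl i, h⟩
  have hsub : ∀ x y : ZMod ℓ, y - x ∉ D1 → x - y ∉ D2 → y - x ∉ D1 ∧ -(y - x) ∉ D2 := by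
    intro x y h h'; rw [neg_sub]; exact ⟨h, h'⟩
  refine glue (ιM := Fin 4 × ZMod ℓ) (E := ZMod ℓ) (ι1 := Fin k) hℓ hk q qc qs id ρ
    ρ ρ
    (fun _ => rfl) (fam true B) N W (· ∈ D1) (· ∈ D2) ?_ ?_ ?_ ?_ ?_ ?_ ?_ ?_ ?_ ?_ ?_ ?_ ?_ ?_
    ?_ ?_ ?_ ?_ ?_ ?_ ?_ ?_
  · intro i
    exact (hB.good i.1).good i.2
  · intro i x hx
    obtain ⟨y, hy, _⟩ := mem_sh_w _ _ _ _ hx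
    exact hB.nw _ _ hy
  · rintro (i | i)
    · exact (h1.good i.1).good i.2
    · exact col_good hℓ ρ _ hρ (W i.2) (hW _).1 (hW _).2 i.1
  · rintro (i | ⟨s, i⟩) x
    · simp only [N, Sum.elim_inl, fam, mem_sh _ _ _ _ x (by decide : Kd.A ≠ .w),
        mem_sh _ _ _ _ x (by decide : Kd.B ≠ .w)]
      exact h1.nA _ _
    · cases s <;> simp [N]
  · rintro i x y hx hy h; exact h
  · intro i; exact ⟨(hW i).1, (hW i).2, .inl (col_count ρ hρ _ (hW i).1 (hW i).2)⟩
  · intro x y; exact (hB.aA _).covd true (.inl rfl) (.inl rfl)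
  · intro x y; exact (hB.bB _).covd true (.inl rfl) (.inl rfl)
  · intro x y h h'
    have := hB.aB _ (hsub x y h h').1 (hsub x y h h').2
    exact ⟨this.1.covd true (.inl rfl) (.inl rfl), this.2.covd true (.inl rfl) (.inl rfl)⟩
  · intro x y h
    exact ⟨(hB.az _ h).1.covd true (.inl rfl) (.inl rfl), (hB.az _ h).2.covd true (.inl rfl) (.inl rfl)⟩
  · intro x y h
    exact ⟨(hB.bz _ h).1.covd true (.inl rfl) (.inl rfl), (hB.bz _ h).2.covd true (.inl rfl) (.inl rfl)⟩
  · intro x y hne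
    obtain ⟨i, hi⟩ := hWc x y hne
    exact ⟨.inr (true, i), hi.map _⟩
  · intro x y hne
    obtain ⟨i, hi⟩ := hWc x y hne
    exact ⟨.inr (false, i), hi.map _⟩
  · intro x y h h'
    exact cN ((h1.ab _ (hsub x y h h').1 (hsub x y h h').2).covd true (.inl rfl) (.inl rfl))
  · intro x y h
    exact cN ((h1.az _ h).covd true (.inl rfl) (.inl rfl))
  · intro x y h
    exact cN ((h1.bz _ h).covd true (.inl rfl) (.inl rfl))
  · intro x y; exact ⟨y, rfl, cN ((h1.aw _).covd true (.inl rfl) (.inl rfl))⟩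
  · intro x y; exact ⟨y, rfl, cN ((h1.bw _).covd true (.inl rfl) (.inl rfl))⟩
  · exact hWc
  · simp [ZMod.card]
  · simp [ZMod.card]
  · simp only [Fintype.card_sum, Fintype.card_prod, Fintype.card_fin, ZMod.card, Fintype.card_bool,
      Nat.choose_two_right]
    have h3 : (2 * ℓ * m + ℓ) * (2 * ℓ * m + ℓ - 1) / 2 = ℓ * (2 * m + 1) * (ℓ * m + k) := by
      have : 2 * ℓ * m + ℓ - 1 = 2 * (ℓ * m + k) := by
        rw [mul_add, ← mul_assoc]; omega
      rw [this, show (2 * ℓ * m + ℓ) * (2 * (ℓ * m + k)) =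
        2 * (ℓ * (2 * m + 1) * (ℓ * m + k)) by ring]
      exact Nat.mul_div_cancel_left _ (by norm_num)
    rw [h3]
    cases m with
    | zero => simp; ring
    | succ m => simp only [Nat.add_sub_cancel]; ring

def cvb {ℓ n : ℕ} (B : Fin n → List (Kd × ZMod ℓ)) (p q : Kd) (δ : ZMod ℓ) : Bool :=
  (List.finRange n).any fun i => ((B i).zip ((B i).tail ++ (B i).take 1)).any fun e =>
    (e.1.1 = p && e.2.1 = q && e.2.2 - e.1.2 = δ) || (e.2.1 = p && e.1.1 = q && e.1.2 - e.2.2 = δ)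

theorem cvb_adj {α : Type} (L : List α) (u v : α) (h : (u, v) ∈ L.zip (L.tail ++ L.take 1)) :
    Adj L u v := by
  left
  obtain ⟨j, hj, h⟩ := List.mem_iff_getElem.1 h
  rw [List.getElem_zip, Prod.mk.injEq] at h
  obtain ⟨h1, h2⟩ := h
  rw [List.length_zip] at hj
  have hj1 : j < L.length := by omega
  apply infix_get j
  · rw [List.getElem?_append_left hj1, List.getElem?_eq_getElem hj1, h1]
  · cases L with
    | nil => simp at hj1
    | cons c L =>
      rw [List.cons_append, List.getElem?_cons_succ, List.getElem?_eq_some_iff]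
      exact ⟨_, h2⟩

theorem cvb_cv {ℓ n : ℕ} {B : Fin n → List (Kd × ZMod ℓ)} {p q : Kd} {δ : ZMod ℓ}
    (h : cvb B p q δ = true) : Cv B p q δ := by
  simp only [cvb, List.any_eq_true, Bool.or_eq_true, Bool.and_eq_true, decide_eq_true_eq] at h
  obtain ⟨i, _, ⟨⟨c, x⟩, ⟨c', y⟩⟩, hm, h⟩ := h
  rcases h with ⟨⟨rfl, rfl⟩, h⟩ | ⟨⟨rfl, rfl⟩, h⟩
  · exact ⟨i, x, y, cvb_adj _ _ _ hm, h⟩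
  · exact ⟨i, y, x, (cvb_adj _ _ _ hm).symm, h⟩

def bgb {ℓ : ℕ} (ρ κ : ZMod ℓ → Bool) (k : ℕ) (g : Bool) (L : List (Kd × ZMod ℓ)) : Prop :=
  L.length = ℓ ∧ L.Nodup ∧ (∀ u ∈ L, (u.1 = .zb → (.b, u.2) ∉ L ∧ (.B, u.2) ∉ L) ∧
    (u.1 = .za → (.a, u.2) ∉ L ∧ (.A, u.2) ∉ L)) ∧
  ∀ t, (L.map (sh g t)).countP (kcol ρ κ) = k ∨ (L.map (sh g t)).countP (kcol ρ κ) = k + 1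

theorem bgb_bg {ℓ : ℕ} {ρ κ : ZMod ℓ → Bool} {k : ℕ} {g : Bool} {L : List (Kd × ZMod ℓ)}
    (h : bgb ρ κ k g L) : BG ρ κ k g L :=
  ⟨h.1, h.2.1, fun _ => ⟨fun h' => (h.2.2.1 _ h').1 rfl, fun h' => (h.2.2.1 _ h').2 rfl⟩, h.2.2.2⟩

instance {ℓ : ℕ} [NeZero ℓ] (ρ κ : ZMod ℓ → Bool) (k : ℕ) (g : Bool) (L : List (Kd × ZMod ℓ)) :
    Decidable (bgb ρ κ k g L) := by unfold bgb; infer_instance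

theorem mem_none {ℓ n : ℕ} {B : Fin n → List (Kd × ZMod ℓ)} {c : Kd}
    (h : ∀ i, ∀ u ∈ B i, u.1 ≠ c) (i : Fin n) (x : ZMod ℓ) : (c, x) ∉ B i :=
  fun h' => h i _ h' rfl

/-- The colour class used for all large parameters. -/
def rho (k ℓ : ℕ) : ZMod ℓ → Bool := fun i => decide ((4 * i).val < k)

def rlo (k ℓ : ℕ) : ZMod ℓ → Bool := fun i => decide (i.val < k)

def mB3 : Fin 4 → List (Kd × ZMod 7) :=
  ![[(.A, 0), (.b, 3), (.A, 1), (.zb, 0), (.a, 6), (.B, 6), (.a, 4)],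
    [(.b, 0), (.B, 5), (.b, 2), (.B, 3), (.b, 4), (.B, 1), (.za, 3)],
    [(.a, 0), (.A, 4), (.zb, 5), (.a, 6), (.A, 5), (.a, 3), (.A, 1)],
    [(.B, 0), (.b, 5), (.za, 0), (.B, 4), (.b, 4), (.A, 4), (.a, 4)]]

theorem mD3 : MainD (rlo 3 7) 3 [1, 6] [2, 3] mB3 where
  good i := bgb_bg (by revert i; decide +kernel)
  nw := mem_none (by decide +kernel)
  aA δ := cvb_cv (by revert δ; decide +kernel)
  bB δ := cvb_cv (by revert δ; decide +kernel)
  aB δ h1 h2 := ⟨cvb_cv (by revert δ; decide +kernel), cvb_cv (by revert δ; decide +kernel)⟩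
  az δ h1 := ⟨cvb_cv (by revert δ; decide +kernel), cvb_cv (by revert δ; decide +kernel)⟩
  bz δ h1 := ⟨cvb_cv (by revert δ; decide +kernel), cvb_cv (by revert δ; decide +kernel)⟩

def uB3 : Fin 2 → List (Kd × ZMod 7) :=
  ![[(.a, 0), (.a, 5), (.b, 1), (.b, 5), (.za, 1), (.b, 6), (.b, 0)],
    [(.b, 0), (.b, 5), (.w, 0), (.a, 6), (.a, 0), (.zb, 6), (.a, 5)]]

def wB3 : Fin 3 → List (Kd × ZMod 7) :=
  ![[(.b, 0), (.za, 3), (.b, 1), (.w, 0), (.a, 1), (.w, 5), (.a, 0)],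
    [(.b, 0), (.w, 3), (.b, 5), (.w, 6), (.b, 2), (.a, 0), (.w, 2)],
    [(.a, 0), (.zb, 1), (.a, 2), (.b, 5), (.w, 5), (.a, 5), (.w, 1)]]

theorem uD3 : L1D (rlo 3 7) 3 [1, 6] [2, 3] 3 5 uB3 where
  good i := bgb_bg (by revert i; decide +kernel)
  nA i x := ⟨mem_none (by decide +kernel) i x, mem_none (by decide +kernel) i x⟩
  w0 i x h := by
    have : ∀ i, ∀ u ∈ uB3 i, u.1 = .w → u.2 = 0 := by decide +kernel
    exact this i _ h rfl
  ff := by decide +kernel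
  aa δ h := by
    have : ∀ δ : ZMod 7, δ ≠ 0 → δ = 3 ∨ δ = -3 ∨ cvb uB3 .a .a δ = true := by decide +kernel
    rcases this δ h with h | h | h
    · exact Or.inl h
    · exact Or.inr (Or.inl h)
    · exact Or.inr (Or.inr (cvb_cv h))
  bb δ h := cvb_cv (by revert δ; decide +kernel)
  ab δ h1 h2 := cvb_cv (by revert δ; decide +kernel)
  az δ h := cvb_cv (by revert δ; decide +kernel)
  bz δ h := cvb_cv (by revert δ; decide +kernel)
  aw := by decide +kernel
  bw := by decide +kernel

theorem wD3 : LLD (rlo 3 7) 3 [1, 6] [2, 3] wB3 where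
  good i := bgb_bg (by revert i; decide +kernel)
  nA i x := ⟨mem_none (by decide +kernel) i x, mem_none (by decide +kernel) i x⟩
  ab δ h1 h2 := cvb_cv (by revert δ; decide +kernel)
  az δ h := cvb_cv (by revert δ; decide +kernel)
  bz δ h := cvb_cv (by revert δ; decide +kernel)
  aw δ := cvb_cv (by revert δ; decide +kernel)
  bw δ := cvb_cv (by revert δ; decide +kernel)

def mB4 : Fin 4 → List (Kd × ZMod 9) :=
  ![[(.b, 0), (.A, 6), (.a, 6), (.A, 2), (.a, 5), (.B, 5), (.b, 6), (.za, 0), (.B, 6)],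
    [(.B, 0), (.za, 2), (.b, 0), (.B, 1), (.a, 7), (.A, 1), (.a, 0), (.B, 2), (.b, 7)],
    [(.b, 0), (.B, 0), (.b, 4), (.A, 0), (.b, 2), (.A, 2), (.zb, 1), (.a, 0), (.A, 4)],
    [(.b, 0), (.B, 7), (.a, 3), (.A, 1), (.a, 2), (.zb, 1), (.A, 0), (.a, 7), (.B, 3)]]

theorem mD4 : MainD (rlo 4 9) 4 [1, 8] [2, 3] mB4 where
  good i := bgb_bg (by revert i; decide +kernel)
  nw := mem_none (by decide +kernel)
  aA δ := cvb_cv (by revert δ; decide +kernel)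
  bB δ := cvb_cv (by revert δ; decide +kernel)
  aB δ h1 h2 := ⟨cvb_cv (by revert δ; decide +kernel), cvb_cv (by revert δ; decide +kernel)⟩
  az δ h1 := ⟨cvb_cv (by revert δ; decide +kernel), cvb_cv (by revert δ; decide +kernel)⟩
  bz δ h1 := ⟨cvb_cv (by revert δ; decide +kernel), cvb_cv (by revert δ; decide +kernel)⟩

def uB4 : Fin 2 → List (Kd × ZMod 9) :=
  ![[(.b, 0), (.b, 7), (.w, 0), (.a, 6), (.b, 6), (.b, 5), (.a, 0), (.a, 5), (.a, 7)],
    [(.b, 0), (.b, 5), (.za, 7), (.b, 4), (.b, 7), (.a, 4), (.zb, 3), (.a, 2), (.a, 5)]]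

def wB4 : Fin 3 → List (Kd × ZMod 9) :=
  ![[(.a, 0), (.w, 0), (.b, 7), (.w, 5), (.a, 4), (.w, 8), (.b, 0), (.a, 5), (.b, 5)],
    [(.a, 0), (.w, 5), (.a, 8), (.b, 1), (.w, 2), (.a, 3), (.w, 1), (.a, 7), (.zb, 8)],
    [(.b, 0), (.w, 6), (.b, 3), (.w, 7), (.b, 7), (.za, 0), (.b, 6), (.a, 3), (.w, 5)]]

theorem uD4 : L1D (rlo 4 9) 4 [1, 8] [2, 3] 1 1 uB4 where
  good i := bgb_bg (by revert i; decide +kernel)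
  nA i x := ⟨mem_none (by decide +kernel) i x, mem_none (by decide +kernel) i x⟩
  w0 i x h := by
    have : ∀ i, ∀ u ∈ uB4 i, u.1 = .w → u.2 = 0 := by decide +kernel
    exact this i _ h rfl
  ff := by decide +kernel
  aa δ h := by
    have : ∀ δ : ZMod 9, δ ≠ 0 → δ = 1 ∨ δ = -1 ∨ cvb uB4 .a .a δ = true := by decide +kernel
    rcases this δ h with h | h | h
    · exact Or.inl h
    · exact Or.inr (Or.inl h)
    · exact Or.inr (Or.inr (cvb_cv h))
  bb δ h := cvb_cv (by revert δ; decide +kernel)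
  ab δ h1 h2 := cvb_cv (by revert δ; decide +kernel)
  az δ h := cvb_cv (by revert δ; decide +kernel)
  bz δ h := cvb_cv (by revert δ; decide +kernel)
  aw := by decide +kernel
  bw := by decide +kernel

theorem wD4 : LLD (rlo 4 9) 4 [1, 8] [2, 3] wB4 where
  good i := bgb_bg (by revert i; decide +kernel)
  nA i x := ⟨mem_none (by decide +kernel) i x, mem_none (by decide +kernel) i x⟩
  ab δ h1 h2 := cvb_cv (by revert δ; decide +kernel)
  az δ h := cvb_cv (by revert δ; decide +kernel)
  bz δ h := cvb_cv (by revert δ; decide +kernel)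
  aw δ := cvb_cv (by revert δ; decide +kernel)
  bw δ := cvb_cv (by revert δ; decide +kernel)

def mB5 : Fin 4 → List (Kd × ZMod 11) :=
  ![[(.a, 0), (.A, 10), (.a, 1), (.B, 1), (.b, 4), (.B, 6), (.b, 7), (.B, 10), (.za, 7), (.b, 0), (.A, 6)],
    [(.b, 0), (.B, 6), (.a, 9), (.A, 6), (.b, 1), (.A, 10), (.zb, 9), (.a, 8), (.A, 1), (.b, 8), (.A, 0)],
    [(.a, 0), (.B, 7), (.a, 1), (.zb, 0), (.A, 10), (.a, 5), (.B, 3), (.b, 5), (.B, 1), (.a, 7), (.A, 3)],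
    [(.B, 0), (.a, 9), (.A, 0), (.a, 10), (.A, 10), (.b, 8), (.za, 5), (.B, 9), (.b, 5), (.B, 10), (.b, 10)]]

theorem mD5 : MainD (rho 5 11) 5 [-1, 1] [-3, -4] mB5 where
  good i := bgb_bg (by revert i; decide +kernel)
  nw := mem_none (by decide +kernel)
  aA δ := cvb_cv (by revert δ; decide +kernel)
  bB δ := cvb_cv (by revert δ; decide +kernel)
  aB δ h1 h2 := ⟨cvb_cv (by revert δ; decide +kernel), cvb_cv (by revert δ; decide +kernel)⟩
  az δ h1 := ⟨cvb_cv (by revert δ; decide +kernel), cvb_cv (by revert δ; decide +kernel)⟩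
  bz δ h1 := ⟨cvb_cv (by revert δ; decide +kernel), cvb_cv (by revert δ; decide +kernel)⟩

def mB6 : Fin 4 → List (Kd × ZMod 13) :=
  ![[(.b, 0), (.B, 5), (.b, 11), (.B, 0), (.b, 7), (.A, 9), (.a, 0), (.A, 12), (.a, 7), (.B, 9), (.a, 11), (.zb, 12), (.A, 0)],
    [(.A, 0), (.a, 10), (.B, 4), (.b, 9), (.A, 2), (.a, 9), (.A, 7), (.b, 0), (.A, 8), (.b, 10), (.B, 7), (.za, 4), (.b, 8)],
    [(.B, 0), (.a, 7), (.A, 9), (.a, 2), (.zb, 1), (.A, 0), (.b, 10), (.A, 1), (.a, 6), (.B, 2), (.b, 6), (.B, 7), (.b, 9)],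
    [(.B, 0), (.b, 1), (.B, 4), (.b, 4), (.za, 1), (.B, 5), (.a, 0), (.A, 4), (.a, 4), (.A, 5), (.a, 8), (.B, 3), (.a, 3)]]

theorem mD6 : MainD (rho 6 13) 6 [-1, 1] [-3, -4] mB6 where
  good i := bgb_bg (by revert i; decide +kernel)
  nw := mem_none (by decide +kernel)
  aA δ := cvb_cv (by revert δ; decide +kernel)
  bB δ := cvb_cv (by revert δ; decide +kernel)
  aB δ h1 h2 := ⟨cvb_cv (by revert δ; decide +kernel), cvb_cv (by revert δ; decide +kernel)⟩
  az δ h1 := ⟨cvb_cv (by revert δ; decide +kernel), cvb_cv (by revert δ; decide +kernel)⟩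
  bz δ h1 := ⟨cvb_cv (by revert δ; decide +kernel), cvb_cv (by revert δ; decide +kernel)⟩

def mB7 : Fin 4 → List (Kd × ZMod 15) :=
  ![[(.b, 0), (.A, 3), (.a, 0), (.A, 10), (.a, 6), (.zb, 7), (.A, 8), (.a, 12), (.A, 11), (.b, 11), (.B, 10), (.a, 7), (.B, 3), (.b, 12), (.B, 8)],
    [(.b, 0), (.B, 13), (.b, 3), (.B, 7), (.a, 12), (.B, 14), (.b, 5), (.za, 14), (.B, 4), (.a, 0), (.A, 13), (.a, 7), (.A, 4), (.b, 12), (.A, 5)],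
    [(.a, 0), (.A, 7), (.b, 3), (.B, 4), (.b, 7), (.za, 2), (.B, 8), (.b, 8), (.B, 11), (.a, 4), (.B, 2), (.a, 8), (.A, 8), (.a, 3), (.B, 0)],
    [(.B, 0), (.b, 13), (.A, 11), (.zb, 12), (.a, 13), (.A, 0), (.a, 6), (.A, 7), (.b, 11), (.B, 3), (.a, 10), (.A, 3), (.b, 6), (.A, 12), (.b, 10)]]

theorem mD7 : MainD (rho 7 15) 7 [-1, 1] [-5, -6] mB7 where
  good i := bgb_bg (by revert i; decide +kernel)
  nw := mem_none (by decide +kernel)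
  aA δ := cvb_cv (by revert δ; decide +kernel)
  bB δ := cvb_cv (by revert δ; decide +kernel)
  aB δ h1 h2 := ⟨cvb_cv (by revert δ; decide +kernel), cvb_cv (by revert δ; decide +kernel)⟩
  az δ h1 := ⟨cvb_cv (by revert δ; decide +kernel), cvb_cv (by revert δ; decide +kernel)⟩
  bz δ h1 := ⟨cvb_cv (by revert δ; decide +kernel), cvb_cv (by revert δ; decide +kernel)⟩

/-- Contribution of a vertex to the number of red vertices. -/
def vz (r : ℤ → ℤ) (κ : ℤ) : Kd × ℤ → ℤ
  | (.a, x) => r x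
  | (.b, x) => 1 - r x
  | (.A, x) => r x
  | (.B, x) => 1 - r x
  | (.za, x) => r x
  | (.zb, x) => 1 - r x
  | (.w, x) => κ * r x

/-- Labels of integer lists are sent to residues after scaling by `s`. -/
def lift (ℓ : ℕ) (s : ZMod ℓ) (u : Kd × ℤ) : Kd × ZMod ℓ := (u.1, s * (u.2 : ZMod ℓ))

/-- Integer version of goodness. -/
structure ZG (k : ℕ) (ℓ : ℕ) (c : ℤ) (L : List (Kd × ℤ)) : Prop where
  len : L.length = ℓ
  nd : L.Nodup
  win : ∀ u ∈ L, c ≤ u.2 ∧ u.2 < c + ℓ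
  zc : ∀ u ∈ L, ∀ v ∈ L, u.2 = v.2 → ¬ (u.1 = .zb ∧ (v.1 = .b ∨ v.1 = .B)) ∧
    ¬ (u.1 = .za ∧ (v.1 = .a ∨ v.1 = .A))

def bi (b : Bool) : ℤ := if b then 1 else 0

theorem lift_inj {ℓ : ℕ} {s s' : ZMod ℓ} (hs : s * s' = 1) {c x y : ℤ}
    (hx : c ≤ x ∧ x < c + ℓ) (hy : c ≤ y ∧ y < c + ℓ)
    (h : s * (x : ZMod ℓ) = s * (y : ZMod ℓ)) : x = y := by
  apply cast_inj_win c _ _ hx hy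
  have : s' * (s * (x : ZMod ℓ)) = s' * (s * (y : ZMod ℓ)) := by rw [h]
  linear_combination this - ((x : ZMod ℓ) - (y : ZMod ℓ)) * hs

theorem ZG.bg {k ℓ : ℕ} {c : ℤ} {L : List (Kd × ℤ)} (h : ZG k ℓ c L) (ρ κ : ZMod ℓ → Bool)
    (g : Bool) (s s' : ZMod ℓ) (hs : s * s' = 1) (kz : ℤ)
    (hκ : (g = true ∧ κ = ρ ∧ kz = 1) ∨ (g = false ∧ κ = (fun _ => false) ∧ kz = 0))
    (eq : ∀ t : ZMod ℓ, (L.map (vz (fun x => bi (ρ (s * x + t))) kz)).sum = k ∨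
      (L.map (vz (fun x => bi (ρ (s * x + t))) kz)).sum = k + 1) :
    BG ρ κ k g (L.map (lift ℓ s)) where
  len := by rw [List.length_map, h.len]
  nd := by
    apply List.Nodup.map_on _ h.nd
    rintro ⟨p, x⟩ hx ⟨q, y⟩ hy h'
    simp only [lift, Prod.mk.injEq] at h'
    have e : x = y := lift_inj hs (h.win _ hx) (h.win _ hy) h'.2
    rw [h'.1, e]
  zc x := by
    have key : ∀ p q, (p, x) ∈ L.map (lift ℓ s) → (q, x) ∈ L.map (lift ℓ s) →
        ∃ z, (p, z) ∈ L ∧ (q, z) ∈ L := by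
      intro p q hp hq
      obtain ⟨⟨p', y⟩, hy, h1⟩ := List.mem_map.1 hp
      obtain ⟨⟨q', z⟩, hz, h2⟩ := List.mem_map.1 hq
      simp only [lift, Prod.mk.injEq] at h1 h2
      obtain ⟨rfl, h1⟩ := h1
      obtain ⟨rfl, h2⟩ := h2
      have : y = z := lift_inj hs (h.win _ hy) (h.win _ hz) (h1.trans h2.symm)
      exact ⟨y, hy, by rw [this]; exact hz⟩
    refine ⟨fun h1 => ⟨fun h2 => ?_, fun h2 => ?_⟩, fun h1 => ⟨fun h2 => ?_, fun h2 => ?_⟩⟩ <;>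
    · obtain ⟨z, hz1, hz2⟩ := key _ _ h1 h2
      have := h.zc _ hz1 _ hz2 rfl
      simp at this
  eq t := by
    have key : (((L.map (lift ℓ s)).map (sh g t)).countP (kcol ρ κ) : ℤ) =
        (L.map (vz (fun x => bi (ρ (s * x + t))) kz)).sum := by
      clear h eq
      induction L with
      | nil => simp
      | cons u L ih =>
        simp only [List.map_cons, List.countP_cons, List.sum_cons]
        push_cast
        rw [ih, add_comm]
        congr 1
        obtain ⟨p, x⟩ := u
        rcases hκ with ⟨hg, h1, h2⟩ | ⟨hg, h1, h2⟩ <;> rw [h1, h2, hg] <;>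
          cases p <;> simp only [lift, sh, vz, kcol, bi] <;>
          cases h : ρ (s * (x : ZMod ℓ) + t) <;> simp [h]
    have := eq t
    rw [← key] at this
    exact_mod_cast this

/-- Integer version of `Cv`. -/
def Cz (ℓ : ℕ) {n : ℕ} (B : Fin n → List (Kd × ℤ)) (s : Fin n → ZMod ℓ) (p q : Kd) (d : ZMod ℓ) : Prop :=
  ∃ i x y, Adj (B i) (p, x) (q, y) ∧ s i * ((y - x : ℤ) : ZMod ℓ) = d

theorem Cz.cv {ℓ n : ℕ} {B : Fin n → List (Kd × ℤ)} {s : Fin n → ZMod ℓ} {p q : Kd}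
    {d : ZMod ℓ} (h : Cz ℓ B s p q d) : Cv (fun i => (B i).map (lift ℓ (s i))) p q d := by
  obtain ⟨i, x, y, h, h'⟩ := h
  refine ⟨i, _, _, h.map (lift ℓ (s i)), ?_⟩
  rw [← h']; push_cast; ring

theorem zg_mk {k ℓ : ℕ} {L : List (Kd × ℤ)} (c z1 z2 : ℤ) (len : L.length = ℓ) (nd : L.Nodup)
    (h : ∀ u ∈ L, (c ≤ u.2 ∧ u.2 < c + ℓ) ∧ (u.1 = .zb → u.2 = z1) ∧ (u.1 = .za → u.2 = z2) ∧
      (u.1 = .b ∨ u.1 = .B → u.2 ≠ z1) ∧ (u.1 = .a ∨ u.1 = .A → u.2 ≠ z2)) : ZG k ℓ c L where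
  len := len
  nd := nd
  win u hu := (h u hu).1
  zc u hu v hv huv := by
    constructor
    · rintro ⟨h1, h2⟩
      exact (h v hv).2.2.2.1 h2 (huv ▸ (h u hu).2.1 h1)
    · rintro ⟨h1, h2⟩
      exact (h v hv).2.2.2.2 h2 (huv ▸ (h u hu).2.2.1 h1)

theorem cz_mk {ℓ n : ℕ} {B : Fin n → List (Kd × ℤ)} {s : Fin n → ZMod ℓ} {p q : Kd} {d : ℤ}
    (hs : ∀ i, s i = 1) (i : Fin n) (x y : ℤ) (h : Adj (B i) (p, x) (q, y)) (e : ℤ) (hd : y - x = d + e * ℓ) :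
    Cz ℓ B s p q (d : ZMod ℓ) :=
  ⟨i, x, y, h, by rw [hd, hs]; simp⟩

theorem zrep {ℓ k : ℕ} [NeZero ℓ] (hℓ : ℓ = 2 * k + 1) (δ : ZMod ℓ) :
    ∃ d : ℤ, -k ≤ d ∧ d ≤ k ∧ (d : ZMod ℓ) = δ := by
  have hv := ZMod.val_lt δ
  have hx : ((δ.val : ℤ) : ZMod ℓ) = δ := by simp
  by_cases h : δ.val ≤ k
  · exact ⟨δ.val, by omega, by omega, hx⟩
  · refine ⟨δ.val - ℓ, by omega, by omega, ?_⟩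
    rw [Int.cast_sub, hx]; simp

def cyc4 (I Z2 O Z1 : List (Kd × ℤ)) : List (Kd × ℤ) := I ++ Z2 ++ O ++ Z1.reverse

section
variable {I Z2 O Z1 : List (Kd × ℤ)} {u v i0 i1 o0 o1 : Kd × ℤ}

theorem c4_in (h : [u, v] <:+: I) : Adj (cyc4 I Z2 O Z1) u v :=
  Or.inl (h.trans ⟨[], Z2 ++ O ++ Z1.reverse ++ (cyc4 I Z2 O Z1).take 1, by simp [cyc4]⟩)

theorem c4_out (h : [u, v] <:+: O) : Adj (cyc4 I Z2 O Z1) u v :=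
  Or.inl (h.trans ⟨I ++ Z2, Z1.reverse ++ (cyc4 I Z2 O Z1).take 1, by simp [cyc4]⟩)

theorem c4_2 (hI : I.getLast? = some i1) (hO : O.head? = some o1)
    (h : [u, v] <:+: [i1] ++ Z2 ++ [o1]) : Adj (cyc4 I Z2 O Z1) u v := by
  obtain ⟨I', rfl⟩ := List.getLast?_eq_some_iff.1 hI
  obtain ⟨O', rfl⟩ := List.head?_eq_some_iff.1 hO
  exact Or.inl (h.trans ⟨I', O' ++ Z1.reverse ++ (cyc4 (I' ++ [i1]) Z2 (o1 :: O') Z1).take 1,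
    by simp [cyc4]⟩)

theorem c4_1 (hI : I.head? = some i0) (hO : O.getLast? = some o0)
    (h : [u, v] <:+: [i0] ++ Z1 ++ [o0]) : Adj (cyc4 I Z2 O Z1) u v := by
  obtain ⟨O', rfl⟩ := List.getLast?_eq_some_iff.1 hO
  obtain ⟨I', rfl⟩ := List.head?_eq_some_iff.1 hI
  have h' := List.reverse_infix.2 h
  refine Or.inr (h'.trans ⟨(i0 :: I') ++ Z2 ++ O', [], ?_⟩)
  simp [cyc4]

end

def run (p q : Kd) (σ : ℤ) (N : ℕ) := zig p q (2 * σ) σ (-3 * σ) (-σ) N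

theorem run_edge (p q : Kd) (σ : ℤ) (N : ℕ) (o i : Kd × ℤ) (ho : o = (p, σ * (N + 2)))
    (hi : i = (q, -2 * σ)) (d : ℤ) (h1 : 4 ≤ d) (h2 : d ≤ 2 * N + 4) :
    ∃ x y, y - x = σ * d ∧ ([(q, x), (p, y)] <:+: [i] ++ run p q σ N ++ [o] ∨
      [(p, y), (q, x)] <:+: [i] ++ run p q σ N ++ [o]) := by
  subst ho hi
  have hb := fun j => zig_e2 p q (2 * σ) σ (-3 * σ) (-σ) N j
  have hc := fun j => zig_e1 p q (2 * σ) σ (-3 * σ) (-σ) N j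
  rw [show -3 * σ - -σ = -2 * σ by ring, show 2 * σ + σ * N = σ * (N + 2) by ring] at hb
  obtain ⟨j, hj | hj⟩ := Int.even_or_odd' d
  · have := hb (j - 2).toNat (by omega)
    refine ⟨_, _, ?_, Or.inl this⟩
    rw [Int.toNat_of_nonneg (by omega), hj]; ring
  · have := hc (j - 2).toNat (by omega)
    refine ⟨_, _, ?_, Or.inr (this.trans ⟨[(q, -2 * σ)], [(p, σ * (N + 2))], by simp [run]⟩)⟩
    rw [Int.toNat_of_nonneg (by omega), hj]; ring

theorem run2 {I O Z1 : List (Kd × ℤ)} (p q : Kd) (σ : ℤ) (N : ℕ) {o i : Kd × ℤ}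
    (hI : I.getLast? = some i) (hO : O.head? = some o) (ho : o = (p, σ * (N + 2)))
    (hi : i = (q, -2 * σ)) (d : ℤ) (h1 : 4 ≤ d) (h2 : d ≤ 2 * N + 4) :
    ∃ x y, y - x = σ * d ∧ Adj (cyc4 I (run p q σ N) O Z1) (q, x) (p, y) := by
  obtain ⟨x, y, h, h' | h'⟩ := run_edge p q σ N o i ho hi d h1 h2
  · exact ⟨x, y, h, c4_2 hI hO h'⟩
  · exact ⟨x, y, h, (c4_2 hI hO h').symm⟩

theorem run1 {I O Z2 : List (Kd × ℤ)} (p q : Kd) (σ : ℤ) (N : ℕ) {o i : Kd × ℤ}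
    (hI : I.head? = some i) (hO : O.getLast? = some o) (ho : o = (p, σ * (N + 2)))
    (hi : i = (q, -2 * σ)) (d : ℤ) (h1 : 4 ≤ d) (h2 : d ≤ 2 * N + 4) :
    ∃ x y, y - x = σ * d ∧ Adj (cyc4 I Z2 O (run p q σ N)) (q, x) (p, y) := by
  obtain ⟨x, y, h, h' | h'⟩ := run_edge p q σ N o i ho hi d h1 h2
  · exact ⟨x, y, h, c4_1 hI hO h'⟩
  · exact ⟨x, y, h, (c4_1 hI hO h').symm⟩

/-- sign and offset of a kind -/
def ep : Kd → ℤ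
  | .a => 1 | .A => 1 | .za => 1 | .b => -1 | .B => -1 | .zb => -1 | .w => 1
def bt : Kd → ℤ
  | .a => 0 | .A => 0 | .za => 0 | .b => 1 | .B => 1 | .zb => 1 | .w => 0

theorem vz_eq (r : ℤ → ℤ) (p : Kd) (x : ℤ) : vz r 1 (p, x) = bt p + ep p * r x := by
  cases p <;> simp [vz, bt, ep] <;> ring

def Fs (r : ℤ → ℤ) (x d : ℤ) (N : ℕ) : ℤ := ∑ i ∈ Finset.range N, r (x + d * i)

theorem Fs_shift (r : ℤ → ℤ) (x d : ℤ) (N : ℕ) :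
    Fs r (x + d) d N = Fs r x d N + r (x + d * N) - r x := by
  have h := Finset.sum_range_succ (fun i : ℕ => r (x + d * i)) N
  rw [Finset.sum_range_succ'] at h
  simp only [Nat.cast_zero, mul_zero, add_zero] at h
  have : Fs r (x + d) d N = ∑ i ∈ Finset.range N, r (x + d * ((i + 1 : ℕ) : ℤ)) := by
    apply Finset.sum_congr rfl
    intro i _
    congr 1; push_cast; ring
  rw [this, Fs]
  linarith

theorem zig_vz (r : ℤ → ℤ) (p q : Kd) (x dx y dy : ℤ) (N : ℕ) :
    ((zig p q x dx y dy N).map (vz r 1)).sum =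
      bt p * N + ep p * Fs r x dx N + (bt q * N + ep q * Fs r y dy N) := by
  rw [zig_sum]
  have h : ∀ (p : Kd) (x d : ℤ), ∑ i ∈ Finset.range N, vz r 1 (p, x + d * i) =
      bt p * N + ep p * Fs r x d N := by
    intro p x d
    simp only [vz_eq, Finset.sum_add_distrib, Finset.sum_const, Finset.card_range, nsmul_eq_mul, Fs,
      Finset.mul_sum]
    ring
  rw [h, h]

theorem run_vz_pos (r : ℤ → ℤ) (p q : Kd) (N : ℕ) :
    ((run p q 1 N).map (vz r 1)).sum = bt p * N + ep p * Fs r 2 1 N + (bt q * N + ep q *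
      (Fs r (-2) (-1) N + r (-(N : ℤ) + (-2)) - r (-2))) := by
  have := Fs_shift r (-2) (-1) N
  rw [run, zig_vz]
  norm_num at this ⊢
  rw [this]
  rw [show -2 + -(N : ℤ) = -(N : ℤ) + -2 by ring]
  exact Or.inl rfl

theorem run_vz_neg (r : ℤ → ℤ) (p q : Kd) (N : ℕ) :
    ((run p q (-1) N).map (vz r 1)).sum = bt p * N + ep p * Fs r (-2) (-1) N + (bt q * N + ep q *
      (Fs r 2 1 N + r ((N : ℤ) + 2) - r 2)) := by
  have := Fs_shift r 2 1 N
  rw [run, zig_vz]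
  norm_num at this ⊢
  rw [this]
  rw [show 2 + (N : ℤ) = (N : ℤ) + 2 by ring]
  exact Or.inl rfl

theorem c4_len {I Z2 O Z1 : List (Kd × ℤ)} : (cyc4 I Z2 O Z1).length = (I ++ O).length + Z2.length + Z1.length := by
  simp only [cyc4, List.length_append, List.length_reverse]; omega

theorem c4_sum {I Z2 O Z1 : List (Kd × ℤ)} (f : Kd × ℤ → ℤ) : ((cyc4 I Z2 O Z1).map f).sum =
    ((I ++ O).map f).sum + (Z2.map f).sum + (Z1.map f).sum := by
  simp only [cyc4, List.map_append, List.sum_append, List.map_reverse, List.sum_reverse]; ring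

theorem c4_all {I Z2 O Z1 : List (Kd × ℤ)} {P : Kd × ℤ → Prop} (h1 : ∀ u ∈ I ++ O, P u)
    (h2 : ∀ u ∈ Z2, P u) (h3 : ∀ u ∈ Z1, P u) : ∀ u ∈ cyc4 I Z2 O Z1, P u := by
  intro u hu
  simp only [cyc4, List.mem_append, List.mem_reverse] at hu
  rcases hu with ((h | h) | h) | h
  · exact h1 u (by simp [h])
  · exact h2 u h
  · exact h1 u (by simp [h])
  · exact h3 u h

theorem c4_nodup {I Z2 O Z1 : List (Kd × ℤ)} (h1 : (I ++ O).Nodup) (h2 : Z2.Nodup) (h3 : Z1.Nodup)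
    (h4 : ∀ u ∈ Z2, u ∉ I ++ O) (h5 : ∀ u ∈ Z1, u ∉ I ++ O) (h6 : ∀ u ∈ Z2, u ∉ Z1) :
    (cyc4 I Z2 O Z1).Nodup := by
  have hp : (cyc4 I Z2 O Z1).Perm ((I ++ O) ++ (Z2 ++ Z1)) := by
    rw [cyc4, List.append_assoc, List.append_assoc, List.append_assoc]
    apply List.Perm.append_left
    rw [← List.append_assoc, ← List.append_assoc]
    exact List.Perm.append (List.perm_append_comm) (List.reverse_perm Z1)
  rw [hp.nodup_iff, List.nodup_append]
  refine ⟨h1, List.nodup_append.2 ⟨h2, h3, fun a ha b hb hab => h6 a ha (hab ▸ hb)⟩, fun a ha b hb hab => ?_⟩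
  subst hab
  rcases List.mem_append.1 hb with h | h
  · exact h4 _ h ha
  · exact h5 _ h ha

theorem run_all {P : Kd × ℤ → Prop} {p q : Kd} {σ : ℤ} {N : ℕ}
    (h : ∀ i : ℕ, i < N → P (p, σ * (2 + i)) ∧ P (q, -σ * (3 + i))) : ∀ u ∈ run p q σ N, P u := by
  rw [run, zig_all]
  intro i hi
  rw [show 2 * σ + σ * i = σ * (2 + i) by ring, show -3 * σ + -σ * i = -σ * (3 + i) by ring]
  exact h i hi

theorem run_nodup {p q : Kd} {σ : ℤ} {N : ℕ} (h : p ≠ q) (hσ : σ ≠ 0) : (run p q σ N).Nodup :=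
  zig_nodup _ _ _ _ _ _ _ hσ (neg_ne_zero.2 hσ) (Or.inl h)

theorem run_kind {p q : Kd} {σ : ℤ} {N : ℕ} : ∀ u ∈ run p q σ N, u.1 = p ∨ u.1 = q :=
  run_all fun _ _ => ⟨Or.inl rfl, Or.inr rfl⟩

theorem run_disj {p q p' q' : Kd} {σ σ' : ℤ} {N : ℕ}
    (h : p ≠ p' ∧ p ≠ q' ∧ q ≠ p' ∧ q ≠ q') : ∀ u ∈ run p q σ N, u ∉ run p' q' σ' N := by
  intro u hu hu'
  rcases run_kind u hu with h1 | h1 <;> rcases run_kind u hu' with h2 | h2 <;>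
    rw [h1] at h2 <;> simp [h2] at h

theorem sl : (∀ p, (False ∧ p) = False) ∧ (∀ p, (True ∧ p) = p) ∧ (∀ p, (False ∨ p) = p) ∧
    (∀ p, (p ∨ False) = p) ∧ (¬False) ∧ (∀ p, (p ∧ True) = p) ∧ (∀ p : Prop, (False → p) = True) ∧
    (∀ p : Prop, (True → p) = p) ∧ (∀ p, (p ∨ True) = True) ∧ (∀ p, (True ∨ p) = True) ∧
    (∀ p : Prop, (p → p) = True) ∧ (∀ p, (p ∨ p) = p) ∧ (∀ p q, (¬(p ∨ q)) = (¬p ∧ ¬q)) ∧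
    (∀ p, (p ∧ p) = p) := by
  simp

theorem sl2 : (∀ (p : Kd × ℤ → Prop) (x y : List (Kd × ℤ)), (∀ u ∈ x ++ y, p u) ↔ (∀ u ∈ x, p u) ∧ ∀ u ∈ y, p u) ∧
    (∀ (p : Kd × ℤ → Prop) a (l : List (Kd × ℤ)), (∀ u ∈ a :: l, p u) ↔ p a ∧ ∀ u ∈ l, p u) ∧
    (∀ a : Kd × ℤ, ¬ a ∈ []) ∧ (∀ (p q : Kd) (x y : ℤ), ((p, x) = (q, y)) = (p = q ∧ x = y)) ∧
    (∀ a (l : List (Kd × ℤ)), (a :: l).Nodup ↔ a ∉ l ∧ l.Nodup) ∧ (([] : List (Kd × ℤ)).Nodup) ∧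
    (∀ (a b : Kd × ℤ) l, a ∈ b :: l ↔ a = b ∨ a ∈ l) := by
  simp [or_imp, forall_and]


theorem mainD_mk {k ℓ : ℕ} [NeZero ℓ] (hℓ : ℓ = 2 * k + 1) (ρ : ZMod ℓ → Bool)
    (C : Fin 4 → List (Kd × ℤ)) (d1 d2 : ℤ) (hG : ∀ i, ZG k ℓ (-k) (C i))
    (hS : ∀ i (r : ℤ → ℤ), (∀ x, r x = 0 ∨ r x = 1) → ((C i).map (vz r 1)).sum = k ∨
      ((C i).map (vz r 1)).sum = k + 1) (hw : ∀ i, ∀ u ∈ C i, u.1 ≠ .w)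
    (aA : ∀ d : ℤ, -k ≤ d → d ≤ k → Cz ℓ C (fun _ => 1) .a .A d)
    (bB : ∀ d : ℤ, -k ≤ d → d ≤ k → Cz ℓ C (fun _ => 1) .b .B d)
    (aB : ∀ d : ℤ, -k ≤ d → d ≤ k → d ≠ -1 → d ≠ 1 → d ≠ -d1 → d ≠ -d2 →
      Cz ℓ C (fun _ => 1) .a .B d)
    (Ab : ∀ d : ℤ, -k ≤ d → d ≤ k → d ≠ -1 → d ≠ 1 → d ≠ -d1 → d ≠ -d2 →
      Cz ℓ C (fun _ => 1) .A .b d)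
    (az : ∀ d : ℤ, d = -1 ∨ d = 1 → Cz ℓ C (fun _ => 1) .a .zb d ∧ Cz ℓ C (fun _ => 1) .A .zb d)
    (bz : ∀ d : ℤ, d = d1 ∨ d = d2 → Cz ℓ C (fun _ => 1) .b .za d ∧ Cz ℓ C (fun _ => 1) .B .za d) :
    MainD ρ k [((-1 : ℤ) : ZMod ℓ), ((1 : ℤ) : ZMod ℓ)] [(d1 : ZMod ℓ), (d2 : ZMod ℓ)]
      (fun i => (C i).map (lift ℓ 1)) where
  good i := (hG i).bg ρ ρ true 1 1 (one_mul 1) 1 (Or.inl ⟨rfl, rfl, rfl⟩) (fun t => by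
    apply hS
    intro x
    simp only [bi]
    split_ifs <;> simp)
  nw i x h := by
    obtain ⟨u, hu, h⟩ := List.mem_map.1 h
    exact hw i u hu (congrArg Prod.fst h)
  aA δ := by
    obtain ⟨d, h1, h2, rfl⟩ := zrep hℓ δ
    exact (aA d h1 h2).cv
  bB δ := by
    obtain ⟨d, h1, h2, rfl⟩ := zrep hℓ δ
    exact (bB d h1 h2).cv
  aB δ hd1 hd2 := by
    obtain ⟨d, h1, h2, rfl⟩ := zrep hℓ δ
    simp only [List.mem_cons, List.not_mem_nil, or_false, not_or] at hd1 hd2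
    have e1 : d ≠ -1 := fun h => hd1.1 (by rw [h])
    have e2 : d ≠ 1 := fun h => hd1.2 (by rw [h])
    have e3 : d ≠ -d1 := fun h => hd2.1 (by rw [h]; simp)
    have e4 : d ≠ -d2 := fun h => hd2.2 (by rw [h]; simp)
    exact ⟨(aB d h1 h2 e1 e2 e3 e4).cv, (Ab d h1 h2 e1 e2 e3 e4).cv⟩
  az δ h := by
    simp only [List.mem_cons, List.not_mem_nil, or_false] at h
    rcases h with rfl | rfl
    · exact ⟨(az (-1) (by simp)).1.cv, (az (-1) (by simp)).2.cv⟩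
    · exact ⟨(az 1 (by simp)).1.cv, (az 1 (by simp)).2.cv⟩
  bz δ h := by
    simp only [List.mem_cons, List.not_mem_nil, or_false] at h
    rcases h with rfl | rfl
    · exact ⟨(bz d1 (by simp)).1.cv, (bz d1 (by simp)).2.cv⟩
    · exact ⟨(bz d2 (by simp)).1.cv, (bz d2 (by simp)).2.cv⟩

def moI0 (N : ℕ) : List (Kd × ℤ) :=
  [(.B, 2), (.za, -2 * N + -3), (.b, 2), (.B, -1), (.a, 2), (.A, -1), (.a, 1), (.B, 1), (.b, -2)]

def moO0 (N : ℕ) : List (Kd × ℤ) :=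
  [(.A, N + 2), (.b, -N + -3), (.B, N + 5), (.a, -N + -3), (.A, N + 5), (.a, -N + -2)]

def moC0 (N : ℕ) : List (Kd × ℤ) := cyc4 (moI0 N) (run .A .b 1 N) (moO0 N) (run .a .B (-1) N)

theorem moG0 {N k ℓ : ℕ} (hℓ : ℓ = 2 * k + 1) (hk : k = 2 * N + 7) (hN : 1 ≤ N) :
    ZG k ℓ (-k) (moC0 N) := by
  refine zg_mk _ (10 * ℓ) (-2 * N + -3) ?_ (c4_nodup ?_ (run_nodup (by decide) (by decide))
    (run_nodup (by decide) (by decide)) (run_all fun i hi => ?_) (run_all fun i hi => ?_)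
    (run_disj (by decide))) (c4_all ?_ (run_all fun i hi => ?_) (run_all fun i hi => ?_))
  · rw [moC0, c4_len, run, run, zig_len, zig_len]
    simp only [moI0, moO0, List.cons_append, List.nil_append, List.length_cons, List.length_nil]
    omega
  all_goals
    try simp only [moI0, moO0, List.cons_append, List.nil_append, List.forall_mem_cons]
    simp only [moI0, moO0, List.cons_append, List.nil_append, sl, sl2,
      reduceCtorEq, forall_const, IsEmpty.forall_iff, implies_true, not_false_eq_true]
    omega

theorem moS0 {N k : ℕ} (hk : k = 2 * N + 7) (r : ℤ → ℤ) (hr : ∀ x, r x = 0 ∨ r x = 1) :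
    ((moC0 N).map (vz r 1)).sum = k ∨ ((moC0 N).map (vz r 1)).sum = k + 1 := by
  rw [moC0, c4_sum]
  simp only [run_vz_pos, run_vz_neg]
  simp only [moI0, moO0, List.cons_append, List.nil_append, List.map_cons, List.map_nil,
    List.sum_cons, List.sum_nil, vz, bt, ep]
  rcases hr (-2 * N + -3) with h | h <;> omega

theorem moW0 {N : ℕ} : ∀ u ∈ moC0 N, u.1 ≠ .w := by
  refine c4_all ?_ (run_all fun i hi => ?_) (run_all fun i hi => ?_)
  all_goals simp [moI0, moO0]

def moI1 (N : ℕ) : List (Kd × ℤ) :=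
  [(.a, 2), (.zb, 1), (.A, 0), (.a, -2), (.B, 0), (.b, -1), (.A, 1), (.b, -2), (.A, -2)]

def moO1 (N : ℕ) : List (Kd × ℤ) :=
  [(.b, N + 2), (.A, -N + -5), (.b, N + 3), (.B, -N + -5), (.a, N + 3), (.B, -N + -2)]

def moC1 (N : ℕ) : List (Kd × ℤ) := cyc4 (moI1 N) (run .b .A 1 N) (moO1 N) (run .B .a (-1) N)

theorem moG1 {N k ℓ : ℕ} (hℓ : ℓ = 2 * k + 1) (hk : k = 2 * N + 7) (hN : 1 ≤ N) :
    ZG k ℓ (-k) (moC1 N) := by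
  refine zg_mk _ 1 (10 * ℓ) ?_ (c4_nodup ?_ (run_nodup (by decide) (by decide))
    (run_nodup (by decide) (by decide)) (run_all fun i hi => ?_) (run_all fun i hi => ?_)
    (run_disj (by decide))) (c4_all ?_ (run_all fun i hi => ?_) (run_all fun i hi => ?_))
  · rw [moC1, c4_len, run, run, zig_len, zig_len]
    simp only [moI1, moO1, List.cons_append, List.nil_append, List.length_cons, List.length_nil]
    omega
  all_goals
    try simp only [moI1, moO1, List.cons_append, List.nil_append, List.forall_mem_cons]
    simp only [moI1, moO1, List.cons_append, List.nil_append, sl, sl2,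
      reduceCtorEq, forall_const, IsEmpty.forall_iff, implies_true, not_false_eq_true]
    omega

theorem moS1 {N k : ℕ} (hk : k = 2 * N + 7) (r : ℤ → ℤ) (hr : ∀ x, r x = 0 ∨ r x = 1) :
    ((moC1 N).map (vz r 1)).sum = k ∨ ((moC1 N).map (vz r 1)).sum = k + 1 := by
  rw [moC1, c4_sum]
  simp only [run_vz_pos, run_vz_neg]
  simp only [moI1, moO1, List.cons_append, List.nil_append, List.map_cons, List.map_nil,
    List.sum_cons, List.sum_nil, vz, bt, ep]
  rcases hr (-1) with h | h <;> omega

theorem moW1 {N : ℕ} : ∀ u ∈ moC1 N, u.1 ≠ .w := by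
  refine c4_all ?_ (run_all fun i hi => ?_) (run_all fun i hi => ?_)
  all_goals simp [moI1, moO1]

def moI2 (N : ℕ) : List (Kd × ℤ) :=
  [(.a, -2), (.zb, -1), (.A, 0), (.a, 0), (.A, -1), (.b, 1), (.B, 0), (.b, 0), (.B, 2)]

def moO2 (N : ℕ) : List (Kd × ℤ) :=
  [(.b, -N + -2), (.B, N + 3), (.b, -N + -3), (.A, N + 3), (.a, -N + -3), (.A, N + 2)]

def moC2 (N : ℕ) : List (Kd × ℤ) := cyc4 (moI2 N) (run .b .B (-1) N) (moO2 N) (run .A .a 1 N)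

theorem moG2 {N k ℓ : ℕ} (hℓ : ℓ = 2 * k + 1) (hk : k = 2 * N + 7) (hN : 1 ≤ N) :
    ZG k ℓ (-k) (moC2 N) := by
  refine zg_mk _ (-1) (10 * ℓ) ?_ (c4_nodup ?_ (run_nodup (by decide) (by decide))
    (run_nodup (by decide) (by decide)) (run_all fun i hi => ?_) (run_all fun i hi => ?_)
    (run_disj (by decide))) (c4_all ?_ (run_all fun i hi => ?_) (run_all fun i hi => ?_))
  · rw [moC2, c4_len, run, run, zig_len, zig_len]
    simp only [moI2, moO2, List.cons_append, List.nil_append, List.length_cons, List.length_nil]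
    omega
  all_goals
    try simp only [moI2, moO2, List.cons_append, List.nil_append, List.forall_mem_cons]
    simp only [moI2, moO2, List.cons_append, List.nil_append, sl, sl2,
      reduceCtorEq, forall_const, IsEmpty.forall_iff, implies_true, not_false_eq_true]
    omega

theorem moS2 {N k : ℕ} (hk : k = 2 * N + 7) (r : ℤ → ℤ) (hr : ∀ x, r x = 0 ∨ r x = 1) :
    ((moC2 N).map (vz r 1)).sum = k ∨ ((moC2 N).map (vz r 1)).sum = k + 1 := by
  rw [moC2, c4_sum]
  simp only [run_vz_pos, run_vz_neg]
  simp only [moI2, moO2, List.cons_append, List.nil_append, List.map_cons, List.map_nil,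
    List.sum_cons, List.sum_nil, vz, bt, ep]
  rcases hr 1 with h | h <;> omega

theorem moW2 {N : ℕ} : ∀ u ∈ moC2 N, u.1 ≠ .w := by
  refine c4_all ?_ (run_all fun i hi => ?_) (run_all fun i hi => ?_)
  all_goals simp [moI2, moO2]

def moI3 (N : ℕ) : List (Kd × ℤ) :=
  [(.A, -2), (.b, 1), (.B, -1), (.a, 1), (.A, 2), (.a, -1), (.B, 2), (.za, -2 * N + -4), (.b, 2)]

def moO3 (N : ℕ) : List (Kd × ℤ) :=
  [(.B, -N + -2), (.b, N + 3), (.B, -N + -3), (.a, N + 3), (.A, -N + -3), (.a, N + 2)]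

def moC3 (N : ℕ) : List (Kd × ℤ) := cyc4 (moI3 N) (run .B .b (-1) N) (moO3 N) (run .a .A 1 N)

theorem moG3 {N k ℓ : ℕ} (hℓ : ℓ = 2 * k + 1) (hk : k = 2 * N + 7) (hN : 1 ≤ N) :
    ZG k ℓ (-k) (moC3 N) := by
  refine zg_mk _ (10 * ℓ) (-2 * N + -4) ?_ (c4_nodup ?_ (run_nodup (by decide) (by decide))
    (run_nodup (by decide) (by decide)) (run_all fun i hi => ?_) (run_all fun i hi => ?_)
    (run_disj (by decide))) (c4_all ?_ (run_all fun i hi => ?_) (run_all fun i hi => ?_))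
  · rw [moC3, c4_len, run, run, zig_len, zig_len]
    simp only [moI3, moO3, List.cons_append, List.nil_append, List.length_cons, List.length_nil]
    omega
  all_goals
    try simp only [moI3, moO3, List.cons_append, List.nil_append, List.forall_mem_cons]
    simp only [moI3, moO3, List.cons_append, List.nil_append, sl, sl2,
      reduceCtorEq, forall_const, IsEmpty.forall_iff, implies_true, not_false_eq_true]
    omega

theorem moS3 {N k : ℕ} (hk : k = 2 * N + 7) (r : ℤ → ℤ) (hr : ∀ x, r x = 0 ∨ r x = 1) :
    ((moC3 N).map (vz r 1)).sum = k ∨ ((moC3 N).map (vz r 1)).sum = k + 1 := by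
  rw [moC3, c4_sum]
  simp only [run_vz_pos, run_vz_neg]
  simp only [moI3, moO3, List.cons_append, List.nil_append, List.map_cons, List.map_nil,
    List.sum_cons, List.sum_nil, vz, bt, ep]
  rcases hr (-2 * N + -4) with h | h <;> omega

theorem moW3 {N : ℕ} : ∀ u ∈ moC3 N, u.1 ≠ .w := by
  refine c4_all ?_ (run_all fun i hi => ?_) (run_all fun i hi => ?_)
  all_goals simp [moI3, moO3]

def moC (N : ℕ) : Fin 4 → List (Kd × ℤ) := ![moC0 N, moC1 N, moC2 N, moC3 N]

theorem moaA {N k ℓ : ℕ} (hℓ : ℓ = 2 * k + 1) (hk : k = 2 * N + 7) (d : ℤ) (h1 : -k ≤ d) (h2 : d ≤ k) :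
    Cz ℓ (moC N) (fun _ => 1) .a .A d := by
  have hc : 4 ≤ -d ∧ -d ≤ 2 * N + 4 ∨ 4 ≤ d ∧ d ≤ 2 * N + 4 ∨ d = -2 * N + -5 ∨ d = -2 * N + -6 ∨ d = -2 * N + -7 ∨ d = -1 ∨ d = -2 ∨ d = -3 ∨ d = 0 ∨ d = 1 ∨ d = 2 ∨ d = 3 ∨ d = 2 * N + 5 ∨ d = 2 * N + 6 ∨ d = 2 * N + 7 := by omega
  rcases hc with h0 | h0 | h0 | h0 | h0 | h0 | h0 | h0 | h0 | h0 | h0 | h0 | h0 | h0 | h0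
  · obtain ⟨x, y, h, ha⟩ := run1 (I := moI3 N) (O := moO3 N) (Z2 := run .B .b (-1) N) .a .A 1 N
      (o := (.a, N + 2)) (i := (.A, -2))
      rfl rfl (congrArg (Prod.mk _) (by ring)) rfl (-d) (by omega) (by omega)
    exact cz_mk (fun _ => rfl) 3 y x ha.symm 0 (by omega)
  · obtain ⟨x, y, h, ha⟩ := run1 (I := moI2 N) (O := moO2 N) (Z2 := run .b .B (-1) N) .A .a 1 N
      (o := (.A, N + 2)) (i := (.a, -2))
      rfl rfl (congrArg (Prod.mk _) (by ring)) rfl d (by omega) (by omega)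
    exact cz_mk (fun _ => rfl) 2 x y ha 0 (by omega)
  · exact cz_mk (fun _ => rfl) 3 (N + 2) (-N + -3) (c4_out (infix_get 4 rfl rfl)).symm 0 (by omega)
  · exact cz_mk (fun _ => rfl) 3 (N + 3) (-N + -3) (c4_out (infix_get 3 rfl rfl)) 0 (by omega)
  · exact cz_mk (fun _ => rfl) 0 (-N + -3) (N + 5) (c4_out (infix_get 3 rfl rfl)) 1 (by omega)
  · exact cz_mk (fun _ => rfl) 2 0 (-1) (c4_in (infix_get 3 rfl rfl)) 0 (by omega)
  · exact cz_mk (fun _ => rfl) 0 1 (-1) (c4_in (infix_get 5 rfl rfl)).symm 0 (by omega)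
  · exact cz_mk (fun _ => rfl) 0 2 (-1) (c4_in (infix_get 4 rfl rfl)) 0 (by omega)
  · exact cz_mk (fun _ => rfl) 2 0 0 (c4_in (infix_get 2 rfl rfl)).symm 0 (by omega)
  · exact cz_mk (fun _ => rfl) 3 1 2 (c4_in (infix_get 3 rfl rfl)) 0 (by omega)
  · exact cz_mk (fun _ => rfl) 1 (-2) 0 (c4_in (infix_get 2 rfl rfl)).symm 0 (by omega)
  · exact cz_mk (fun _ => rfl) 3 (-1) 2 (c4_in (infix_get 4 rfl rfl)).symm 0 (by omega)
  · exact cz_mk (fun _ => rfl) 2 (-N + -3) (N + 2) (c4_out (infix_get 4 rfl rfl)) 0 (by omega)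
  · exact cz_mk (fun _ => rfl) 2 (-N + -3) (N + 3) (c4_out (infix_get 3 rfl rfl)).symm 0 (by omega)
  · exact cz_mk (fun _ => rfl) 0 (-N + -2) (N + 5) (c4_out (infix_get 4 rfl rfl)).symm 0 (by omega)

theorem mobB {N k ℓ : ℕ} (hℓ : ℓ = 2 * k + 1) (hk : k = 2 * N + 7) (d : ℤ) (h1 : -k ≤ d) (h2 : d ≤ k) :
    Cz ℓ (moC N) (fun _ => 1) .b .B d := by
  have hc : 4 ≤ -d ∧ -d ≤ 2 * N + 4 ∨ 4 ≤ d ∧ d ≤ 2 * N + 4 ∨ d = -2 * N + -5 ∨ d = -2 * N + -6 ∨ d = -2 * N + -7 ∨ d = -1 ∨ d = -2 ∨ d = -3 ∨ d = 0 ∨ d = 1 ∨ d = 2 ∨ d = 3 ∨ d = 2 * N + 5 ∨ d = 2 * N + 6 ∨ d = 2 * N + 7 := by omega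
  rcases hc with h0 | h0 | h0 | h0 | h0 | h0 | h0 | h0 | h0 | h0 | h0 | h0 | h0 | h0 | h0
  · obtain ⟨x, y, h, ha⟩ := run2 (I := moI3 N) (O := moO3 N) (Z1 := run .a .A 1 N) .B .b (-1) N
      (o := (.B, -N + -2)) (i := (.b, 2))
      rfl rfl (congrArg (Prod.mk _) (by ring)) rfl (-d) (by omega) (by omega)
    exact cz_mk (fun _ => rfl) 3 x y ha 0 (by omega)
  · obtain ⟨x, y, h, ha⟩ := run2 (I := moI2 N) (O := moO2 N) (Z1 := run .A .a 1 N) .b .B (-1) N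
      (o := (.b, -N + -2)) (i := (.B, 2))
      rfl rfl (congrArg (Prod.mk _) (by ring)) rfl d (by omega) (by omega)
    exact cz_mk (fun _ => rfl) 2 y x ha.symm 0 (by omega)
  · exact cz_mk (fun _ => rfl) 3 (N + 3) (-N + -2) (c4_out (infix_get 0 rfl rfl)).symm 0 (by omega)
  · exact cz_mk (fun _ => rfl) 3 (N + 3) (-N + -3) (c4_out (infix_get 1 rfl rfl)) 0 (by omega)
  · exact cz_mk (fun _ => rfl) 0 (-N + -3) (N + 5) (c4_out (infix_get 1 rfl rfl)) 1 (by omega)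
  · exact cz_mk (fun _ => rfl) 2 1 0 (c4_in (infix_get 5 rfl rfl)) 0 (by omega)
  · exact cz_mk (fun _ => rfl) 3 1 (-1) (c4_in (infix_get 1 rfl rfl)) 0 (by omega)
  · exact cz_mk (fun _ => rfl) 0 2 (-1) (c4_in (infix_get 2 rfl rfl)) 0 (by omega)
  · exact cz_mk (fun _ => rfl) 2 0 0 (c4_in (infix_get 6 rfl rfl)).symm 0 (by omega)
  · exact cz_mk (fun _ => rfl) 1 (-1) 0 (c4_in (infix_get 4 rfl rfl)).symm 0 (by omega)
  · exact cz_mk (fun _ => rfl) 2 0 2 (c4_in (infix_get 7 rfl rfl)) 0 (by omega)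
  · exact cz_mk (fun _ => rfl) 0 (-2) 1 (c4_in (infix_get 7 rfl rfl)).symm 0 (by omega)
  · exact cz_mk (fun _ => rfl) 2 (-N + -2) (N + 3) (c4_out (infix_get 0 rfl rfl)) 0 (by omega)
  · exact cz_mk (fun _ => rfl) 2 (-N + -3) (N + 3) (c4_out (infix_get 1 rfl rfl)).symm 0 (by omega)
  · exact cz_mk (fun _ => rfl) 1 (N + 3) (-N + -5) (c4_out (infix_get 2 rfl rfl)) (-1) (by omega)

theorem moaB {N k ℓ : ℕ} (hℓ : ℓ = 2 * k + 1) (hk : k = 2 * N + 7) (d : ℤ) (h1 : -k ≤ d) (h2 : d ≤ k)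
    (h3 : d ≠ -1) (h4 : d ≠ 1) (h5 : d ≠ -(-2 * N + -5)) (h6 : d ≠ -(-2 * N + -6)) :
    Cz ℓ (moC N) (fun _ => 1) .a .B d := by
  have hc : 4 ≤ -d ∧ -d ≤ 2 * N + 4 ∨ 4 ≤ d ∧ d ≤ 2 * N + 4 ∨ d = -2 * N + -5 ∨ d = -2 * N + -6 ∨ d = -2 * N + -7 ∨ d = -2 ∨ d = -3 ∨ d = 0 ∨ d = 2 ∨ d = 3 ∨ d = 2 * N + 7 := by omega
  rcases hc with h0 | h0 | h0 | h0 | h0 | h0 | h0 | h0 | h0 | h0 | h0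
  · obtain ⟨x, y, h, ha⟩ := run1 (I := moI1 N) (O := moO1 N) (Z2 := run .b .A 1 N) .B .a (-1) N
      (o := (.B, -N + -2)) (i := (.a, 2))
      rfl rfl (congrArg (Prod.mk _) (by ring)) rfl (-d) (by omega) (by omega)
    exact cz_mk (fun _ => rfl) 1 x y ha 0 (by omega)
  · obtain ⟨x, y, h, ha⟩ := run1 (I := moI0 N) (O := moO0 N) (Z2 := run .A .b 1 N) .a .B (-1) N
      (o := (.a, -N + -2)) (i := (.B, 2))
      rfl rfl (congrArg (Prod.mk _) (by ring)) rfl d (by omega) (by omega)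
    exact cz_mk (fun _ => rfl) 0 y x ha.symm 0 (by omega)
  · exact cz_mk (fun _ => rfl) 1 (N + 3) (-N + -2) (c4_out (infix_get 4 rfl rfl)) 0 (by omega)
  · exact cz_mk (fun _ => rfl) 3 (N + 3) (-N + -3) (c4_out (infix_get 2 rfl rfl)).symm 0 (by omega)
  · exact cz_mk (fun _ => rfl) 0 (-N + -3) (N + 5) (c4_out (infix_get 2 rfl rfl)).symm 1 (by omega)
  · exact cz_mk (fun _ => rfl) 3 1 (-1) (c4_in (infix_get 2 rfl rfl)).symm 0 (by omega)
  · exact cz_mk (fun _ => rfl) 0 2 (-1) (c4_in (infix_get 3 rfl rfl)).symm 0 (by omega)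
  · exact cz_mk (fun _ => rfl) 0 1 1 (c4_in (infix_get 6 rfl rfl)) 0 (by omega)
  · exact cz_mk (fun _ => rfl) 1 (-2) 0 (c4_in (infix_get 3 rfl rfl)) 0 (by omega)
  · exact cz_mk (fun _ => rfl) 3 (-1) 2 (c4_in (infix_get 5 rfl rfl)) 0 (by omega)
  · exact cz_mk (fun _ => rfl) 1 (N + 3) (-N + -5) (c4_out (infix_get 3 rfl rfl)).symm (-1) (by omega)

theorem moAb {N k ℓ : ℕ} (hℓ : ℓ = 2 * k + 1) (hk : k = 2 * N + 7) (d : ℤ) (h1 : -k ≤ d) (h2 : d ≤ k)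
    (h3 : d ≠ -1) (h4 : d ≠ 1) (h5 : d ≠ -(-2 * N + -5)) (h6 : d ≠ -(-2 * N + -6)) :
    Cz ℓ (moC N) (fun _ => 1) .A .b d := by
  have hc : 4 ≤ -d ∧ -d ≤ 2 * N + 4 ∨ 4 ≤ d ∧ d ≤ 2 * N + 4 ∨ d = -2 * N + -5 ∨ d = -2 * N + -6 ∨ d = -2 * N + -7 ∨ d = -2 ∨ d = -3 ∨ d = 0 ∨ d = 2 ∨ d = 3 ∨ d = 2 * N + 7 := by omega
  rcases hc with h0 | h0 | h0 | h0 | h0 | h0 | h0 | h0 | h0 | h0 | h0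
  · obtain ⟨x, y, h, ha⟩ := run2 (I := moI0 N) (O := moO0 N) (Z1 := run .a .B (-1) N) .A .b 1 N
      (o := (.A, N + 2)) (i := (.b, -2))
      rfl rfl (congrArg (Prod.mk _) (by ring)) rfl (-d) (by omega) (by omega)
    exact cz_mk (fun _ => rfl) 0 y x ha.symm 0 (by omega)
  · obtain ⟨x, y, h, ha⟩ := run2 (I := moI1 N) (O := moO1 N) (Z1 := run .B .a (-1) N) .b .A 1 N
      (o := (.b, N + 2)) (i := (.A, -2))
      rfl rfl (congrArg (Prod.mk _) (by ring)) rfl d (by omega) (by omega)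
    exact cz_mk (fun _ => rfl) 1 x y ha 0 (by omega)
  · exact cz_mk (fun _ => rfl) 0 (N + 2) (-N + -3) (c4_out (infix_get 0 rfl rfl)) 0 (by omega)
  · exact cz_mk (fun _ => rfl) 2 (N + 3) (-N + -3) (c4_out (infix_get 2 rfl rfl)).symm 0 (by omega)
  · exact cz_mk (fun _ => rfl) 1 (-N + -5) (N + 3) (c4_out (infix_get 1 rfl rfl)) 1 (by omega)
  · exact cz_mk (fun _ => rfl) 1 1 (-1) (c4_in (infix_get 5 rfl rfl)).symm 0 (by omega)
  · exact cz_mk (fun _ => rfl) 1 1 (-2) (c4_in (infix_get 6 rfl rfl)) 0 (by omega)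
  · exact cz_mk (fun _ => rfl) 1 (-2) (-2) (c4_in (infix_get 7 rfl rfl)).symm 0 (by omega)
  · exact cz_mk (fun _ => rfl) 2 (-1) 1 (c4_in (infix_get 4 rfl rfl)) 0 (by omega)
  · exact cz_mk (fun _ => rfl) 3 (-2) 1 (c4_in (infix_get 0 rfl rfl)) 0 (by omega)
  · exact cz_mk (fun _ => rfl) 1 (-N + -5) (N + 2) (c4_out (infix_get 0 rfl rfl)).symm 0 (by omega)

theorem moaz {N k ℓ : ℕ} (hℓ : ℓ = 2 * k + 1) (hk : k = 2 * N + 7) (d : ℤ) (h : d = -1 ∨ d = 1) :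
    Cz ℓ (moC N) (fun _ => 1) .a .zb d := by
  have hc : d = -1 ∨ d = 1 := by omega
  rcases hc with h0 | h0
  · exact cz_mk (fun _ => rfl) 1 2 1 (c4_in (infix_get 0 rfl rfl)) 0 (by omega)
  · exact cz_mk (fun _ => rfl) 2 (-2) (-1) (c4_in (infix_get 0 rfl rfl)) 0 (by omega)

theorem moAz {N k ℓ : ℕ} (hℓ : ℓ = 2 * k + 1) (hk : k = 2 * N + 7) (d : ℤ) (h : d = -1 ∨ d = 1) :
    Cz ℓ (moC N) (fun _ => 1) .A .zb d := by
  have hc : d = -1 ∨ d = 1 := by omega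
  rcases hc with h0 | h0
  · exact cz_mk (fun _ => rfl) 2 0 (-1) (c4_in (infix_get 1 rfl rfl)).symm 0 (by omega)
  · exact cz_mk (fun _ => rfl) 1 0 1 (c4_in (infix_get 1 rfl rfl)).symm 0 (by omega)

theorem mobz {N k ℓ : ℕ} (hℓ : ℓ = 2 * k + 1) (hk : k = 2 * N + 7) (d : ℤ) (h : d = -2 * N + -5 ∨ d = -2 * N + -6) :
    Cz ℓ (moC N) (fun _ => 1) .b .za d := by
  have hc : d = -2 * N + -5 ∨ d = -2 * N + -6 := by omega
  rcases hc with h0 | h0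
  · exact cz_mk (fun _ => rfl) 0 2 (-2 * N + -3) (c4_in (infix_get 1 rfl rfl)).symm 0 (by omega)
  · exact cz_mk (fun _ => rfl) 3 2 (-2 * N + -4) (c4_in (infix_get 7 rfl rfl)).symm 0 (by omega)

theorem moBz {N k ℓ : ℕ} (hℓ : ℓ = 2 * k + 1) (hk : k = 2 * N + 7) (d : ℤ) (h : d = -2 * N + -5 ∨ d = -2 * N + -6) :
    Cz ℓ (moC N) (fun _ => 1) .B .za d := by
  have hc : d = -2 * N + -5 ∨ d = -2 * N + -6 := by omega
  rcases hc with h0 | h0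
  · exact cz_mk (fun _ => rfl) 0 2 (-2 * N + -3) (c4_in (infix_get 0 rfl rfl)) 0 (by omega)
  · exact cz_mk (fun _ => rfl) 3 2 (-2 * N + -4) (c4_in (infix_get 6 rfl rfl)) 0 (by omega)

theorem moD {N k ℓ : ℕ} [NeZero ℓ] (hℓ : ℓ = 2 * k + 1) (hk : k = 2 * N + 7) (hN : 1 ≤ N)
    (ρ : ZMod ℓ → Bool) :
    MainD ρ k [((-1 : ℤ) : ZMod ℓ), ((1 : ℤ) : ZMod ℓ)]
      [((-2 * N + -5 : ℤ) : ZMod ℓ), ((-2 * N + -6 : ℤ) : ZMod ℓ)] (fun i => (moC N i).map (lift ℓ 1)) := by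
  refine mainD_mk hℓ ρ (moC N) _ _ ?_ ?_ ?_ (moaA hℓ hk) (mobB hℓ hk) (moaB hℓ hk) (moAb hℓ hk)
    (fun d h => ⟨moaz hℓ hk d h, moAz hℓ hk d h⟩) (fun d h => ⟨mobz hℓ hk d h, moBz hℓ hk d h⟩)
  · intro i
    fin_cases i
    exacts [moG0 hℓ hk hN, moG1 hℓ hk hN, moG2 hℓ hk hN, moG3 hℓ hk hN]
  · intro i r hr
    fin_cases i
    exacts [moS0 hk r hr, moS1 hk r hr, moS2 hk r hr, moS3 hk r hr]
  · intro i
    fin_cases i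
    exacts [moW0, moW1, moW2, moW3]

def meI0 (N : ℕ) : List (Kd × ℤ) :=
  [(.B, 2), (.a, -1), (.A, 0), (.a, 1), (.B, -1), (.b, 0), (.B, 1), (.za, -2 * N + -4), (.b, 1), (.A, 1), (.b, -2)]

def meO0 (N : ℕ) : List (Kd × ℤ) :=
  [(.A, N + 2), (.b, -N + -3), (.B, N + 4), (.a, -N + -3), (.A, N + 4), (.a, -N + -2)]

def meC0 (N : ℕ) : List (Kd × ℤ) := cyc4 (meI0 N) (run .A .b 1 N) (meO0 N) (run .a .B (-1) N)

theorem meG0 {N k ℓ : ℕ} (hℓ : ℓ = 2 * k + 1) (hk : k = 2 * N + 8) (hN : 0 ≤ N) :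
    ZG k ℓ (-k) (meC0 N) := by
  refine zg_mk _ (10 * ℓ) (-2 * N + -4) ?_ (c4_nodup ?_ (run_nodup (by decide) (by decide))
    (run_nodup (by decide) (by decide)) (run_all fun i hi => ?_) (run_all fun i hi => ?_)
    (run_disj (by decide))) (c4_all ?_ (run_all fun i hi => ?_) (run_all fun i hi => ?_))
  · rw [meC0, c4_len, run, run, zig_len, zig_len]
    simp only [meI0, meO0, List.cons_append, List.nil_append, List.length_cons, List.length_nil]
    omega
  all_goals
    try simp only [meI0, meO0, List.cons_append, List.nil_append, List.forall_mem_cons]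
    simp only [meI0, meO0, List.cons_append, List.nil_append, sl, sl2,
      reduceCtorEq, forall_const, IsEmpty.forall_iff, implies_true, not_false_eq_true]
    omega

theorem meS0 {N k : ℕ} (hk : k = 2 * N + 8) (r : ℤ → ℤ) (hr : ∀ x, r x = 0 ∨ r x = 1) :
    ((meC0 N).map (vz r 1)).sum = k ∨ ((meC0 N).map (vz r 1)).sum = k + 1 := by
  rw [meC0, c4_sum]
  simp only [run_vz_pos, run_vz_neg]
  simp only [meI0, meO0, List.cons_append, List.nil_append, List.map_cons, List.map_nil,
    List.sum_cons, List.sum_nil, vz, bt, ep]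
  rcases hr (-2 * N + -4) with h | h <;> omega

theorem meW0 {N : ℕ} : ∀ u ∈ meC0 N, u.1 ≠ .w := by
  refine c4_all ?_ (run_all fun i hi => ?_) (run_all fun i hi => ?_)
  all_goals simp [meI0, meO0]

def meI1 (N : ℕ) : List (Kd × ℤ) :=
  [(.a, 2), (.B, -1), (.za, -2 * N + -7), (.b, -1), (.A, 1), (.a, -1), (.A, -1), (.a, 1), (.B, 1), (.b, 1), (.A, -2)]

def meO1 (N : ℕ) : List (Kd × ℤ) :=
  [(.b, N + 2), (.B, -N + -4), (.b, N + 3), (.A, -N + -4), (.a, N + 3), (.B, -N + -2)]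

def meC1 (N : ℕ) : List (Kd × ℤ) := cyc4 (meI1 N) (run .b .A 1 N) (meO1 N) (run .B .a (-1) N)

theorem meG1 {N k ℓ : ℕ} (hℓ : ℓ = 2 * k + 1) (hk : k = 2 * N + 8) (hN : 0 ≤ N) :
    ZG k ℓ (-k) (meC1 N) := by
  refine zg_mk _ (10 * ℓ) (-2 * N + -7) ?_ (c4_nodup ?_ (run_nodup (by decide) (by decide))
    (run_nodup (by decide) (by decide)) (run_all fun i hi => ?_) (run_all fun i hi => ?_)
    (run_disj (by decide))) (c4_all ?_ (run_all fun i hi => ?_) (run_all fun i hi => ?_))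
  · rw [meC1, c4_len, run, run, zig_len, zig_len]
    simp only [meI1, meO1, List.cons_append, List.nil_append, List.length_cons, List.length_nil]
    omega
  all_goals
    try simp only [meI1, meO1, List.cons_append, List.nil_append, List.forall_mem_cons]
    simp only [meI1, meO1, List.cons_append, List.nil_append, sl, sl2,
      reduceCtorEq, forall_const, IsEmpty.forall_iff, implies_true, not_false_eq_true]
    omega

theorem meS1 {N k : ℕ} (hk : k = 2 * N + 8) (r : ℤ → ℤ) (hr : ∀ x, r x = 0 ∨ r x = 1) :
    ((meC1 N).map (vz r 1)).sum = k ∨ ((meC1 N).map (vz r 1)).sum = k + 1 := by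
  rw [meC1, c4_sum]
  simp only [run_vz_pos, run_vz_neg]
  simp only [meI1, meO1, List.cons_append, List.nil_append, List.map_cons, List.map_nil,
    List.sum_cons, List.sum_nil, vz, bt, ep]
  rcases hr (-2 * N + -7) with h | h <;> omega

theorem meW1 {N : ℕ} : ∀ u ∈ meC1 N, u.1 ≠ .w := by
  refine c4_all ?_ (run_all fun i hi => ?_) (run_all fun i hi => ?_)
  all_goals simp [meI1, meO1]

def meI2 (N : ℕ) : List (Kd × ℤ) :=
  [(.a, -2), (.A, 1), (.zb, 0), (.a, -1), (.B, 1), (.b, -1), (.B, 2)]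

def meO2 (N : ℕ) : List (Kd × ℤ) :=
  [(.b, -N + -2), (.B, N + 3), (.b, -N + -3), (.A, N + 3), (.b, -N + -4), (.B, N + 5), (.a, -N + -4), (.A, N + 5), (.a, -N + -3), (.A, N + 2)]

def meC2 (N : ℕ) : List (Kd × ℤ) := cyc4 (meI2 N) (run .b .B (-1) N) (meO2 N) (run .A .a 1 N)

theorem meG2 {N k ℓ : ℕ} (hℓ : ℓ = 2 * k + 1) (hk : k = 2 * N + 8) (hN : 0 ≤ N) :
    ZG k ℓ (-k) (meC2 N) := by
  refine zg_mk _ 0 (10 * ℓ) ?_ (c4_nodup ?_ (run_nodup (by decide) (by decide))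
    (run_nodup (by decide) (by decide)) (run_all fun i hi => ?_) (run_all fun i hi => ?_)
    (run_disj (by decide))) (c4_all ?_ (run_all fun i hi => ?_) (run_all fun i hi => ?_))
  · rw [meC2, c4_len, run, run, zig_len, zig_len]
    simp only [meI2, meO2, List.cons_append, List.nil_append, List.length_cons, List.length_nil]
    omega
  all_goals
    try simp only [meI2, meO2, List.cons_append, List.nil_append, List.forall_mem_cons]
    simp only [meI2, meO2, List.cons_append, List.nil_append, sl, sl2,
      reduceCtorEq, forall_const, IsEmpty.forall_iff, implies_true, not_false_eq_true]
    omega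

theorem meS2 {N k : ℕ} (hk : k = 2 * N + 8) (r : ℤ → ℤ) (hr : ∀ x, r x = 0 ∨ r x = 1) :
    ((meC2 N).map (vz r 1)).sum = k ∨ ((meC2 N).map (vz r 1)).sum = k + 1 := by
  rw [meC2, c4_sum]
  simp only [run_vz_pos, run_vz_neg]
  simp only [meI2, meO2, List.cons_append, List.nil_append, List.map_cons, List.map_nil,
    List.sum_cons, List.sum_nil, vz, bt, ep]
  rcases hr 0 with h | h <;> omega

theorem meW2 {N : ℕ} : ∀ u ∈ meC2 N, u.1 ≠ .w := by
  refine c4_all ?_ (run_all fun i hi => ?_) (run_all fun i hi => ?_)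
  all_goals simp [meI2, meO2]

def meI3 (N : ℕ) : List (Kd × ℤ) :=
  [(.A, -2), (.a, 1), (.zb, 0), (.A, -1), (.b, 1), (.B, -1), (.b, 2)]

def meO3 (N : ℕ) : List (Kd × ℤ) :=
  [(.B, -N + -2), (.b, N + 3), (.A, -N + -5), (.b, N + 4), (.B, -N + -5), (.a, N + 4), (.B, -N + -3), (.a, N + 3), (.A, -N + -3), (.a, N + 2)]

def meC3 (N : ℕ) : List (Kd × ℤ) := cyc4 (meI3 N) (run .B .b (-1) N) (meO3 N) (run .a .A 1 N)

theorem meG3 {N k ℓ : ℕ} (hℓ : ℓ = 2 * k + 1) (hk : k = 2 * N + 8) (hN : 0 ≤ N) :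
    ZG k ℓ (-k) (meC3 N) := by
  refine zg_mk _ 0 (10 * ℓ) ?_ (c4_nodup ?_ (run_nodup (by decide) (by decide))
    (run_nodup (by decide) (by decide)) (run_all fun i hi => ?_) (run_all fun i hi => ?_)
    (run_disj (by decide))) (c4_all ?_ (run_all fun i hi => ?_) (run_all fun i hi => ?_))
  · rw [meC3, c4_len, run, run, zig_len, zig_len]
    simp only [meI3, meO3, List.cons_append, List.nil_append, List.length_cons, List.length_nil]
    omega
  all_goals
    try simp only [meI3, meO3, List.cons_append, List.nil_append, List.forall_mem_cons]
    simp only [meI3, meO3, List.cons_append, List.nil_append, sl, sl2,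
      reduceCtorEq, forall_const, IsEmpty.forall_iff, implies_true, not_false_eq_true]
    omega

theorem meS3 {N k : ℕ} (hk : k = 2 * N + 8) (r : ℤ → ℤ) (hr : ∀ x, r x = 0 ∨ r x = 1) :
    ((meC3 N).map (vz r 1)).sum = k ∨ ((meC3 N).map (vz r 1)).sum = k + 1 := by
  rw [meC3, c4_sum]
  simp only [run_vz_pos, run_vz_neg]
  simp only [meI3, meO3, List.cons_append, List.nil_append, List.map_cons, List.map_nil,
    List.sum_cons, List.sum_nil, vz, bt, ep]
  rcases hr 0 with h | h <;> omega

theorem meW3 {N : ℕ} : ∀ u ∈ meC3 N, u.1 ≠ .w := by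
  refine c4_all ?_ (run_all fun i hi => ?_) (run_all fun i hi => ?_)
  all_goals simp [meI3, meO3]

def meC (N : ℕ) : Fin 4 → List (Kd × ℤ) := ![meC0 N, meC1 N, meC2 N, meC3 N]

theorem meaA {N k ℓ : ℕ} (hℓ : ℓ = 2 * k + 1) (hk : k = 2 * N + 8) (d : ℤ) (h1 : -k ≤ d) (h2 : d ≤ k) :
    Cz ℓ (meC N) (fun _ => 1) .a .A d := by
  have hc : 4 ≤ -d ∧ -d ≤ 2 * N + 4 ∨ 4 ≤ d ∧ d ≤ 2 * N + 4 ∨ d = -2 * N + -5 ∨ d = -2 * N + -6 ∨ d = -2 * N + -7 ∨ d = -2 * N + -8 ∨ d = -1 ∨ d = -2 ∨ d = -3 ∨ d = 0 ∨ d = 1 ∨ d = 2 ∨ d = 3 ∨ d = 2 * N + 5 ∨ d = 2 * N + 6 ∨ d = 2 * N + 7 ∨ d = 2 * N + 8 := by omega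
  rcases hc with h0 | h0 | h0 | h0 | h0 | h0 | h0 | h0 | h0 | h0 | h0 | h0 | h0 | h0 | h0 | h0 | h0
  · obtain ⟨x, y, h, ha⟩ := run1 (I := meI3 N) (O := meO3 N) (Z2 := run .B .b (-1) N) .a .A 1 N
      (o := (.a, N + 2)) (i := (.A, -2))
      rfl rfl (congrArg (Prod.mk _) (by ring)) rfl (-d) (by omega) (by omega)
    exact cz_mk (fun _ => rfl) 3 y x ha.symm 0 (by omega)
  · obtain ⟨x, y, h, ha⟩ := run1 (I := meI2 N) (O := meO2 N) (Z2 := run .b .B (-1) N) .A .a 1 N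
      (o := (.A, N + 2)) (i := (.a, -2))
      rfl rfl (congrArg (Prod.mk _) (by ring)) rfl d (by omega) (by omega)
    exact cz_mk (fun _ => rfl) 2 x y ha 0 (by omega)
  · exact cz_mk (fun _ => rfl) 3 (N + 2) (-N + -3) (c4_out (infix_get 8 rfl rfl)).symm 0 (by omega)
  · exact cz_mk (fun _ => rfl) 3 (N + 3) (-N + -3) (c4_out (infix_get 7 rfl rfl)) 0 (by omega)
  · exact cz_mk (fun _ => rfl) 1 (N + 3) (-N + -4) (c4_out (infix_get 3 rfl rfl)).symm 0 (by omega)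
  · exact cz_mk (fun _ => rfl) 2 (-N + -4) (N + 5) (c4_out (infix_get 6 rfl rfl)) 1 (by omega)
  · exact cz_mk (fun _ => rfl) 0 1 0 (c4_in (infix_get 2 rfl rfl)).symm 0 (by omega)
  · exact cz_mk (fun _ => rfl) 1 1 (-1) (c4_in (infix_get 6 rfl rfl)).symm 0 (by omega)
  · exact cz_mk (fun _ => rfl) 3 1 (-2) (c4_in (infix_get 0 rfl rfl)).symm 0 (by omega)
  · exact cz_mk (fun _ => rfl) 1 (-1) (-1) (c4_in (infix_get 5 rfl rfl)) 0 (by omega)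
  · exact cz_mk (fun _ => rfl) 0 (-1) 0 (c4_in (infix_get 1 rfl rfl)) 0 (by omega)
  · exact cz_mk (fun _ => rfl) 1 (-1) 1 (c4_in (infix_get 4 rfl rfl)).symm 0 (by omega)
  · exact cz_mk (fun _ => rfl) 2 (-2) 1 (c4_in (infix_get 0 rfl rfl)) 0 (by omega)
  · exact cz_mk (fun _ => rfl) 2 (-N + -3) (N + 2) (c4_out (infix_get 8 rfl rfl)) 0 (by omega)
  · exact cz_mk (fun _ => rfl) 0 (-N + -2) (N + 4) (c4_out (infix_get 4 rfl rfl)).symm 0 (by omega)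
  · exact cz_mk (fun _ => rfl) 0 (-N + -3) (N + 4) (c4_out (infix_get 3 rfl rfl)) 0 (by omega)
  · exact cz_mk (fun _ => rfl) 2 (-N + -3) (N + 5) (c4_out (infix_get 7 rfl rfl)).symm 0 (by omega)

theorem mebB {N k ℓ : ℕ} (hℓ : ℓ = 2 * k + 1) (hk : k = 2 * N + 8) (d : ℤ) (h1 : -k ≤ d) (h2 : d ≤ k) :
    Cz ℓ (meC N) (fun _ => 1) .b .B d := by
  have hc : 4 ≤ -d ∧ -d ≤ 2 * N + 4 ∨ 4 ≤ d ∧ d ≤ 2 * N + 4 ∨ d = -2 * N + -5 ∨ d = -2 * N + -6 ∨ d = -2 * N + -7 ∨ d = -2 * N + -8 ∨ d = -1 ∨ d = -2 ∨ d = -3 ∨ d = 0 ∨ d = 1 ∨ d = 2 ∨ d = 3 ∨ d = 2 * N + 5 ∨ d = 2 * N + 6 ∨ d = 2 * N + 7 ∨ d = 2 * N + 8 := by omega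
  rcases hc with h0 | h0 | h0 | h0 | h0 | h0 | h0 | h0 | h0 | h0 | h0 | h0 | h0 | h0 | h0 | h0 | h0
  · obtain ⟨x, y, h, ha⟩ := run2 (I := meI3 N) (O := meO3 N) (Z1 := run .a .A 1 N) .B .b (-1) N
      (o := (.B, -N + -2)) (i := (.b, 2))
      rfl rfl (congrArg (Prod.mk _) (by ring)) rfl (-d) (by omega) (by omega)
    exact cz_mk (fun _ => rfl) 3 x y ha 0 (by omega)
  · obtain ⟨x, y, h, ha⟩ := run2 (I := meI2 N) (O := meO2 N) (Z1 := run .A .a 1 N) .b .B (-1) N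
      (o := (.b, -N + -2)) (i := (.B, 2))
      rfl rfl (congrArg (Prod.mk _) (by ring)) rfl d (by omega) (by omega)
    exact cz_mk (fun _ => rfl) 2 y x ha.symm 0 (by omega)
  · exact cz_mk (fun _ => rfl) 3 (N + 3) (-N + -2) (c4_out (infix_get 0 rfl rfl)).symm 0 (by omega)
  · exact cz_mk (fun _ => rfl) 1 (N + 2) (-N + -4) (c4_out (infix_get 0 rfl rfl)) 0 (by omega)
  · exact cz_mk (fun _ => rfl) 1 (N + 3) (-N + -4) (c4_out (infix_get 1 rfl rfl)).symm 0 (by omega)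
  · exact cz_mk (fun _ => rfl) 2 (-N + -4) (N + 5) (c4_out (infix_get 4 rfl rfl)) 1 (by omega)
  · exact cz_mk (fun _ => rfl) 0 0 (-1) (c4_in (infix_get 4 rfl rfl)).symm 0 (by omega)
  · exact cz_mk (fun _ => rfl) 3 1 (-1) (c4_in (infix_get 4 rfl rfl)) 0 (by omega)
  · exact cz_mk (fun _ => rfl) 3 2 (-1) (c4_in (infix_get 5 rfl rfl)).symm 0 (by omega)
  · exact cz_mk (fun _ => rfl) 1 1 1 (c4_in (infix_get 8 rfl rfl)).symm 0 (by omega)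
  · exact cz_mk (fun _ => rfl) 0 0 1 (c4_in (infix_get 5 rfl rfl)) 0 (by omega)
  · exact cz_mk (fun _ => rfl) 2 (-1) 1 (c4_in (infix_get 4 rfl rfl)).symm 0 (by omega)
  · exact cz_mk (fun _ => rfl) 2 (-1) 2 (c4_in (infix_get 5 rfl rfl)) 0 (by omega)
  · exact cz_mk (fun _ => rfl) 2 (-N + -2) (N + 3) (c4_out (infix_get 0 rfl rfl)) 0 (by omega)
  · exact cz_mk (fun _ => rfl) 2 (-N + -3) (N + 3) (c4_out (infix_get 1 rfl rfl)).symm 0 (by omega)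
  · exact cz_mk (fun _ => rfl) 0 (-N + -3) (N + 4) (c4_out (infix_get 1 rfl rfl)) 0 (by omega)
  · exact cz_mk (fun _ => rfl) 3 (N + 4) (-N + -5) (c4_out (infix_get 3 rfl rfl)) (-1) (by omega)

theorem meaB {N k ℓ : ℕ} (hℓ : ℓ = 2 * k + 1) (hk : k = 2 * N + 8) (d : ℤ) (h1 : -k ≤ d) (h2 : d ≤ k)
    (h3 : d ≠ -1) (h4 : d ≠ 1) (h5 : d ≠ -(-2 * N + -5)) (h6 : d ≠ -(-2 * N + -6)) :
    Cz ℓ (meC N) (fun _ => 1) .a .B d := by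
  have hc : 4 ≤ -d ∧ -d ≤ 2 * N + 4 ∨ 4 ≤ d ∧ d ≤ 2 * N + 4 ∨ d = -2 * N + -5 ∨ d = -2 * N + -6 ∨ d = -2 * N + -7 ∨ d = -2 * N + -8 ∨ d = -2 ∨ d = -3 ∨ d = 0 ∨ d = 2 ∨ d = 3 ∨ d = 2 * N + 7 ∨ d = 2 * N + 8 := by omega
  rcases hc with h0 | h0 | h0 | h0 | h0 | h0 | h0 | h0 | h0 | h0 | h0 | h0 | h0
  · obtain ⟨x, y, h, ha⟩ := run1 (I := meI1 N) (O := meO1 N) (Z2 := run .b .A 1 N) .B .a (-1) N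
      (o := (.B, -N + -2)) (i := (.a, 2))
      rfl rfl (congrArg (Prod.mk _) (by ring)) rfl (-d) (by omega) (by omega)
    exact cz_mk (fun _ => rfl) 1 x y ha 0 (by omega)
  · obtain ⟨x, y, h, ha⟩ := run1 (I := meI0 N) (O := meO0 N) (Z2 := run .A .b 1 N) .a .B (-1) N
      (o := (.a, -N + -2)) (i := (.B, 2))
      rfl rfl (congrArg (Prod.mk _) (by ring)) rfl d (by omega) (by omega)
    exact cz_mk (fun _ => rfl) 0 y x ha.symm 0 (by omega)
  · exact cz_mk (fun _ => rfl) 1 (N + 3) (-N + -2) (c4_out (infix_get 4 rfl rfl)) 0 (by omega)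
  · exact cz_mk (fun _ => rfl) 3 (N + 3) (-N + -3) (c4_out (infix_get 6 rfl rfl)).symm 0 (by omega)
  · exact cz_mk (fun _ => rfl) 3 (N + 4) (-N + -3) (c4_out (infix_get 5 rfl rfl)) 0 (by omega)
  · exact cz_mk (fun _ => rfl) 2 (-N + -4) (N + 5) (c4_out (infix_get 5 rfl rfl)).symm 1 (by omega)
  · exact cz_mk (fun _ => rfl) 0 1 (-1) (c4_in (infix_get 3 rfl rfl)) 0 (by omega)
  · exact cz_mk (fun _ => rfl) 1 2 (-1) (c4_in (infix_get 0 rfl rfl)) 0 (by omega)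
  · exact cz_mk (fun _ => rfl) 1 1 1 (c4_in (infix_get 7 rfl rfl)) 0 (by omega)
  · exact cz_mk (fun _ => rfl) 2 (-1) 1 (c4_in (infix_get 3 rfl rfl)) 0 (by omega)
  · exact cz_mk (fun _ => rfl) 0 (-1) 2 (c4_in (infix_get 0 rfl rfl)).symm 0 (by omega)
  · exact cz_mk (fun _ => rfl) 0 (-N + -3) (N + 4) (c4_out (infix_get 2 rfl rfl)).symm 0 (by omega)
  · exact cz_mk (fun _ => rfl) 3 (N + 4) (-N + -5) (c4_out (infix_get 4 rfl rfl)).symm (-1) (by omega)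

theorem meAb {N k ℓ : ℕ} (hℓ : ℓ = 2 * k + 1) (hk : k = 2 * N + 8) (d : ℤ) (h1 : -k ≤ d) (h2 : d ≤ k)
    (h3 : d ≠ -1) (h4 : d ≠ 1) (h5 : d ≠ -(-2 * N + -5)) (h6 : d ≠ -(-2 * N + -6)) :
    Cz ℓ (meC N) (fun _ => 1) .A .b d := by
  have hc : 4 ≤ -d ∧ -d ≤ 2 * N + 4 ∨ 4 ≤ d ∧ d ≤ 2 * N + 4 ∨ d = -2 * N + -5 ∨ d = -2 * N + -6 ∨ d = -2 * N + -7 ∨ d = -2 * N + -8 ∨ d = -2 ∨ d = -3 ∨ d = 0 ∨ d = 2 ∨ d = 3 ∨ d = 2 * N + 7 ∨ d = 2 * N + 8 := by omega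
  rcases hc with h0 | h0 | h0 | h0 | h0 | h0 | h0 | h0 | h0 | h0 | h0 | h0 | h0
  · obtain ⟨x, y, h, ha⟩ := run2 (I := meI0 N) (O := meO0 N) (Z1 := run .a .B (-1) N) .A .b 1 N
      (o := (.A, N + 2)) (i := (.b, -2))
      rfl rfl (congrArg (Prod.mk _) (by ring)) rfl (-d) (by omega) (by omega)
    exact cz_mk (fun _ => rfl) 0 y x ha.symm 0 (by omega)
  · obtain ⟨x, y, h, ha⟩ := run2 (I := meI1 N) (O := meO1 N) (Z1 := run .B .a (-1) N) .b .A 1 N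
      (o := (.b, N + 2)) (i := (.A, -2))
      rfl rfl (congrArg (Prod.mk _) (by ring)) rfl d (by omega) (by omega)
    exact cz_mk (fun _ => rfl) 1 x y ha 0 (by omega)
  · exact cz_mk (fun _ => rfl) 0 (N + 2) (-N + -3) (c4_out (infix_get 0 rfl rfl)) 0 (by omega)
  · exact cz_mk (fun _ => rfl) 2 (N + 3) (-N + -3) (c4_out (infix_get 2 rfl rfl)).symm 0 (by omega)
  · exact cz_mk (fun _ => rfl) 2 (N + 3) (-N + -4) (c4_out (infix_get 3 rfl rfl)) 0 (by omega)
  · exact cz_mk (fun _ => rfl) 3 (-N + -5) (N + 4) (c4_out (infix_get 2 rfl rfl)) 1 (by omega)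
  · exact cz_mk (fun _ => rfl) 1 1 (-1) (c4_in (infix_get 3 rfl rfl)).symm 0 (by omega)
  · exact cz_mk (fun _ => rfl) 0 1 (-2) (c4_in (infix_get 9 rfl rfl)) 0 (by omega)
  · exact cz_mk (fun _ => rfl) 0 1 1 (c4_in (infix_get 8 rfl rfl)).symm 0 (by omega)
  · exact cz_mk (fun _ => rfl) 3 (-1) 1 (c4_in (infix_get 3 rfl rfl)) 0 (by omega)
  · exact cz_mk (fun _ => rfl) 1 (-2) 1 (c4_in (infix_get 9 rfl rfl)).symm 0 (by omega)
  · exact cz_mk (fun _ => rfl) 1 (-N + -4) (N + 3) (c4_out (infix_get 2 rfl rfl)).symm 0 (by omega)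
  · exact cz_mk (fun _ => rfl) 3 (-N + -5) (N + 3) (c4_out (infix_get 1 rfl rfl)).symm 0 (by omega)

theorem meaz {N k ℓ : ℕ} (hℓ : ℓ = 2 * k + 1) (hk : k = 2 * N + 8) (d : ℤ) (h : d = -1 ∨ d = 1) :
    Cz ℓ (meC N) (fun _ => 1) .a .zb d := by
  have hc : d = -1 ∨ d = 1 := by omega
  rcases hc with h0 | h0
  · exact cz_mk (fun _ => rfl) 3 1 0 (c4_in (infix_get 1 rfl rfl)) 0 (by omega)
  · exact cz_mk (fun _ => rfl) 2 (-1) 0 (c4_in (infix_get 2 rfl rfl)).symm 0 (by omega)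

theorem meAz {N k ℓ : ℕ} (hℓ : ℓ = 2 * k + 1) (hk : k = 2 * N + 8) (d : ℤ) (h : d = -1 ∨ d = 1) :
    Cz ℓ (meC N) (fun _ => 1) .A .zb d := by
  have hc : d = -1 ∨ d = 1 := by omega
  rcases hc with h0 | h0
  · exact cz_mk (fun _ => rfl) 2 1 0 (c4_in (infix_get 1 rfl rfl)) 0 (by omega)
  · exact cz_mk (fun _ => rfl) 3 (-1) 0 (c4_in (infix_get 2 rfl rfl)).symm 0 (by omega)

theorem mebz {N k ℓ : ℕ} (hℓ : ℓ = 2 * k + 1) (hk : k = 2 * N + 8) (d : ℤ) (h : d = -2 * N + -5 ∨ d = -2 * N + -6) :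
    Cz ℓ (meC N) (fun _ => 1) .b .za d := by
  have hc : d = -2 * N + -5 ∨ d = -2 * N + -6 := by omega
  rcases hc with h0 | h0
  · exact cz_mk (fun _ => rfl) 0 1 (-2 * N + -4) (c4_in (infix_get 7 rfl rfl)).symm 0 (by omega)
  · exact cz_mk (fun _ => rfl) 1 (-1) (-2 * N + -7) (c4_in (infix_get 2 rfl rfl)).symm 0 (by omega)

theorem meBz {N k ℓ : ℕ} (hℓ : ℓ = 2 * k + 1) (hk : k = 2 * N + 8) (d : ℤ) (h : d = -2 * N + -5 ∨ d = -2 * N + -6) :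
    Cz ℓ (meC N) (fun _ => 1) .B .za d := by
  have hc : d = -2 * N + -5 ∨ d = -2 * N + -6 := by omega
  rcases hc with h0 | h0
  · exact cz_mk (fun _ => rfl) 0 1 (-2 * N + -4) (c4_in (infix_get 6 rfl rfl)) 0 (by omega)
  · exact cz_mk (fun _ => rfl) 1 (-1) (-2 * N + -7) (c4_in (infix_get 1 rfl rfl)) 0 (by omega)

theorem meD {N k ℓ : ℕ} [NeZero ℓ] (hℓ : ℓ = 2 * k + 1) (hk : k = 2 * N + 8) (hN : 0 ≤ N)
    (ρ : ZMod ℓ → Bool) :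
    MainD ρ k [((-1 : ℤ) : ZMod ℓ), ((1 : ℤ) : ZMod ℓ)]
      [((-2 * N + -5 : ℤ) : ZMod ℓ), ((-2 * N + -6 : ℤ) : ZMod ℓ)] (fun i => (meC N i).map (lift ℓ 1)) := by
  refine mainD_mk hℓ ρ (meC N) _ _ ?_ ?_ ?_ (meaA hℓ hk) (mebB hℓ hk) (meaB hℓ hk) (meAb hℓ hk)
    (fun d h => ⟨meaz hℓ hk d h, meAz hℓ hk d h⟩) (fun d h => ⟨mebz hℓ hk d h, meBz hℓ hk d h⟩)
  · intro i
    fin_cases i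
    exacts [meG0 hℓ hk hN, meG1 hℓ hk hN, meG2 hℓ hk hN, meG3 hℓ hk hN]
  · intro i r hr
    fin_cases i
    exacts [meS0 hk r hr, meS1 hk r hr, meS2 hk r hr, meS3 hk r hr]
  · intro i
    fin_cases i
    exacts [meW0, meW1, meW2, meW3]

/-- A zigzag segment following the vertex `(q, u)`. -/
def zz (p q : Kd) (x u ε : ℤ) (N : ℕ) := zig p q x ε (u - ε) (-ε) N

theorem zig_e2' (p q : Kd) (x dx y dy : ℤ) (N : ℕ) (v : Kd × ℤ) (i : ℕ) (hi : i < N) :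
    [(q, y - dy + dy * i), (p, x + dx * i)] <:+: [(q, y - dy)] ++ zig p q x dx y dy N ++ [v] := by
  induction N generalizing x y i with
  | zero => omega
  | succ N ih =>
    cases i with
    | zero => exact ⟨[], (q, y) :: zig p q (x + dx) dx (y + dy) dy N ++ [v], by simp [zig]⟩
    | succ i =>
      have h := ih (x + dx) (y + dy) i (by omega)
      rw [show y + dy - dy = y by ring] at h
      have e1 : y - dy + dy * ((i + 1 : ℕ) : ℤ) = y + dy * i := by push_cast; ring
      have e2 : x + dx * ((i + 1 : ℕ) : ℤ) = x + dx + dx * i := by push_cast; ring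
      rw [e1, e2]
      exact h.trans ⟨[(q, y - dy), (p, x)], [], by simp [zig]⟩

theorem zig_eN (p q : Kd) (x dx y dy : ℤ) (N : ℕ) (v : Kd × ℤ) :
    [(q, y - dy + dy * N), v] <:+: [(q, y - dy)] ++ zig p q x dx y dy N ++ [v] := by
  induction N generalizing x y with
  | zero => exact ⟨[], [], by simp [zig]⟩
  | succ N ih =>
    have h := ih (x + dx) (y + dy)
    rw [show y + dy - dy = y by ring] at h
    have e1 : y - dy + dy * ((N + 1 : ℕ) : ℤ) = y + dy * N := by push_cast; ring
    rw [e1]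
    exact h.trans ⟨[(q, y - dy), (p, x)], [], by simp [zig]⟩

theorem Adj.inf {L X : List (Kd × ℤ)} {u v : Kd × ℤ} (h : [u, v] <:+: X) (hX : X <:+: L) : Adj L u v :=
  Or.inl ((h.trans hX).trans ⟨[], L.take 1, by simp⟩)

theorem Adj.wrap {L T : List (Kd × ℤ)} {u v : Kd × ℤ} (h : L = u :: (T ++ [v])) : Adj L v u :=
  Or.inl ⟨u :: T, [], by simp [h]⟩

theorem zz_cov {L : List (Kd × ℤ)} {p q : Kd} {x u ε : ℤ} {N : ℕ} {v : Kd × ℤ}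
    (hX : [(q, u)] ++ zz p q x u ε N ++ [v] <:+: L) (m : ℤ) (h0 : 0 ≤ m)
    (h1 : m < 2 * N ∨ (m = 2 * N ∧ v = (p, x + ε * N))) :
    ∃ X Y, Y - X = x - u + ε * m ∧ Adj L (q, X) (p, Y) := by
  obtain ⟨j, hj | hj⟩ := Int.even_or_odd' m
  · have hj' : ((j.toNat : ℕ) : ℤ) = j := Int.toNat_of_nonneg (by omega)
    have h : [(q, u - ε - -ε + -ε * (j.toNat : ℤ)), (p, x + ε * (j.toNat : ℤ))] <:+:
        [(q, u)] ++ zz p q x u ε N ++ [v] := by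
      rcases h1 with h1 | ⟨h1, rfl⟩
      · have := zig_e2' p q x ε (u - ε) (-ε) N v j.toNat (by omega)
        rw [show ([(q, u)] : List (Kd × ℤ)) = [(q, u - ε - -ε)] by simp]
        exact this
      · have := zig_e2 p q x ε (u - ε) (-ε) N j.toNat (by omega)
        rw [show ([(q, u)] : List (Kd × ℤ)) = [(q, u - ε - -ε)] by simp]
        exact this
    refine ⟨_, _, ?_, Adj.inf h hX⟩
    rw [hj', hj]; ring
  · have hj' : ((j.toNat : ℕ) : ℤ) = j := Int.toNat_of_nonneg (by omega)
    have h := zig_e1 p q x ε (u - ε) (-ε) N j.toNat (by omega)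
    refine ⟨_, _, ?_, (Adj.inf h (List.IsInfix.trans ⟨[(q, u)], [v], rfl⟩ hX)).symm⟩
    rw [hj', hj]; ring

theorem zz_last {L : List (Kd × ℤ)} {p q : Kd} {x u ε : ℤ} {N : ℕ} {v : Kd × ℤ}
    (hX : [(q, u)] ++ zz p q x u ε N ++ [v] <:+: L) (y : ℤ) (hy : y = u - ε * N) : Adj L (q, y) v := by
  have := zig_eN p q x ε (u - ε) (-ε) N v
  rw [show u - ε - -ε = u by ring, show u + -ε * N = y by rw [hy]; ring] at this
  exact Adj.inf this hX

theorem zz_all {P : Kd × ℤ → Prop} {p q : Kd} {x u ε : ℤ} {N : ℕ} :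
    (∀ v ∈ zz p q x u ε N, P v) ↔ ∀ i : ℕ, i < N → P (p, x + ε * i) ∧ P (q, u - ε - ε * i) := by
  rw [zz, zig_all]
  simp only [neg_mul, ← sub_eq_add_neg]

theorem zz_len (p q : Kd) (x u ε : ℤ) (N : ℕ) : (zz p q x u ε N).length = 2 * N := zig_len ..

theorem zz_nodup {p q : Kd} {x u ε : ℤ} {N : ℕ} (hε : ε = 1 ∨ ε = -1)
    (h : p ≠ q ∨ ∀ i j : ℕ, i < N → j < N → x + ε * i ≠ u - ε - ε * j) : (zz p q x u ε N).Nodup := by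
  apply zig_nodup
  · omega
  · omega
  · simpa only [neg_mul, ← sub_eq_add_neg] using h

theorem app_nodup {L M : List (Kd × ℤ)} (h1 : L.Nodup) (h2 : M.Nodup)
    (h : ∀ u ∈ L, ∀ v ∈ M, u ≠ v) : (L ++ M).Nodup :=
  List.nodup_append.2 ⟨h1, h2, h⟩

theorem antid (r : ℤ → ℤ) : ∃ S : ℤ → ℤ, ∀ x, S (x + 1) = S x + r x := by
  refine ⟨fun x => ∑ i ∈ Finset.range x.toNat, r i - ∑ i ∈ Finset.range (-x).toNat, r (-(i : ℤ) - 1), ?_⟩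
  intro x
  rcases lt_or_ge x 0 with h | h
  · obtain ⟨n, rfl⟩ : ∃ n : ℕ, x = -(n : ℤ) - 1 := ⟨(-x - 1).toNat, by omega⟩
    simp only [show (-(n : ℤ) - 1 + 1).toNat = 0 by omega, show (-(n : ℤ) - 1).toNat = 0 by omega,
      show (-(-(n : ℤ) - 1 + 1)).toNat = n by omega, show (-(-(n : ℤ) - 1)).toNat = n + 1 by omega,
      Finset.sum_range_succ]
    ring
  · obtain ⟨n, rfl⟩ : ∃ n : ℕ, x = n := ⟨x.toNat, by omega⟩
    simp only [show ((n : ℤ) + 1).toNat = n + 1 by omega, show (-((n : ℤ) + 1)).toNat = 0 by omega,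
      show (-(n : ℤ)).toNat = 0 by omega, show (n : ℤ).toNat = n by omega, Finset.sum_range_succ]
    ring

theorem Fs_up {r S : ℤ → ℤ} (hS : ∀ x, S (x + 1) = S x + r x) (x : ℤ) (N : ℕ) :
    Fs r x 1 N = S (x + N) - S x := by
  induction N with
  | zero => simp [Fs]
  | succ N ih =>
    rw [Fs, Finset.sum_range_succ]
    rw [Fs] at ih
    rw [ih]
    have := hS (x + N)
    push_cast
    rw [← add_assoc, this, one_mul]; ring

theorem Fs_dn {r S : ℤ → ℤ} (hS : ∀ x, S (x + 1) = S x + r x) (x : ℤ) (N : ℕ) :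
    Fs r x (-1) N = S (x + 1) - S (x + 1 - N) := by
  induction N with
  | zero => simp [Fs]
  | succ N ih =>
    rw [Fs, Finset.sum_range_succ]
    rw [Fs] at ih
    rw [ih]
    have := hS (x - N)
    push_cast
    rw [show x + 1 - ((N : ℤ) + 1) = x - N by ring, show x + 1 - (N : ℤ) = x - N + 1 by ring, this,
      show x + -1 * (N : ℤ) = x - N by ring]; ring

def ek (κ : ℤ) : Kd → ℤ
  | .a => 1 | .A => 1 | .za => 1 | .b => -1 | .B => -1 | .zb => -1 | .w => κ

theorem zz_vz (r : ℤ → ℤ) (κ : ℤ) (p q : Kd) (x u ε : ℤ) (N : ℕ) :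
    ((zz p q x u ε N).map (vz r κ)).sum =
      bt p * N + ek κ p * Fs r x ε N + (bt q * N + ek κ q * Fs r (u - ε) (-ε) N) := by
  rw [zz, zig_sum]
  have h : ∀ (p : Kd) (x d : ℤ), ∑ i ∈ Finset.range N, vz r κ (p, x + d * i) =
      bt p * N + ek κ p * Fs r x d N := by
    intro p x d
    have hv : ∀ y, vz r κ (p, y) = bt p + ek κ p * r y := by
      intro y
      cases p <;> simp [vz, bt, ek] <;> ring
    simp only [hv, Finset.sum_add_distrib, Finset.sum_const, Finset.card_range, nsmul_eq_mul, Fs,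
      Finset.mul_sum]
    ring
  rw [h, h]

theorem zz_pos {r S : ℤ → ℤ} (hS : ∀ x, S (x + 1) = S x + r x) (κ : ℤ) (p q : Kd) (x u : ℤ) (N : ℕ)
    (x' u' : ℤ) (hx : x' = x + N) (hu : u' = u - N) : ((zz p q x u 1 N).map (vz r κ)).sum =
      bt p * N + ek κ p * (S x' - S x) + (bt q * N + ek κ q * (S u - S u')) := by
  rw [zz_vz, Fs_up hS, Fs_dn hS, hx, hu, sub_add_cancel]

theorem zz_neg {r S : ℤ → ℤ} (hS : ∀ x, S (x + 1) = S x + r x) (κ : ℤ) (p q : Kd) (x u : ℤ) (N : ℕ)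
    (x1 x' u1 u' : ℤ) (h1 : x1 = x + 1) (hx : x' = x + 1 - N) (h2 : u1 = u + 1) (hu : u' = u + 1 + N) :
    ((zz p q x u (-1) N).map (vz r κ)).sum =
      bt p * N + ek κ p * (S x1 - S x') + (bt q * N + ek κ q * (S u' - S u1)) := by
  rw [zz_vz, Fs_dn hS, neg_neg, Fs_up hS, h1, h2, hx, hu, sub_neg_eq_add]

theorem st {S r : ℤ → ℤ} (hS : ∀ x, S (x + 1) = S x + r x) (x y : ℤ) (h : x = y + 1) :
    S x = S y + r y := h ▸ hS y

theorem zw {m x N ε y : ℤ} {p : Kd} (h : m ≤ 2 * N) (h2 : m = 2 * N → y = x + ε * N) :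
    m < 2 * N ∨ (m = 2 * N ∧ (p, y) = (p, x + ε * N)) := by
  rcases lt_or_eq_of_le h with h | h
  · exact Or.inl h
  · exact Or.inr ⟨h, congrArg _ (h2 h)⟩

theorem inf_skip {X R : List (Kd × ℤ)} (P : List (Kd × ℤ)) (h : X <:+: R) : X <:+: P ++ R :=
  h.trans ⟨P, [], by simp⟩

theorem inf_here (X R : List (Kd × ℤ)) : X <:+: X ++ R := ⟨[], R, by simp⟩

theorem inf_zz {S Z W : List (Kd × ℤ)} {u v : Kd × ℤ} (hu : S.getLast? = some u)
    (hv : W.head? = some v) : [u] ++ Z ++ [v] <:+: S ++ (Z ++ W) := by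
  obtain ⟨S', rfl⟩ := List.getLast?_eq_some_iff.1 hu
  obtain ⟨W', rfl⟩ := List.head?_eq_some_iff.1 hv
  exact ⟨S', W', by simp⟩

def Lst (L : List (Kd × ℤ)) (v : Kd × ℤ) : Prop := L.getLast? = some v

theorem Lst.skip {R : List (Kd × ℤ)} {v : Kd × ℤ} (P : List (Kd × ℤ)) (h : Lst R v) : Lst (P ++ R) v := by
  obtain ⟨S', rfl⟩ := List.getLast?_eq_some_iff.1 h
  exact List.getLast?_eq_some_iff.2 ⟨P ++ S', by simp⟩

theorem wrapA {L : List (Kd × ℤ)} {u v : Kd × ℤ} (h : L.head? = some u) (h2 : Lst L v) : Adj L v u := by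
  obtain ⟨S', rfl⟩ := List.getLast?_eq_some_iff.1 h2
  obtain ⟨W', h3⟩ := List.head?_eq_some_iff.1 h
  have h4 : (S' ++ [v]).take 1 = [u] := by rw [h3]; rfl
  exact Or.inl ⟨S', [], by rw [h4]; simp⟩

theorem cz_a {ℓ n : ℕ} {B : Fin n → List (Kd × ℤ)} {s : Fin n → ZMod ℓ} {p q : Kd} {d : ℤ} {σ : ZMod ℓ}
    (i : Fin n) (τ : ℤ) (hs : s i = σ * (τ : ZMod ℓ)) (x y : ℤ) (h : Adj (B i) (p, x) (q, y)) e
    (hd : τ * (y - x) = d + e * ℓ) : Cz ℓ B s p q (σ * (d : ZMod ℓ)) := by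
  refine ⟨i, x, y, h, ?_⟩
  have := congrArg (Int.cast : ℤ → ZMod ℓ) hd
  push_cast at this
  rw [ZMod.natCast_self, mul_zero, add_zero] at this
  rw [hs, mul_assoc, ← this]; push_cast; ring

theorem cz_b {ℓ n : ℕ} {B : Fin n → List (Kd × ℤ)} {s : Fin n → ZMod ℓ} {p q : Kd} {d : ℤ} {σ : ZMod ℓ}
    (i : Fin n) (τ : ℤ) (hs : s i * (τ : ZMod ℓ) = σ) (x y : ℤ) (h : Adj (B i) (p, x) (q, y)) e
    (hd : y - x = τ * d + e * ℓ) : Cz ℓ B s p q (σ * (d : ZMod ℓ)) := by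
  refine ⟨i, x, y, h, ?_⟩
  rw [hd, ← hs]
  push_cast
  rw [ZMod.natCast_self]; ring

def xBe (M : ℕ) : List (Kd × ℤ) :=
  [(.b, -(M : ℤ) + -3)] ++ (zz .a .b ((M : ℤ) + 3) (-(M : ℤ) + -3) (-1) (M + 2) ++ ([(.a, 1), (.zb, 0), (.a, -1)] ++ (zz .b .a 1 (-1) 1 (M) ++ ([(.b, (M : ℤ) + 1), (.za, -(M : ℤ) + -2), (.b, (M : ℤ) + 2), (.a, -(M : ℤ) + -3), (.b, (M : ℤ) + 3)]))))

theorem xBeG {M k ℓ : ℕ} (hℓ : ℓ = 2 * k + 1) (hk : k = 2 * M + 6) : ZG k ℓ (-2 * M + -6) (xBe M) := by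
  refine zg_mk _ 0 (-M + -2) ?_ (app_nodup ?_ (app_nodup (zz_nodup (by norm_num) (Or.inl (by decide))) (app_nodup ?_ (app_nodup (zz_nodup (by norm_num) (Or.inl (by decide))) ?_ ?_) ?_) ?_) ?_) ?_
  · simp only [xBe, List.length_append, zz_len, List.length_cons, List.length_nil]
    omega
  all_goals
    try simp only [xBe, List.forall_mem_append, List.forall_mem_cons]
    simp only [sl, sl2, zz_all, reduceCtorEq, forall_const, IsEmpty.forall_iff, implies_true, ne_eq, not_false_eq_true] <;>
      repeat' first | omega | apply And.intro | intro _

theorem xBeS {M k ℓ : ℕ} (hk : k = 2 * M + 6) (r : ℤ → ℤ) (hr : ∀ x, r x = 0 ∨ r x = 1) :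
    ((xBe M).map (vz r 0)).sum = k ∨ ((xBe M).map (vz r 0)).sum = k + 1 := by
  obtain ⟨S, hS⟩ := antid r
  simp only [xBe, List.map_append, List.sum_append]
  rw [zz_neg hS 0 .a .b (M + 3) (-M + -3) (M + 2) (M + 4) 2 (-M + -2) 0 (by omega) (by omega) (by omega) (by omega)]
  rw [zz_pos hS 0 .b .a 1 (-1) (M) (M + 1) (-M + -1) (by omega) (by omega)]
  simp only [List.map_cons, List.map_nil, List.sum_cons, List.sum_nil, vz, bt, ek]
  have g0 := st hS (-M + -2) (-M + -3) (by omega)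
  have g1 := st hS (2) 1 (by omega)
  have g2 := st hS (1) 0 (by omega)
  have g3 := st hS (0) (-1) (by omega)
  have g4 := st hS (M + 2) (M + 1) (by omega)
  have g5 := st hS (-M + -1) (-M + -2) (by omega)
  have g6 := st hS (M + 3) (M + 2) (by omega)
  have g7 := st hS (M + 4) (M + 3) (by omega)
  rcases hr 0 with h | h <;> omega

theorem xBeW {M : ℕ} : ∀ u ∈ xBe M, u.1 ≠ .A ∧ u.1 ≠ .B ∧ (u.1 = .w → u.2 = 0) := by
  simp only [xBe, List.forall_mem_append, List.forall_mem_cons]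
  simp only [sl, sl2, zz_all, reduceCtorEq, forall_const, IsEmpty.forall_iff, implies_true, ne_eq, not_false_eq_true]

def xCe (M : ℕ) : List (Kd × ℤ) :=
  [(.a, 0)] ++ (zz .a .a 1 0 1 (M + 2) ++ ([(.a, (M : ℤ) + 3), (.b, (M : ℤ) + 3)] ++ (zz .b .b (-(M : ℤ) + -2) ((M : ℤ) + 3) 1 (M + 2) ++ ([(.b, 0), (.w, 0)]))))

theorem xCeG {M k ℓ : ℕ} (hℓ : ℓ = 2 * k + 1) (hk : k = 2 * M + 6) : ZG k ℓ (-2 * M + -6) (xCe M) := by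
  refine zg_mk _ (10 * ℓ) (10 * ℓ) ?_ (app_nodup ?_ (app_nodup (zz_nodup (by norm_num) (Or.inr fun i j hi hj => by omega)) (app_nodup ?_ (app_nodup (zz_nodup (by norm_num) (Or.inr fun i j hi hj => by omega)) ?_ ?_) ?_) ?_) ?_) ?_
  · simp only [xCe, List.length_append, zz_len, List.length_cons, List.length_nil]
    omega
  all_goals
    try simp only [xCe, List.forall_mem_append, List.forall_mem_cons]
    simp only [sl, sl2, zz_all, reduceCtorEq, forall_const, IsEmpty.forall_iff, implies_true, ne_eq, not_false_eq_true] <;>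
      repeat' first | omega | apply And.intro | intro _

theorem xCeS {M k ℓ : ℕ} (hk : k = 2 * M + 6) (r : ℤ → ℤ) (hr : ∀ x, r x = 0 ∨ r x = 1) :
    ((xCe M).map (vz r 0)).sum = k ∨ ((xCe M).map (vz r 0)).sum = k + 1 := by
  obtain ⟨S, hS⟩ := antid r
  simp only [xCe, List.map_append, List.sum_append]
  rw [zz_pos hS 0 .a .a 1 0 (M + 2) (M + 3) (-M + -2) (by omega) (by omega)]
  rw [zz_pos hS 0 .b .b (-M + -2) (M + 3) (M + 2) 0 1 (by omega) (by omega)]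
  simp only [List.map_cons, List.map_nil, List.sum_cons, List.sum_nil, vz, bt, ek]
  have g0 := st hS (1) 0 (by omega)
  have g1 := st hS (M + 4) (M + 3) (by omega)
  omega

theorem xCeW {M : ℕ} : ∀ u ∈ xCe M, u.1 ≠ .A ∧ u.1 ≠ .B ∧ (u.1 = .w → u.2 = 0) := by
  simp only [xCe, List.forall_mem_append, List.forall_mem_cons]
  simp only [sl, sl2, zz_all, reduceCtorEq, forall_const, IsEmpty.forall_iff, implies_true, ne_eq, not_false_eq_true]

def yBe (M : ℕ) : List (Kd × ℤ) :=
  [(.b, -(M : ℤ) + -3)] ++ (zz .a .b ((M : ℤ) + 3) (-(M : ℤ) + -3) (-1) (M + 2) ++ ([(.a, 1), (.zb, 0), (.a, -1)] ++ (zz .b .a 1 (-1) 1 (M) ++ ([(.b, (M : ℤ) + 1), (.za, -(M : ℤ) + -2), (.b, (M : ℤ) + 2), (.a, -(M : ℤ) + -3), (.w, 0)]))))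

theorem yBeG {M k ℓ : ℕ} (hℓ : ℓ = 2 * k + 1) (hk : k = 2 * M + 6) : ZG k ℓ (-2 * M + -6) (yBe M) := by
  refine zg_mk _ 0 (-M + -2) ?_ (app_nodup ?_ (app_nodup (zz_nodup (by norm_num) (Or.inl (by decide))) (app_nodup ?_ (app_nodup (zz_nodup (by norm_num) (Or.inl (by decide))) ?_ ?_) ?_) ?_) ?_) ?_
  · simp only [yBe, List.length_append, zz_len, List.length_cons, List.length_nil]
    omega
  all_goals
    try simp only [yBe, List.forall_mem_append, List.forall_mem_cons]
    simp only [sl, sl2, zz_all, reduceCtorEq, forall_const, IsEmpty.forall_iff, implies_true, ne_eq, not_false_eq_true] <;>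
      repeat' first | omega | apply And.intro | intro _

theorem yBeS {M k ℓ : ℕ} (hk : k = 2 * M + 6) (r : ℤ → ℤ) (hr : ∀ x, r x = 0 ∨ r x = 1) :
    ((yBe M).map (vz r 1)).sum = k ∨ ((yBe M).map (vz r 1)).sum = k + 1 := by
  obtain ⟨S, hS⟩ := antid r
  simp only [yBe, List.map_append, List.sum_append]
  rw [zz_neg hS 1 .a .b (M + 3) (-M + -3) (M + 2) (M + 4) 2 (-M + -2) 0 (by omega) (by omega) (by omega) (by omega)]
  rw [zz_pos hS 1 .b .a 1 (-1) (M) (M + 1) (-M + -1) (by omega) (by omega)]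
  simp only [List.map_cons, List.map_nil, List.sum_cons, List.sum_nil, vz, bt, ek]
  have g0 := st hS (-M + -2) (-M + -3) (by omega)
  have g1 := st hS (2) 1 (by omega)
  have g2 := st hS (1) 0 (by omega)
  have g3 := st hS (0) (-1) (by omega)
  have g4 := st hS (M + 2) (M + 1) (by omega)
  have g5 := st hS (-M + -1) (-M + -2) (by omega)
  have g6 := st hS (M + 3) (M + 2) (by omega)
  have g7 := st hS (M + 4) (M + 3) (by omega)
  rcases hr (M + 3) with h | h <;> omega

theorem yBeW {M : ℕ} : ∀ u ∈ yBe M, u.1 ≠ .A ∧ u.1 ≠ .B := by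
  simp only [yBe, List.forall_mem_append, List.forall_mem_cons]
  simp only [sl, sl2, zz_all, reduceCtorEq, forall_const, IsEmpty.forall_iff, implies_true, ne_eq, not_false_eq_true]

def yCe (M : ℕ) : List (Kd × ℤ) :=
  [(.b, 0)] ++ (zz .w .b (2 * (M : ℤ) + 5) 0 (-1) (2 * M + 5) ++ ([(.w, 0), (.a, 0)]))

theorem yCeG {M k ℓ : ℕ} (hℓ : ℓ = 2 * k + 1) (hk : k = 2 * M + 6) : ZG k ℓ 0 (yCe M) := by
  refine zg_mk _ (10 * ℓ) (10 * ℓ) ?_ (app_nodup ?_ (app_nodup (zz_nodup (by norm_num) (Or.inl (by decide))) ?_ ?_) ?_) ?_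
  · simp only [yCe, List.length_append, zz_len, List.length_cons, List.length_nil]
    omega
  all_goals
    try simp only [yCe, List.forall_mem_append, List.forall_mem_cons]
    simp only [sl, sl2, zz_all, reduceCtorEq, forall_const, IsEmpty.forall_iff, implies_true, ne_eq, not_false_eq_true] <;>
      repeat' first | omega | apply And.intro | intro _

theorem yCeS {M k ℓ : ℕ} (hk : k = 2 * M + 6) (r : ℤ → ℤ) (hr : ∀ x, r x = 0 ∨ r x = 1) :
    ((yCe M).map (vz r 1)).sum = k ∨ ((yCe M).map (vz r 1)).sum = k + 1 := by
  obtain ⟨S, hS⟩ := antid r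
  simp only [yCe, List.map_append, List.sum_append]
  rw [zz_neg hS 1 .w .b (2 * M + 5) 0 (2 * M + 5) (2 * M + 6) 1 1 (2 * M + 6) (by omega) (by omega) (by omega) (by omega)]
  simp only [List.map_cons, List.map_nil, List.sum_cons, List.sum_nil, vz, bt, ek]
  have g0 := st hS (1) 0 (by omega)
  rcases hr 0 with h | h <;> omega

theorem yCeW {M : ℕ} : ∀ u ∈ yCe M, u.1 ≠ .A ∧ u.1 ≠ .B := by
  simp only [yCe, List.forall_mem_append, List.forall_mem_cons]
  simp only [sl, sl2, zz_all, reduceCtorEq, forall_const, IsEmpty.forall_iff, implies_true, ne_eq, not_false_eq_true]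

def yDe (M : ℕ) : List (Kd × ℤ) :=
  [(.a, 0)] ++ (zz .w .a (4 * (M : ℤ) + 12) 0 (-1) (M + 2) ++ ([(.w, 3 * (M : ℤ) + 10), (.a, (M : ℤ) + 3)] ++ (zz .w .a (3 * (M : ℤ) + 8) ((M : ℤ) + 3) (-1) (M + 2) ++ ([(.w, 2 * (M : ℤ) + 6), (.b, 4 * (M : ℤ) + 12)]))))

theorem yDeG {M k ℓ : ℕ} (hℓ : ℓ = 2 * k + 1) (hk : k = 2 * M + 6) : ZG k ℓ 0 (yDe M) := by
  refine zg_mk _ (10 * ℓ) (10 * ℓ) ?_ (app_nodup ?_ (app_nodup (zz_nodup (by norm_num) (Or.inl (by decide))) (app_nodup ?_ (app_nodup (zz_nodup (by norm_num) (Or.inl (by decide))) ?_ ?_) ?_) ?_) ?_) ?_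
  · simp only [yDe, List.length_append, zz_len, List.length_cons, List.length_nil]
    omega
  all_goals
    try simp only [yDe, List.forall_mem_append, List.forall_mem_cons]
    simp only [sl, sl2, zz_all, reduceCtorEq, forall_const, IsEmpty.forall_iff, implies_true, ne_eq, not_false_eq_true] <;>
      repeat' first | omega | apply And.intro | intro _

theorem yDeS {M k ℓ : ℕ} (hk : k = 2 * M + 6) (r : ℤ → ℤ) (hr : r (3 * M + 9) + r (4 * M + 12) = 0 ∨ r (3 * M + 9) + r (4 * M + 12) = 1)
    (hF : Fs r 0 1 (4 * M + 13) = k) :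
    ((yDe M).map (vz r 1)).sum = k ∨ ((yDe M).map (vz r 1)).sum = k + 1 := by
  obtain ⟨S, hS⟩ := antid r
  simp only [yDe, List.map_append, List.sum_append]
  rw [zz_neg hS 1 .w .a (4 * M + 12) 0 (M + 2) (4 * M + 13) (3 * M + 11) 1 (M + 3) (by omega) (by omega) (by omega) (by omega)]
  rw [zz_neg hS 1 .w .a (3 * M + 8) (M + 3) (M + 2) (3 * M + 9) (2 * M + 7) (M + 4) (2 * M + 6) (by omega) (by omega) (by omega) (by omega)]
  simp only [List.map_cons, List.map_nil, List.sum_cons, List.sum_nil, vz, bt, ek]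
  have g0 := st hS (1) 0 (by omega)
  have g1 := st hS (3 * M + 11) (3 * M + 10) (by omega)
  have g2 := st hS (M + 4) (M + 3) (by omega)
  have g3 := st hS (2 * M + 7) (2 * M + 6) (by omega)
  have g4 := st hS (4 * M + 13) (4 * M + 12) (by omega)
  have g5 := st hS (3 * M + 10) (3 * M + 9) (by omega)
  rw [Fs_up hS, show (0 : ℤ) + ((4 * M + 13 : ℕ) : ℤ) = 4 * M + 13 by push_cast; ring] at hF
  omega

theorem yDeW {M : ℕ} : ∀ u ∈ yDe M, u.1 ≠ .A ∧ u.1 ≠ .B := by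
  simp only [yDe, List.forall_mem_append, List.forall_mem_cons]
  simp only [sl, sl2, zz_all, reduceCtorEq, forall_const, IsEmpty.forall_iff, implies_true, ne_eq, not_false_eq_true]

def xBo (M e : ℕ) : List (Kd × ℤ) :=
  [(.a, 2 * (M : ℤ) + (e : ℤ) + 3), (.b, -2 * (M : ℤ) + -(e : ℤ) + -2)] ++ (zz .a .b (2 * (M : ℤ) + (e : ℤ) + 2) (-2 * (M : ℤ) + -(e : ℤ) + -2) (-1) (2 * M + e + 1) ++ ([(.a, 1), (.zb, 0), (.a, -1)] ++ (zz .b .a 1 (-1) 1 (2 * M + e) ++ ([(.b, 2 * (M : ℤ) + (e : ℤ) + 1), (.za, -2 * (M : ℤ) + -(e : ℤ) + -2), (.b, 2 * (M : ℤ) + (e : ℤ) + 2), (.b, 2 * (M : ℤ) + (e : ℤ) + 3)]))))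

theorem xBoG {M e k ℓ : ℕ} (hℓ : ℓ = 2 * k + 1) (hk : k = 4 * M + 2 * e + 5) (he : e ≤ 1) : ZG k ℓ (-4 * M + -2 * e + -5) (xBo M e) := by
  refine zg_mk _ 0 (-2 * M + -e + -2) ?_ (app_nodup ?_ (app_nodup (zz_nodup (by norm_num) (Or.inl (by decide))) (app_nodup ?_ (app_nodup (zz_nodup (by norm_num) (Or.inl (by decide))) ?_ ?_) ?_) ?_) ?_) ?_
  · simp only [xBo, List.length_append, zz_len, List.length_cons, List.length_nil]
    omega
  all_goals
    try simp only [xBo, List.forall_mem_append, List.forall_mem_cons]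
    simp only [sl, sl2, zz_all, reduceCtorEq, forall_const, IsEmpty.forall_iff, implies_true, ne_eq, not_false_eq_true] <;>
      repeat' first | omega | apply And.intro | intro _

theorem xBoS {M e k ℓ : ℕ} (hk : k = 4 * M + 2 * e + 5) (he : e ≤ 1) (r : ℤ → ℤ) (hr : ∀ x, r x = 0 ∨ r x = 1) :
    ((xBo M e).map (vz r 0)).sum = k ∨ ((xBo M e).map (vz r 0)).sum = k + 1 := by
  obtain ⟨S, hS⟩ := antid r
  simp only [xBo, List.map_append, List.sum_append]
  rw [zz_neg hS 0 .a .b (2 * M + e + 2) (-2 * M + -e + -2) (2 * M + e + 1) (2 * M + e + 3) 2 (-2 * M + -e + -1) 0 (by omega) (by omega) (by omega) (by omega)]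
  rw [zz_pos hS 0 .b .a 1 (-1) (2 * M + e) (2 * M + e + 1) (-2 * M + -e + -1) (by omega) (by omega)]
  simp only [List.map_cons, List.map_nil, List.sum_cons, List.sum_nil, vz, bt, ek]
  have g0 := st hS (2 * M + e + 4) (2 * M + e + 3) (by omega)
  have g1 := st hS (-2 * M + -e + -1) (-2 * M + -e + -2) (by omega)
  have g2 := st hS (2) 1 (by omega)
  have g3 := st hS (1) 0 (by omega)
  have g4 := st hS (0) (-1) (by omega)
  have g5 := st hS (2 * M + e + 2) (2 * M + e + 1) (by omega)
  have g6 := st hS (2 * M + e + 3) (2 * M + e + 2) (by omega)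
  rcases hr 0 with h | h <;> omega

theorem xBoW {M e : ℕ} : ∀ u ∈ xBo M e, u.1 ≠ .A ∧ u.1 ≠ .B ∧ (u.1 = .w → u.2 = 0) := by
  simp only [xBo, List.forall_mem_append, List.forall_mem_cons]
  simp only [sl, sl2, zz_all, reduceCtorEq, forall_const, IsEmpty.forall_iff, implies_true, ne_eq, not_false_eq_true]

def xCo (M e : ℕ) : List (Kd × ℤ) :=
  [(.a, 2 * (M : ℤ) + 2 * (e : ℤ) + 3), (.a, 0), (.a, 4 * (M : ℤ) + 3 * (e : ℤ) + 5)] ++ (zz .a .a ((e : ℤ) + 1) (4 * (M : ℤ) + 3 * (e : ℤ) + 5) 1 (M) ++ ([(.a, (M : ℤ) + (e : ℤ) + 1)] ++ (zz .a .a (3 * (M : ℤ) + 3 * (e : ℤ) + 3) ((M : ℤ) + (e : ℤ) + 1) (-1) (M + e) ++ ([(.a, 2 * (M : ℤ) + 2 * (e : ℤ) + 2), (.b, 2 * (M : ℤ) + 2 * (e : ℤ) + 3), (.b, 0), (.b, 4 * (M : ℤ) + 3 * (e : ℤ) + 5)] ++ (zz .b .b ((e : ℤ) + 1) (4 * (M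 : ℤ) + 3 * (e : ℤ) + 5) 1 (M) ++ ([(.b, (M : ℤ) + (e : ℤ) + 1)] ++ (zz .b .b (3 * (M : ℤ) + 3 * (e : ℤ) + 3) ((M : ℤ) + (e : ℤ) + 1) (-1) (M + e) ++ ([(.b, 2 * (M : ℤ) + 2 * (e : ℤ) + 2), (.w, 0)]))))))))

theorem xCoG {M e k ℓ : ℕ} (hℓ : ℓ = 2 * k + 1) (hk : k = 4 * M + 2 * e + 5) (he : e ≤ 1) : ZG k ℓ 0 (xCo M e) := by
  refine zg_mk _ (10 * ℓ) (10 * ℓ) ?_ (app_nodup ?_ (app_nodup (zz_nodup (by norm_num) (Or.inr fun i j hi hj => by omega)) (app_nodup ?_ (app_nodup (zz_nodup (by norm_num) (Or.inr fun i j hi hj => by omega)) (app_nodup ?_ (app_nodup (zz_nodup (by norm_num) (Or.inr fun i j hi hj => by omega)) (app_nodup ?_ (app_nodup (zz_nodup (by norm_num) (Or.inr fun i j hi hj => by omega)) ?_ ?_) ?_) ?_) ?_) ?_) ?_) ?_) ?_) ?_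
  · simp only [xCo, List.length_append, zz_len, List.length_cons, List.length_nil]
    omega
  all_goals
    try simp only [xCo, List.forall_mem_append, List.forall_mem_cons]
    simp only [sl, sl2, zz_all, reduceCtorEq, forall_const, IsEmpty.forall_iff, implies_true, ne_eq, not_false_eq_true] <;>
      repeat' first | omega | apply And.intro | intro _

theorem xCoS {M e k ℓ : ℕ} (hk : k = 4 * M + 2 * e + 5) (he : e ≤ 1) (r : ℤ → ℤ) (hr : ∀ x, r x = 0 ∨ r x = 1) :
    ((xCo M e).map (vz r 0)).sum = k ∨ ((xCo M e).map (vz r 0)).sum = k + 1 := by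
  obtain ⟨S, hS⟩ := antid r
  simp only [xCo, List.map_append, List.sum_append]
  rw [zz_pos hS 0 .a .a (e + 1) (4 * M + 3 * e + 5) (M) (M + e + 1) (3 * M + 3 * e + 5) (by omega) (by omega)]
  rw [zz_neg hS 0 .a .a (3 * M + 3 * e + 3) (M + e + 1) (M + e) (3 * M + 3 * e + 4) (2 * M + 2 * e + 4) (M + e + 2) (2 * M + 2 * e + 2) (by omega) (by omega) (by omega) (by omega)]
  rw [zz_pos hS 0 .b .b (e + 1) (4 * M + 3 * e + 5) (M) (M + e + 1) (3 * M + 3 * e + 5) (by omega) (by omega)]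
  rw [zz_neg hS 0 .b .b (3 * M + 3 * e + 3) (M + e + 1) (M + e) (3 * M + 3 * e + 4) (2 * M + 2 * e + 4) (M + e + 2) (2 * M + 2 * e + 2) (by omega) (by omega) (by omega) (by omega)]
  simp only [List.map_cons, List.map_nil, List.sum_cons, List.sum_nil, vz, bt, ek]
  have g0 := st hS (2 * M + 2 * e + 4) (2 * M + 2 * e + 3) (by omega)
  have g1 := st hS (1) 0 (by omega)
  have g2 := st hS (4 * M + 3 * e + 6) (4 * M + 3 * e + 5) (by omega)
  have g3 := st hS (M + e + 2) (M + e + 1) (by omega)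
  have g4 := st hS (2 * M + 2 * e + 3) (2 * M + 2 * e + 2) (by omega)
  omega

theorem xCoW {M e : ℕ} : ∀ u ∈ xCo M e, u.1 ≠ .A ∧ u.1 ≠ .B ∧ (u.1 = .w → u.2 = 0) := by
  simp only [xCo, List.forall_mem_append, List.forall_mem_cons]
  simp only [sl, sl2, zz_all, reduceCtorEq, forall_const, IsEmpty.forall_iff, implies_true, ne_eq, not_false_eq_true]

def yBo (M e : ℕ) : List (Kd × ℤ) :=
  [(.b, -2 * (M : ℤ) + -(e : ℤ) + -3)] ++ (zz .a .b (2 * (M : ℤ) + (e : ℤ) + 2) (-2 * (M : ℤ) + -(e : ℤ) + -3) (-1) (M + 1) ++ ([(.a, (M : ℤ) + (e : ℤ) + 1)] ++ (zz .b .a (-(M : ℤ) + -(e : ℤ)) ((M : ℤ) + (e : ℤ) + 1) 1 (M + e) ++ ([(.zb, 0), (.a, -1)] ++ (zz .b .a 1 (-1) 1 (2 * M + e) ++ ([(.b, 2 * (M : ℤ) + (e : ℤ) + 1), (.za, -2 * (M : ℤ) + -(e : ℤ) + -2), (.b, 2 * (M : ℤ) + (e : ℤ) + 2), (.a, -2 *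 (M : ℤ) + -(e : ℤ) + -3), (.w, 0)]))))))

theorem yBoG {M e k ℓ : ℕ} (hℓ : ℓ = 2 * k + 1) (hk : k = 4 * M + 2 * e + 5) (he : e ≤ 1) : ZG k ℓ (-4 * M + -2 * e + -5) (yBo M e) := by
  refine zg_mk _ 0 (-2 * M + -e + -2) ?_ (app_nodup ?_ (app_nodup (zz_nodup (by norm_num) (Or.inl (by decide))) (app_nodup ?_ (app_nodup (zz_nodup (by norm_num) (Or.inl (by decide))) (app_nodup ?_ (app_nodup (zz_nodup (by norm_num) (Or.inl (by decide))) ?_ ?_) ?_) ?_) ?_) ?_) ?_) ?_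
  · simp only [yBo, List.length_append, zz_len, List.length_cons, List.length_nil]
    omega
  all_goals
    try simp only [yBo, List.forall_mem_append, List.forall_mem_cons]
    simp only [sl, sl2, zz_all, reduceCtorEq, forall_const, IsEmpty.forall_iff, implies_true, ne_eq, not_false_eq_true] <;>
      repeat' first | omega | apply And.intro | intro _

theorem yBoS {M e k ℓ : ℕ} (hk : k = 4 * M + 2 * e + 5) (he : e ≤ 1) (r : ℤ → ℤ) (hr : ∀ x, r x = 0 ∨ r x = 1) :
    ((yBo M e).map (vz r 1)).sum = k ∨ ((yBo M e).map (vz r 1)).sum = k + 1 := by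
  obtain ⟨S, hS⟩ := antid r
  simp only [yBo, List.map_append, List.sum_append]
  rw [zz_neg hS 1 .a .b (2 * M + e + 2) (-2 * M + -e + -3) (M + 1) (2 * M + e + 3) (M + e + 2) (-2 * M + -e + -2) (-M + -e + -1) (by omega) (by omega) (by omega) (by omega)]
  rw [zz_pos hS 1 .b .a (-M + -e) (M + e + 1) (M + e) 0 1 (by omega) (by omega)]
  rw [zz_pos hS 1 .b .a 1 (-1) (2 * M + e) (2 * M + e + 1) (-2 * M + -e + -1) (by omega) (by omega)]
  simp only [List.map_cons, List.map_nil, List.sum_cons, List.sum_nil, vz, bt, ek]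
  have g0 := st hS (-2 * M + -e + -2) (-2 * M + -e + -3) (by omega)
  have g1 := st hS (M + e + 2) (M + e + 1) (by omega)
  have g2 := st hS (1) 0 (by omega)
  have g3 := st hS (0) (-1) (by omega)
  have g4 := st hS (2 * M + e + 2) (2 * M + e + 1) (by omega)
  have g5 := st hS (-2 * M + -e + -1) (-2 * M + -e + -2) (by omega)
  have g6 := st hS (2 * M + e + 3) (2 * M + e + 2) (by omega)
  have g7 := st hS (-M + -e) (-M + -e + -1) (by omega)
  rcases hr (-M + -e + -1) with h | h <;> omega

theorem yBoW {M e : ℕ} : ∀ u ∈ yBo M e, u.1 ≠ .A ∧ u.1 ≠ .B := by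
  simp only [yBo, List.forall_mem_append, List.forall_mem_cons]
  simp only [sl, sl2, zz_all, reduceCtorEq, forall_const, IsEmpty.forall_iff, implies_true, ne_eq, not_false_eq_true]

def yCo (M e : ℕ) : List (Kd × ℤ) :=
  [(.b, 0)] ++ (zz .w .b (4 * (M : ℤ) + 2 * (e : ℤ) + 4) 0 (-1) (4 * M + 2 * e + 4) ++ ([(.w, 0), (.a, 0)]))

theorem yCoG {M e k ℓ : ℕ} (hℓ : ℓ = 2 * k + 1) (hk : k = 4 * M + 2 * e + 5) (he : e ≤ 1) : ZG k ℓ 0 (yCo M e) := by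
  refine zg_mk _ (10 * ℓ) (10 * ℓ) ?_ (app_nodup ?_ (app_nodup (zz_nodup (by norm_num) (Or.inl (by decide))) ?_ ?_) ?_) ?_
  · simp only [yCo, List.length_append, zz_len, List.length_cons, List.length_nil]
    omega
  all_goals
    try simp only [yCo, List.forall_mem_append, List.forall_mem_cons]
    simp only [sl, sl2, zz_all, reduceCtorEq, forall_const, IsEmpty.forall_iff, implies_true, ne_eq, not_false_eq_true] <;>
      repeat' first | omega | apply And.intro | intro _

theorem yCoS {M e k ℓ : ℕ} (hk : k = 4 * M + 2 * e + 5) (he : e ≤ 1) (r : ℤ → ℤ) (hr : ∀ x, r x = 0 ∨ r x = 1) :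
    ((yCo M e).map (vz r 1)).sum = k ∨ ((yCo M e).map (vz r 1)).sum = k + 1 := by
  obtain ⟨S, hS⟩ := antid r
  simp only [yCo, List.map_append, List.sum_append]
  rw [zz_neg hS 1 .w .b (4 * M + 2 * e + 4) 0 (4 * M + 2 * e + 4) (4 * M + 2 * e + 5) 1 1 (4 * M + 2 * e + 5) (by omega) (by omega) (by omega) (by omega)]
  simp only [List.map_cons, List.map_nil, List.sum_cons, List.sum_nil, vz, bt, ek]
  have g0 := st hS (1) 0 (by omega)
  rcases hr 0 with h | h <;> omega

theorem yCoW {M e : ℕ} : ∀ u ∈ yCo M e, u.1 ≠ .A ∧ u.1 ≠ .B := by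
  simp only [yCo, List.forall_mem_append, List.forall_mem_cons]
  simp only [sl, sl2, zz_all, reduceCtorEq, forall_const, IsEmpty.forall_iff, implies_true, ne_eq, not_false_eq_true]

def yDo (M e : ℕ) : List (Kd × ℤ) :=
  [(.a, 4 * (M : ℤ) + 3 * (e : ℤ) + 4)] ++ (zz .w .a (4 * (M : ℤ) + 3 * (e : ℤ) + 5) (4 * (M : ℤ) + 3 * (e : ℤ) + 4) 1 (M + e) ++ ([(.w, 5 * (M : ℤ) + 4 * (e : ℤ) + 5), (.a, 3 * (M : ℤ) + (e : ℤ) + 3)] ++ (zz .w .a (5 * (M : ℤ) + 3 * (e : ℤ) + 7) (3 * (M : ℤ) + (e : ℤ) + 3) 1 (3 * M + e + 3) ++ ([(.w, 8 * (M : ℤ) + 4 * (e : ℤ) + 10), (.b, 2 * (M : ℤ) + (e : ℤ) + 2)]))))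

theorem yDoG {M e k ℓ : ℕ} (hℓ : ℓ = 2 * k + 1) (hk : k = 4 * M + 2 * e + 5) (he : e ≤ 1) : ZG k ℓ 0 (yDo M e) := by
  refine zg_mk _ (10 * ℓ) (10 * ℓ) ?_ (app_nodup ?_ (app_nodup (zz_nodup (by norm_num) (Or.inl (by decide))) (app_nodup ?_ (app_nodup (zz_nodup (by norm_num) (Or.inl (by decide))) ?_ ?_) ?_) ?_) ?_) ?_
  · simp only [yDo, List.length_append, zz_len, List.length_cons, List.length_nil]
    omega
  all_goals
    try simp only [yDo, List.forall_mem_append, List.forall_mem_cons]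
    simp only [sl, sl2, zz_all, reduceCtorEq, forall_const, IsEmpty.forall_iff, implies_true, ne_eq, not_false_eq_true] <;>
      repeat' first | omega | apply And.intro | intro _

theorem yDoS {M e k ℓ : ℕ} (hk : k = 4 * M + 2 * e + 5) (he : e ≤ 1) (r : ℤ → ℤ)
    (hr0 : e = 0 → r (2 * M + e + 2) + r (5 * M + 6) = 0 ∨ r (2 * M + e + 2) + r (5 * M + 6) = 1)
    (hr1 : e = 1 → r (2 * M + e + 2) + r (3 * M + 5) = 0 ∨ r (2 * M + e + 2) + r (3 * M + 5) = 1)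
    (hF : Fs r 0 1 (8 * M + 4 * e + 11) = k) :
    ((yDo M e).map (vz r 1)).sum = k ∨ ((yDo M e).map (vz r 1)).sum = k + 1 := by
  obtain ⟨S, hS⟩ := antid r
  simp only [yDo, List.map_append, List.sum_append]
  rw [zz_pos hS 1 .w .a (4 * M + 3 * e + 5) (4 * M + 3 * e + 4) (M + e) (5 * M + 4 * e + 5) (3 * M + 2 * e + 4) (by omega) (by omega)]
  rw [zz_pos hS 1 .w .a (5 * M + 3 * e + 7) (3 * M + e + 3) (3 * M + e + 3) (8 * M + 4 * e + 10) 0 (by omega) (by omega)]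
  simp only [List.map_cons, List.map_nil, List.sum_cons, List.sum_nil, vz, bt, ek]
  have g0 := st hS (4 * M + 3 * e + 5) (4 * M + 3 * e + 4) (by omega)
  have g1 := st hS (5 * M + 4 * e + 6) (5 * M + 4 * e + 5) (by omega)
  have g2 := st hS (3 * M + e + 4) (3 * M + e + 3) (by omega)
  have g3 := st hS (8 * M + 4 * e + 11) (8 * M + 4 * e + 10) (by omega)
  have g4 := st hS (2 * M + e + 3) (2 * M + e + 2) (by omega)
  rw [Fs_up hS, show (0 : ℤ) + ((8 * M + 4 * e + 11 : ℕ) : ℤ) = 8 * M + 4 * e + 11 by push_cast; ring] at hF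
  rcases (show e = 0 ∨ e = 1 by omega) with h | h
  · have q1 : S (5 * M + 3 * e + 7) = S (5 * M + 4 * e + 6) + r (5 * M + 6) := by
      rw [show 5 * (M : ℤ) + 3 * (e : ℤ) + 7 = 5 * (M : ℤ) + 6 + 1 by omega, show 5 * (M : ℤ) + 4 * (e : ℤ) + 6 = 5 * (M : ℤ) + 6 by omega]; exact hS _
    have q2 : S (3 * M + 2 * e + 4) = S (3 * M + e + 4) := congrArg S (by omega)
    have := hr0 h
    omega
  · have q1 : S (5 * M + 3 * e + 7) = S (5 * M + 4 * e + 6) := congrArg S (by omega)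
    have q2 : S (3 * M + 2 * e + 4) = S (3 * M + e + 4) + r (3 * M + 5) := by
      rw [show 3 * (M : ℤ) + 2 * (e : ℤ) + 4 = 3 * (M : ℤ) + 5 + 1 by omega, show 3 * (M : ℤ) + (e : ℤ) + 4 = 3 * (M : ℤ) + 5 by omega]; exact hS _
    have := hr1 h
    omega

theorem yDoW {M e : ℕ} : ∀ u ∈ yDo M e, u.1 ≠ .A ∧ u.1 ≠ .B := by
  simp only [yDo, List.forall_mem_append, List.forall_mem_cons]
  simp only [sl, sl2, zz_all, reduceCtorEq, forall_const, IsEmpty.forall_iff, implies_true, ne_eq, not_false_eq_true]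

def xEC (M : ℕ) : Fin 2 → List (Kd × ℤ) := ![xBe M, xCe M]

theorem xEaa {M k ℓ : ℕ} (hℓ : ℓ = 2 * k + 1) (hk : k = 2 * M + 6) (d : ℤ)
    (h1 : -k ≤ d) (h2 : d ≤ k) (h3 : d ≠ 0) (h4 : d ≠ k) (h5 : d ≠ -k) :
    Cz ℓ (xEC M) (fun _ => 1) .a .a (1 * (d : ZMod ℓ)) := by
  have hc : (0 ≤ d + -1 ∧ d + -1 ≤ 2 * (M + 2)) ∨ (0 ≤ -d + -1 ∧ -d + -1 ≤ 2 * (M + 2)) := by omega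
  rcases hc with h0 | h0
  · obtain ⟨x, y, h, ha⟩ := zz_cov (L := xCe M) (q := .a) (u := 0) (ε := 1) (N := M + 2)
      (x := 1) (p := .a) (v := (.a, M + 3)) (inf_zz rfl rfl) (d + -1) h0.1 (zw (by omega) (by omega))
    exact cz_b 1 1 (by simp) x y ha 0 (by omega)
  · obtain ⟨x, y, h, ha⟩ := zz_cov (L := xCe M) (q := .a) (u := 0) (ε := 1) (N := M + 2)
      (x := 1) (p := .a) (v := (.a, M + 3)) (inf_zz rfl rfl) (-d + -1) h0.1 (zw (by omega) (by omega))
    exact cz_b 1 1 (by simp) y x ha.symm 0 (by omega)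

theorem xEbb {M k ℓ : ℕ} (hℓ : ℓ = 2 * k + 1) (hk : k = 2 * M + 6) (d : ℤ)
    (h1 : -k ≤ d) (h2 : d ≤ k) (h3 : d ≠ 0) :
    Cz ℓ (xEC M) (fun _ => 1) .b .b (1 * (d : ZMod ℓ)) := by
  have hc : (-2 * M + -6 = d) ∨ (2 * M + 6 = d) ∨ (0 ≤ d + (2 * M + 5) ∧ d + (2 * M + 5) ≤ 2 * (M + 2)) ∨ (0 ≤ -d + (2 * M + 5) ∧ -d + (2 * M + 5) ≤ 2 * (M + 2)) := by omega
  rcases hc with h0 | h0 | h0 | h0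
  · exact cz_b 0 1 (by simp) (M + 3) (-M + -3) ((wrapA rfl (Lst.skip _ (Lst.skip _ (Lst.skip _ (Lst.skip _ (rfl))))) : Adj (xBe M) ((.b, M + 3)) ((.b, -M + -3)))) 0 (by omega)
  · exact cz_b 0 1 (by simp) (-M + -3) (M + 3) ((wrapA rfl (Lst.skip _ (Lst.skip _ (Lst.skip _ (Lst.skip _ (rfl))))) : Adj (xBe M) ((.b, M + 3)) ((.b, -M + -3))).symm) 0 (by omega)
  · obtain ⟨x, y, h, ha⟩ := zz_cov (L := xCe M) (q := .b) (u := M + 3) (ε := 1) (N := M + 2)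
      (x := -M + -2) (p := .b) (v := (.b, 0)) (inf_skip _ (inf_skip _ (inf_zz rfl rfl))) (d + (2 * M + 5)) h0.1 (zw (by omega) (by omega))
    exact cz_b 1 1 (by simp) x y ha 0 (by omega)
  · obtain ⟨x, y, h, ha⟩ := zz_cov (L := xCe M) (q := .b) (u := M + 3) (ε := 1) (N := M + 2)
      (x := -M + -2) (p := .b) (v := (.b, 0)) (inf_skip _ (inf_skip _ (inf_zz rfl rfl))) (-d + (2 * M + 5)) h0.1 (zw (by omega) (by omega))
    exact cz_b 1 1 (by simp) y x ha.symm 0 (by omega)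

theorem xEab {M k ℓ : ℕ} (hℓ : ℓ = 2 * k + 1) (hk : k = 2 * M + 6) (d : ℤ)
    (h1 : -k ≤ d) (h2 : d ≤ k) (h3 : d ≠ -1) (h4 : d ≠ 1) (h5 : d ≠ k - 3) (h6 : d ≠ k - 2) :
    Cz ℓ (xEC M) (fun _ => 1) .a .b (1 * (d : ZMod ℓ)) := by
  have hc : (0 ≤ d + (2 * M + 6) ∧ d + (2 * M + 6) ≤ 2 * (M + 2)) ∨ (0 ≤ d + -2 ∧ d + -2 ≤ 2 * (M)) ∨ (2 * M + 5 = d) ∨ (2 * M + 6 = d) ∨ (0 = d) := by omega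
  rcases hc with h0 | h0 | h0 | h0 | h0
  · obtain ⟨x, y, h, ha⟩ := zz_cov (L := xBe M) (q := .b) (u := -M + -3) (ε := -1) (N := M + 2)
      (x := M + 3) (p := .a) (v := (.a, 1)) (inf_zz rfl rfl) (d + (2 * M + 6)) h0.1 (zw (by omega) (by omega))
    exact cz_b 0 1 (by simp) y x ha.symm 0 (by omega)
  · obtain ⟨x, y, h, ha⟩ := zz_cov (L := xBe M) (q := .a) (u := -1) (ε := 1) (N := M)
      (x := 1) (p := .b) (v := (.b, M + 1)) (inf_skip _ (inf_skip _ (inf_zz rfl rfl))) (d + -2) h0.1 (zw (by omega) (by omega))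
    exact cz_b 0 1 (by simp) x y ha 0 (by omega)
  · exact cz_b 0 1 (by simp) (-M + -3) (M + 2) ((Adj.inf (infix_get 2 rfl rfl) (inf_skip _ (inf_skip _ (inf_skip _ (inf_skip _ (List.infix_refl _))))) : Adj (xBe M) ((.b, M + 2)) ((.a, -M + -3))).symm) 0 (by omega)
  · exact cz_b 0 1 (by simp) (-M + -3) (M + 3) ((Adj.inf (infix_get 3 rfl rfl) (inf_skip _ (inf_skip _ (inf_skip _ (inf_skip _ (List.infix_refl _))))) : Adj (xBe M) ((.a, -M + -3)) ((.b, M + 3)))) 0 (by omega)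
  · exact cz_b 1 1 (by simp) (M + 3) (M + 3) ((Adj.inf (infix_get 0 rfl rfl) (inf_skip _ (inf_skip _ (inf_here _ _))) : Adj (xCe M) ((.a, M + 3)) ((.b, M + 3)))) 0 (by omega)

theorem xEaz {M k ℓ : ℕ} (hℓ : ℓ = 2 * k + 1) (hk : k = 2 * M + 6) (d : ℤ) (hd : d = -1 ∨ d = 1) :
    Cz ℓ (xEC M) (fun _ => 1) .a .zb (1 * (d : ZMod ℓ)) := by
  have hc : (-1 = d) ∨ (1 = d) := by omega
  rcases hc with h0 | h0
  · exact cz_b 0 1 (by simp) 1 0 ((Adj.inf (infix_get 0 rfl rfl) (inf_skip _ (inf_skip _ (inf_here _ _))) : Adj (xBe M) ((.a, 1)) ((.zb, 0)))) 0 (by omega)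
  · exact cz_b 0 1 (by simp) (-1) 0 ((Adj.inf (infix_get 1 rfl rfl) (inf_skip _ (inf_skip _ (inf_here _ _))) : Adj (xBe M) ((.zb, 0)) ((.a, -1))).symm) 0 (by omega)

theorem xEbz {M k ℓ : ℕ} (hℓ : ℓ = 2 * k + 1) (hk : k = 2 * M + 6) (d : ℤ) (hd : d = 3 - k ∨ d = 2 - k) :
    Cz ℓ (xEC M) (fun _ => 1) .b .za (1 * (d : ZMod ℓ)) := by
  have hc : (-2 * M + -3 = d) ∨ (-2 * M + -4 = d) := by omega
  rcases hc with h0 | h0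
  · exact cz_b 0 1 (by simp) (M + 1) (-M + -2) ((Adj.inf (infix_get 0 rfl rfl) (inf_skip _ (inf_skip _ (inf_skip _ (inf_skip _ (List.infix_refl _))))) : Adj (xBe M) ((.b, M + 1)) ((.za, -M + -2)))) 0 (by omega)
  · exact cz_b 0 1 (by simp) (M + 2) (-M + -2) ((Adj.inf (infix_get 1 rfl rfl) (inf_skip _ (inf_skip _ (inf_skip _ (inf_skip _ (List.infix_refl _))))) : Adj (xBe M) ((.za, -M + -2)) ((.b, M + 2))).symm) 0 (by omega)

def xOC (M e : ℕ) : Fin 2 → List (Kd × ℤ) := ![xBo M e, xCo M e]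

theorem xOaa {M e k ℓ : ℕ} {h : ZMod ℓ} (hh : h * 2 = -1) (hℓ : ℓ = 2 * k + 1) (hk : k = 4 * M + 2 * e + 5) (he : e ≤ 1) (d : ℤ)
    (h1 : -k ≤ d) (h2 : d ≤ k) (h3 : d ≠ 0) (h4 : d ≠ 2) (h5 : d ≠ -2) :
    Cz ℓ (xOC M e) (![1, h]) .a .a (h * (d : ZMod ℓ)) := by
  have hc : (-2 * M + -2 * e + -3 = d) ∨ (2 * M + 2 * e + 3 = d) ∨ (4 * M + 3 * e + 5 = d) ∨ (4 * M + 3 * e + 5 = d + ℓ) ∨ (-4 * M + -3 * e + -5 = d - ℓ) ∨ (-4 * M + -3 * e + -5 = d) ∨ (0 ≤ d + (4 * M + 2 * e + 4) ∧ d + (4 * M + 2 * e + 4) ≤ 2 * (M)) ∨ (0 ≤ -d + (4 * M + 2 * e + 4) ∧ -d + (4 * M + 2 * e + 4) ≤ 2 * (M)) ∨ (0 ≤ -d + (2 * M + 2 * e + 2) ∧ -d + (2 * M + 2 * e + 2) < 2 * (M + e)) ∨ (0 ≤ d + (2 * M + 2 * e + 2) ∧ d + (2 * M + 2 * e + 2)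 < 2 * (M + e)) ∨ (1 = d) ∨ (-1 = d) := by omega
  rcases hc with h0 | h0 | h0 | h0 | h0 | h0 | h0 | h0 | h0 | h0 | h0 | h0
  · exact cz_b 1 1 (by simp) (2 * M + 2 * e + 3) 0 ((Adj.inf (infix_get 0 rfl rfl) (inf_here _ _) : Adj (xCo M e) ((.a, 2 * M + 2 * e + 3)) ((.a, 0)))) 0 (by omega)
  · exact cz_b 1 1 (by simp) 0 (2 * M + 2 * e + 3) ((Adj.inf (infix_get 0 rfl rfl) (inf_here _ _) : Adj (xCo M e) ((.a, 2 * M + 2 * e + 3)) ((.a, 0))).symm) 0 (by omega)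
  · exact cz_b 1 1 (by simp) 0 (4 * M + 3 * e + 5) ((Adj.inf (infix_get 1 rfl rfl) (inf_here _ _) : Adj (xCo M e) ((.a, 0)) ((.a, 4 * M + 3 * e + 5)))) 0 (by omega)
  · exact cz_b 1 1 (by simp) 0 (4 * M + 3 * e + 5) ((Adj.inf (infix_get 1 rfl rfl) (inf_here _ _) : Adj (xCo M e) ((.a, 0)) ((.a, 4 * M + 3 * e + 5)))) 1 (by omega)
  · exact cz_b 1 1 (by simp) (4 * M + 3 * e + 5) 0 ((Adj.inf (infix_get 1 rfl rfl) (inf_here _ _) : Adj (xCo M e) ((.a, 0)) ((.a, 4 * M + 3 * e + 5))).symm) (-1) (by omega)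
  · exact cz_b 1 1 (by simp) (4 * M + 3 * e + 5) 0 ((Adj.inf (infix_get 1 rfl rfl) (inf_here _ _) : Adj (xCo M e) ((.a, 0)) ((.a, 4 * M + 3 * e + 5))).symm) 0 (by omega)
  · obtain ⟨x, y, h, ha⟩ := zz_cov (L := xCo M e) (q := .a) (u := 4 * M + 3 * e + 5) (ε := 1) (N := M)
      (x := e + 1) (p := .a) (v := (.a, M + e + 1)) (inf_zz rfl rfl) (d + (4 * M + 2 * e + 4)) h0.1 (zw (by omega) (by omega))
    exact cz_b 1 1 (by simp) x y ha 0 (by omega)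
  · obtain ⟨x, y, h, ha⟩ := zz_cov (L := xCo M e) (q := .a) (u := 4 * M + 3 * e + 5) (ε := 1) (N := M)
      (x := e + 1) (p := .a) (v := (.a, M + e + 1)) (inf_zz rfl rfl) (-d + (4 * M + 2 * e + 4)) h0.1 (zw (by omega) (by omega))
    exact cz_b 1 1 (by simp) y x ha.symm 0 (by omega)
  · obtain ⟨x, y, h, ha⟩ := zz_cov (L := xCo M e) (q := .a) (u := M + e + 1) (ε := -1) (N := M + e)
      (x := 3 * M + 3 * e + 3) (p := .a) (v := (.a, 2 * M + 2 * e + 2)) (inf_skip _ (inf_skip _ (inf_zz rfl rfl))) (-d + (2 * M + 2 * e + 2)) h0.1 (Or.inl (by omega))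
    exact cz_b 1 1 (by simp) x y ha 0 (by omega)
  · obtain ⟨x, y, h, ha⟩ := zz_cov (L := xCo M e) (q := .a) (u := M + e + 1) (ε := -1) (N := M + e)
      (x := 3 * M + 3 * e + 3) (p := .a) (v := (.a, 2 * M + 2 * e + 2)) (inf_skip _ (inf_skip _ (inf_zz rfl rfl))) (d + (2 * M + 2 * e + 2)) h0.1 (Or.inl (by omega))
    exact cz_b 1 1 (by simp) y x ha.symm 0 (by omega)
  · exact cz_b 1 1 (by simp) (2 * M + 2 * e + 1) (2 * M + 2 * e + 2) ((zz_last (q := .a) (u := M + e + 1) (ε := -1) (N := M + e) (x := 3 * M + 3 * e + 3) (p := .a) (inf_skip _ (inf_skip _ (inf_zz rfl rfl))) (2 * M + 2 * e + 1) (by omega) : Adj (xCo M e) ((.a, 2 * M + 2 * e + 1)) ((.a, 2 * M + 2 * e + 2)))) 0 (by omega)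
  · exact cz_b 1 1 (by simp) (2 * M + 2 * e + 2) (2 * M + 2 * e + 1) ((zz_last (q := .a) (u := M + e + 1) (ε := -1) (N := M + e) (x := 3 * M + 3 * e + 3) (p := .a) (inf_skip _ (inf_skip _ (inf_zz rfl rfl))) (2 * M + 2 * e + 1) (by omega) : Adj (xCo M e) ((.a, 2 * M + 2 * e + 1)) ((.a, 2 * M + 2 * e + 2))).symm) 0 (by omega)

theorem xObb {M e k ℓ : ℕ} {h : ZMod ℓ} (hh : h * 2 = -1) (hℓ : ℓ = 2 * k + 1) (hk : k = 4 * M + 2 * e + 5) (he : e ≤ 1) (d : ℤ)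
    (h1 : -k ≤ d) (h2 : d ≤ k) (h3 : d ≠ 0) :
    Cz ℓ (xOC M e) (![1, h]) .b .b (h * (d : ZMod ℓ)) := by
  have hc : (-2 * 1 = d + 0 * ℓ) ∨ (-2 * (-1) = d + 0 * ℓ) ∨ (-2 * M + -2 * e + -3 = d) ∨ (2 * M + 2 * e + 3 = d) ∨ (4 * M + 3 * e + 5 = d) ∨ (4 * M + 3 * e + 5 = d + ℓ) ∨ (-4 * M + -3 * e + -5 = d - ℓ) ∨ (-4 * M + -3 * e + -5 = d) ∨ (0 ≤ d + (4 * M + 2 * e + 4) ∧ d + (4 * M + 2 * e + 4) ≤ 2 * (M)) ∨ (0 ≤ -d + (4 * M + 2 * e + 4) ∧ -d + (4 * M + 2 * e + 4) ≤ 2 * (M)) ∨ (0 ≤ -d + (2 * M + 2 * e + 2) ∧ -d + (2 * M + 2 * e + 2) < 2 * (M + e)) ∨ (0 ≤ d + (2 * M + 2 * e + 2) ∧ d + (2 * M + 2 * e + 2) < 2 * (M + e)) ∨ (1 = d) ∨ (-1 = d) := by omega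
  rcases hc with h0 | h0 | h0 | h0 | h0 | h0 | h0 | h0 | h0 | h0 | h0 | h0 | h0 | h0
  · exact cz_a 0 (-2) (by simp [hh]) (2 * M + e + 2) (2 * M + e + 3) ((Adj.inf (infix_get 2 rfl rfl) (inf_skip _ (inf_skip _ (inf_skip _ (inf_skip _ (List.infix_refl _))))) : Adj (xBo M e) ((.b, 2 * M + e + 2)) ((.b, 2 * M + e + 3)))) 0 (by omega)
  · exact cz_a 0 (-2) (by simp [hh]) (2 * M + e + 3) (2 * M + e + 2) ((Adj.inf (infix_get 2 rfl rfl) (inf_skip _ (inf_skip _ (inf_skip _ (inf_skip _ (List.infix_refl _))))) : Adj (xBo M e) ((.b, 2 * M + e + 2)) ((.b, 2 * M + e + 3))).symm) 0 (by omega)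
  · exact cz_b 1 1 (by simp) (2 * M + 2 * e + 3) 0 ((Adj.inf (infix_get 1 rfl rfl) (inf_skip _ (inf_skip _ (inf_skip _ (inf_skip _ (inf_here _ _))))) : Adj (xCo M e) ((.b, 2 * M + 2 * e + 3)) ((.b, 0)))) 0 (by omega)
  · exact cz_b 1 1 (by simp) 0 (2 * M + 2 * e + 3) ((Adj.inf (infix_get 1 rfl rfl) (inf_skip _ (inf_skip _ (inf_skip _ (inf_skip _ (inf_here _ _))))) : Adj (xCo M e) ((.b, 2 * M + 2 * e + 3)) ((.b, 0))).symm) 0 (by omega)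
  · exact cz_b 1 1 (by simp) 0 (4 * M + 3 * e + 5) ((Adj.inf (infix_get 2 rfl rfl) (inf_skip _ (inf_skip _ (inf_skip _ (inf_skip _ (inf_here _ _))))) : Adj (xCo M e) ((.b, 0)) ((.b, 4 * M + 3 * e + 5)))) 0 (by omega)
  · exact cz_b 1 1 (by simp) 0 (4 * M + 3 * e + 5) ((Adj.inf (infix_get 2 rfl rfl) (inf_skip _ (inf_skip _ (inf_skip _ (inf_skip _ (inf_here _ _))))) : Adj (xCo M e) ((.b, 0)) ((.b, 4 * M + 3 * e + 5)))) 1 (by omega)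
  · exact cz_b 1 1 (by simp) (4 * M + 3 * e + 5) 0 ((Adj.inf (infix_get 2 rfl rfl) (inf_skip _ (inf_skip _ (inf_skip _ (inf_skip _ (inf_here _ _))))) : Adj (xCo M e) ((.b, 0)) ((.b, 4 * M + 3 * e + 5))).symm) (-1) (by omega)
  · exact cz_b 1 1 (by simp) (4 * M + 3 * e + 5) 0 ((Adj.inf (infix_get 2 rfl rfl) (inf_skip _ (inf_skip _ (inf_skip _ (inf_skip _ (inf_here _ _))))) : Adj (xCo M e) ((.b, 0)) ((.b, 4 * M + 3 * e + 5))).symm) 0 (by omega)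
  · obtain ⟨x, y, h, ha⟩ := zz_cov (L := xCo M e) (q := .b) (u := 4 * M + 3 * e + 5) (ε := 1) (N := M)
      (x := e + 1) (p := .b) (v := (.b, M + e + 1)) (inf_skip _ (inf_skip _ (inf_skip _ (inf_skip _ (inf_zz rfl rfl))))) (d + (4 * M + 2 * e + 4)) h0.1 (zw (by omega) (by omega))
    exact cz_b 1 1 (by simp) x y ha 0 (by omega)
  · obtain ⟨x, y, h, ha⟩ := zz_cov (L := xCo M e) (q := .b) (u := 4 * M + 3 * e + 5) (ε := 1) (N := M)
      (x := e + 1) (p := .b) (v := (.b, M + e + 1)) (inf_skip _ (inf_skip _ (inf_skip _ (inf_skip _ (inf_zz rfl rfl))))) (-d + (4 * M + 2 * e + 4)) h0.1 (zw (by omega) (by omega))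
    exact cz_b 1 1 (by simp) y x ha.symm 0 (by omega)
  · obtain ⟨x, y, h, ha⟩ := zz_cov (L := xCo M e) (q := .b) (u := M + e + 1) (ε := -1) (N := M + e)
      (x := 3 * M + 3 * e + 3) (p := .b) (v := (.b, 2 * M + 2 * e + 2)) (inf_skip _ (inf_skip _ (inf_skip _ (inf_skip _ (inf_skip _ (inf_skip _ (inf_zz rfl rfl))))))) (-d + (2 * M + 2 * e + 2)) h0.1 (Or.inl (by omega))
    exact cz_b 1 1 (by simp) x y ha 0 (by omega)
  · obtain ⟨x, y, h, ha⟩ := zz_cov (L := xCo M e) (q := .b) (u := M + e + 1) (ε := -1) (N := M + e)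
      (x := 3 * M + 3 * e + 3) (p := .b) (v := (.b, 2 * M + 2 * e + 2)) (inf_skip _ (inf_skip _ (inf_skip _ (inf_skip _ (inf_skip _ (inf_skip _ (inf_zz rfl rfl))))))) (d + (2 * M + 2 * e + 2)) h0.1 (Or.inl (by omega))
    exact cz_b 1 1 (by simp) y x ha.symm 0 (by omega)
  · exact cz_b 1 1 (by simp) (2 * M + 2 * e + 1) (2 * M + 2 * e + 2) ((zz_last (q := .b) (u := M + e + 1) (ε := -1) (N := M + e) (x := 3 * M + 3 * e + 3) (p := .b) (inf_skip _ (inf_skip _ (inf_skip _ (inf_skip _ (inf_skip _ (inf_skip _ (inf_zz rfl rfl))))))) (2 * M + 2 * e + 1) (by omega) : Adj (xCo M e) ((.b, 2 * M + 2 * e + 1)) ((.b, 2 * M + 2 * e + 2)))) 0 (by omega)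
  · exact cz_b 1 1 (by simp) (2 * M + 2 * e + 2) (2 * M + 2 * e + 1) ((zz_last (q := .b) (u := M + e + 1) (ε := -1) (N := M + e) (x := 3 * M + 3 * e + 3) (p := .b) (inf_skip _ (inf_skip _ (inf_skip _ (inf_skip _ (inf_skip _ (inf_skip _ (inf_zz rfl rfl))))))) (2 * M + 2 * e + 1) (by omega) : Adj (xCo M e) ((.b, 2 * M + 2 * e + 1)) ((.b, 2 * M + 2 * e + 2))).symm) 0 (by omega)

theorem xOab {M e k ℓ : ℕ} {h : ZMod ℓ} (hh : h * 2 = -1) (hℓ : ℓ = 2 * k + 1) (hk : k = 4 * M + 2 * e + 5) (he : e ≤ 1) (d : ℤ)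
    (h1 : -k ≤ d) (h2 : d ≤ k) (h3 : d ≠ -1) (h4 : d ≠ 1) (h5 : d ≠ k - 2) (h6 : d ≠ k - 1) :
    Cz ℓ (xOC M e) (![1, h]) .a .b (1 * (d : ZMod ℓ)) := by
  have hc : (-4 * M + -2 * e + -5 = d) ∨ (0 ≤ d + (4 * M + 2 * e + 4) ∧ d + (4 * M + 2 * e + 4) ≤ 2 * (2 * M + e + 1)) ∨ (0 ≤ d + -2 ∧ d + -2 ≤ 2 * (2 * M + e)) ∨ (0 = d) ∨ (1 = -2 * d + ℓ) := by omega
  rcases hc with h0 | h0 | h0 | h0 | h0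
  · exact cz_b 0 1 (by simp) (2 * M + e + 3) (-2 * M + -e + -2) ((Adj.inf (infix_get 0 rfl rfl) (inf_here _ _) : Adj (xBo M e) ((.a, 2 * M + e + 3)) ((.b, -2 * M + -e + -2)))) 0 (by omega)
  · obtain ⟨x, y, h, ha⟩ := zz_cov (L := xBo M e) (q := .b) (u := -2 * M + -e + -2) (ε := -1) (N := 2 * M + e + 1)
      (x := 2 * M + e + 2) (p := .a) (v := (.a, 1)) (inf_zz rfl rfl) (d + (4 * M + 2 * e + 4)) h0.1 (zw (by omega) (by omega))
    exact cz_b 0 1 (by simp) y x ha.symm 0 (by omega)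
  · obtain ⟨x, y, h, ha⟩ := zz_cov (L := xBo M e) (q := .a) (u := -1) (ε := 1) (N := 2 * M + e)
      (x := 1) (p := .b) (v := (.b, 2 * M + e + 1)) (inf_skip _ (inf_skip _ (inf_zz rfl rfl))) (d + -2) h0.1 (zw (by omega) (by omega))
    exact cz_b 0 1 (by simp) x y ha 0 (by omega)
  · exact cz_b 0 1 (by simp) (2 * M + e + 3) (2 * M + e + 3) ((wrapA rfl (Lst.skip _ (Lst.skip _ (Lst.skip _ (Lst.skip _ (rfl))))) : Adj (xBo M e) ((.b, 2 * M + e + 3)) ((.a, 2 * M + e + 3))).symm) 0 (by omega)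
  · exact cz_b 1 (-2) (by simp [hh]) (2 * M + 2 * e + 2) (2 * M + 2 * e + 3) ((Adj.inf (infix_get 0 rfl rfl) (inf_skip _ (inf_skip _ (inf_skip _ (inf_skip _ (inf_here _ _))))) : Adj (xCo M e) ((.a, 2 * M + 2 * e + 2)) ((.b, 2 * M + 2 * e + 3)))) 1 (by omega)

theorem xOaz {M e k ℓ : ℕ} {h : ZMod ℓ} (hh : h * 2 = -1) (hℓ : ℓ = 2 * k + 1) (hk : k = 4 * M + 2 * e + 5) (he : e ≤ 1) (d : ℤ) (hd : d = -1 ∨ d = 1) :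
    Cz ℓ (xOC M e) (![1, h]) .a .zb (1 * (d : ZMod ℓ)) := by
  have hc : (-1 = d) ∨ (1 = d) := by omega
  rcases hc with h0 | h0
  · exact cz_b 0 1 (by simp) 1 0 ((Adj.inf (infix_get 0 rfl rfl) (inf_skip _ (inf_skip _ (inf_here _ _))) : Adj (xBo M e) ((.a, 1)) ((.zb, 0)))) 0 (by omega)
  · exact cz_b 0 1 (by simp) (-1) 0 ((Adj.inf (infix_get 1 rfl rfl) (inf_skip _ (inf_skip _ (inf_here _ _))) : Adj (xBo M e) ((.zb, 0)) ((.a, -1))).symm) 0 (by omega)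

theorem xObz {M e k ℓ : ℕ} {h : ZMod ℓ} (hh : h * 2 = -1) (hℓ : ℓ = 2 * k + 1) (hk : k = 4 * M + 2 * e + 5) (he : e ≤ 1) (d : ℤ) (hd : d = 2 - k ∨ d = 1 - k) :
    Cz ℓ (xOC M e) (![1, h]) .b .za (1 * (d : ZMod ℓ)) := by
  have hc : (-4 * M + -2 * e + -3 = d) ∨ (-4 * M + -2 * e + -4 = d) := by omega
  rcases hc with h0 | h0
  · exact cz_b 0 1 (by simp) (2 * M + e + 1) (-2 * M + -e + -2) ((Adj.inf (infix_get 0 rfl rfl) (inf_skip _ (inf_skip _ (inf_skip _ (inf_skip _ (List.infix_refl _))))) : Adj (xBo M e) ((.b, 2 * M + e + 1)) ((.za, -2 * M + -e + -2)))) 0 (by omega)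
  · exact cz_b 0 1 (by simp) (2 * M + e + 2) (-2 * M + -e + -2) ((Adj.inf (infix_get 1 rfl rfl) (inf_skip _ (inf_skip _ (inf_skip _ (inf_skip _ (List.infix_refl _))))) : Adj (xBo M e) ((.za, -2 * M + -e + -2)) ((.b, 2 * M + e + 2))).symm) 0 (by omega)

def yEC (M : ℕ) : Fin 3 → List (Kd × ℤ) := ![yBe M, yCe M, yDe M]

theorem yEab {M k ℓ : ℕ} {h : ZMod ℓ} (hh : h * 2 = 1) (hℓ : ℓ = 2 * k + 1) (hk : k = 2 * M + 6) (d : ℤ)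
    (h1 : -k ≤ d) (h2 : d ≤ k) (h3 : d ≠ -1) (h4 : d ≠ 1) (h5 : d ≠ k - 3) (h6 : d ≠ k - 2) :
    Cz ℓ (yEC M) (![1, h, h]) .a .b (1 * (d : ZMod ℓ)) := by
  have hc : (0 ≤ d + (2 * M + 6) ∧ d + (2 * M + 6) ≤ 2 * (M + 2)) ∨ (0 ≤ d + -2 ∧ d + -2 ≤ 2 * (M)) ∨ (2 * M + 5 = d) ∨ (0 = 2 * d) ∨ (4 * M + 12 = 2 * d) := by omega
  rcases hc with h0 | h0 | h0 | h0 | h0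
  · obtain ⟨x, y, h, ha⟩ := zz_cov (L := yBe M) (q := .b) (u := -M + -3) (ε := -1) (N := M + 2)
      (x := M + 3) (p := .a) (v := (.a, 1)) (inf_zz rfl rfl) (d + (2 * M + 6)) h0.1 (zw (by omega) (by omega))
    exact cz_b 0 1 (by simp) y x ha.symm 0 (by omega)
  · obtain ⟨x, y, h, ha⟩ := zz_cov (L := yBe M) (q := .a) (u := -1) (ε := 1) (N := M)
      (x := 1) (p := .b) (v := (.b, M + 1)) (inf_skip _ (inf_skip _ (inf_zz rfl rfl))) (d + -2) h0.1 (zw (by omega) (by omega))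
    exact cz_b 0 1 (by simp) x y ha 0 (by omega)
  · exact cz_b 0 1 (by simp) (-M + -3) (M + 2) ((Adj.inf (infix_get 2 rfl rfl) (inf_skip _ (inf_skip _ (inf_skip _ (inf_skip _ (List.infix_refl _))))) : Adj (yBe M) ((.b, M + 2)) ((.a, -M + -3))).symm) 0 (by omega)
  · exact cz_b 1 2 (by simp [hh]) 0 0 ((wrapA rfl (Lst.skip _ (Lst.skip _ (rfl))) : Adj (yCe M) ((.a, 0)) ((.b, 0)))) 0 (by omega)
  · exact cz_b 2 2 (by simp [hh]) 0 (4 * M + 12) ((wrapA rfl (Lst.skip _ (Lst.skip _ (Lst.skip _ (Lst.skip _ (rfl))))) : Adj (yDe M) ((.b, 4 * M + 12)) ((.a, 0))).symm) 0 (by omega)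

theorem yEaz {M k ℓ : ℕ} {h : ZMod ℓ} (hh : h * 2 = 1) (hℓ : ℓ = 2 * k + 1) (hk : k = 2 * M + 6) (d : ℤ) (hd : d = -1 ∨ d = 1) :
    Cz ℓ (yEC M) (![1, h, h]) .a .zb (1 * (d : ZMod ℓ)) := by
  have hc : (-1 = d) ∨ (1 = d) := by omega
  rcases hc with h0 | h0
  · exact cz_b 0 1 (by simp) 1 0 ((Adj.inf (infix_get 0 rfl rfl) (inf_skip _ (inf_skip _ (inf_here _ _))) : Adj (yBe M) ((.a, 1)) ((.zb, 0)))) 0 (by omega)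
  · exact cz_b 0 1 (by simp) (-1) 0 ((Adj.inf (infix_get 1 rfl rfl) (inf_skip _ (inf_skip _ (inf_here _ _))) : Adj (yBe M) ((.zb, 0)) ((.a, -1))).symm) 0 (by omega)

theorem yEbz {M k ℓ : ℕ} {h : ZMod ℓ} (hh : h * 2 = 1) (hℓ : ℓ = 2 * k + 1) (hk : k = 2 * M + 6) (d : ℤ) (hd : d = 3 - k ∨ d = 2 - k) :
    Cz ℓ (yEC M) (![1, h, h]) .b .za (1 * (d : ZMod ℓ)) := by
  have hc : (-2 * M + -3 = d) ∨ (-2 * M + -4 = d) := by omega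
  rcases hc with h0 | h0
  · exact cz_b 0 1 (by simp) (M + 1) (-M + -2) ((Adj.inf (infix_get 0 rfl rfl) (inf_skip _ (inf_skip _ (inf_skip _ (inf_skip _ (List.infix_refl _))))) : Adj (yBe M) ((.b, M + 1)) ((.za, -M + -2)))) 0 (by omega)
  · exact cz_b 0 1 (by simp) (M + 2) (-M + -2) ((Adj.inf (infix_get 1 rfl rfl) (inf_skip _ (inf_skip _ (inf_skip _ (inf_skip _ (List.infix_refl _))))) : Adj (yBe M) ((.za, -M + -2)) ((.b, M + 2))).symm) 0 (by omega)

theorem yEaw {M k ℓ : ℕ} {h : ZMod ℓ} (hh : h * 2 = 1) (hℓ : ℓ = 2 * k + 1) (hk : k = 2 * M + 6) (d : ℤ)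
    (h1 : -k ≤ d) (h2 : d ≤ k) :
    Cz ℓ (yEC M) (![1, h, h]) .a .w (h * (d : ZMod ℓ)) := by
  have hc : (2 * (M + 3) = d + 0 * ℓ) ∨ (0 = d) ∨ (0 ≤ -(d + ℓ) + (4 * M + 12) ∧ -(d + ℓ) + (4 * M + 12) ≤ 2 * (M + 2)) ∨ (2 * M + 7 = d + ℓ) ∨ (0 ≤ -d + (2 * M + 5) ∧ -d + (2 * M + 5) ≤ 2 * (M + 2)) := by omega
  rcases hc with h0 | h0 | h0 | h0 | h0
  · exact cz_a 0 2 (by simp [hh]) (-M + -3) 0 ((Adj.inf (infix_get 3 rfl rfl) (inf_skip _ (inf_skip _ (inf_skip _ (inf_skip _ (List.infix_refl _))))) : Adj (yBe M) ((.a, -M + -3)) ((.w, 0)))) 0 (by omega)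
  · exact cz_b 1 1 (by simp) 0 0 ((Adj.inf (infix_get 0 rfl rfl) (inf_skip _ (inf_skip _ (List.infix_refl _))) : Adj (yCe M) ((.w, 0)) ((.a, 0))).symm) 0 (by omega)
  · obtain ⟨x, y, h, ha⟩ := zz_cov (L := yDe M) (q := .a) (u := 0) (ε := -1) (N := M + 2)
      (x := 4 * M + 12) (p := .w) (v := (.w, 3 * M + 10)) (inf_zz rfl rfl) (-(d + ℓ) + (4 * M + 12)) h0.1 (zw (by omega) (by omega))
    exact cz_b 2 1 (by simp) x y ha 1 (by omega)
  · exact cz_b 2 1 (by simp) (M + 3) (3 * M + 10) ((Adj.inf (infix_get 0 rfl rfl) (inf_skip _ (inf_skip _ (inf_here _ _))) : Adj (yDe M) ((.w, 3 * M + 10)) ((.a, M + 3))).symm) 1 (by omega)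
  · obtain ⟨x, y, h, ha⟩ := zz_cov (L := yDe M) (q := .a) (u := M + 3) (ε := -1) (N := M + 2)
      (x := 3 * M + 8) (p := .w) (v := (.w, 2 * M + 6)) (inf_skip _ (inf_skip _ (inf_zz rfl rfl))) (-d + (2 * M + 5)) h0.1 (zw (by omega) (by omega))
    exact cz_b 2 1 (by simp) x y ha 0 (by omega)

theorem yEbw {M k ℓ : ℕ} {h : ZMod ℓ} (hh : h * 2 = 1) (hℓ : ℓ = 2 * k + 1) (hk : k = 2 * M + 6) (d : ℤ)
    (h1 : -k ≤ d) (h2 : d ≤ k) :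
    Cz ℓ (yEC M) (![1, h, h]) .b .w (h * (d : ZMod ℓ)) := by
  have hc : (2 * (M + 3) = d + 0 * ℓ) ∨ (0 ≤ -d + (2 * M + 5) ∧ -d + (2 * M + 5) ≤ 2 * (2 * M + 5)) ∨ (-2 * M + -6 = d) := by omega
  rcases hc with h0 | h0 | h0
  · exact cz_a 0 2 (by simp [hh]) (-M + -3) 0 ((wrapA rfl (Lst.skip _ (Lst.skip _ (Lst.skip _ (Lst.skip _ (rfl))))) : Adj (yBe M) ((.w, 0)) ((.b, -M + -3))).symm) 0 (by omega)
  · obtain ⟨x, y, h, ha⟩ := zz_cov (L := yCe M) (q := .b) (u := 0) (ε := -1) (N := 2 * M + 5)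
      (x := 2 * M + 5) (p := .w) (v := (.w, 0)) (inf_zz rfl rfl) (-d + (2 * M + 5)) h0.1 (zw (by omega) (by omega))
    exact cz_b 1 1 (by simp) x y ha 0 (by omega)
  · exact cz_b 2 1 (by simp) (4 * M + 12) (2 * M + 6) ((Adj.inf (infix_get 0 rfl rfl) (inf_skip _ (inf_skip _ (inf_skip _ (inf_skip _ (List.infix_refl _))))) : Adj (yDe M) ((.w, 2 * M + 6)) ((.b, 4 * M + 12))).symm) 0 (by omega)

def yOC (M e : ℕ) : Fin 3 → List (Kd × ℤ) := ![yBo M e, yCo M e, yDo M e]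

theorem yOab {M e k ℓ : ℕ} {h : ZMod ℓ} (hh : h * 2 = 1) (hℓ : ℓ = 2 * k + 1) (hk : k = 4 * M + 2 * e + 5) (he : e ≤ 1) (d : ℤ)
    (h1 : -k ≤ d) (h2 : d ≤ k) (h3 : d ≠ -1) (h4 : d ≠ 1) (h5 : d ≠ k - 2) (h6 : d ≠ k - 1) :
    Cz ℓ (yOC M e) (![1, h, 1]) .a .b (1 * (d : ZMod ℓ)) := by
  have hc : (0 ≤ d + (4 * M + 2 * e + 5) ∧ d + (4 * M + 2 * e + 5) ≤ 2 * (M + 1)) ∨ (0 ≤ d + (2 * M + 2 * e + 1) ∧ d + (2 * M + 2 * e + 1) < 2 * (M + e)) ∨ (0 ≤ d + -2 ∧ d + -2 ≤ 2 * (2 * M + e)) ∨ (4 * M + 2 * e + 5 = d) ∨ (0 = 2 * d) ∨ (-2 * M + -2 * e + -2 = d) := by omega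
  rcases hc with h0 | h0 | h0 | h0 | h0 | h0
  · obtain ⟨x, y, h, ha⟩ := zz_cov (L := yBo M e) (q := .b) (u := -2 * M + -e + -3) (ε := -1) (N := M + 1)
      (x := 2 * M + e + 2) (p := .a) (v := (.a, M + e + 1)) (inf_zz rfl rfl) (d + (4 * M + 2 * e + 5)) h0.1 (zw (by omega) (by omega))
    exact cz_b 0 1 (by simp) y x ha.symm 0 (by omega)
  · obtain ⟨x, y, h, ha⟩ := zz_cov (L := yBo M e) (q := .a) (u := M + e + 1) (ε := 1) (N := M + e)
      (x := -M + -e) (p := .b) (v := (.zb, 0)) (inf_skip _ (inf_skip _ (inf_zz rfl rfl))) (d + (2 * M + 2 * e + 1)) h0.1 (Or.inl (by omega))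
    exact cz_b 0 1 (by simp) x y ha 0 (by omega)
  · obtain ⟨x, y, h, ha⟩ := zz_cov (L := yBo M e) (q := .a) (u := -1) (ε := 1) (N := 2 * M + e)
      (x := 1) (p := .b) (v := (.b, 2 * M + e + 1)) (inf_skip _ (inf_skip _ (inf_skip _ (inf_skip _ (inf_zz rfl rfl))))) (d + -2) h0.1 (zw (by omega) (by omega))
    exact cz_b 0 1 (by simp) x y ha 0 (by omega)
  · exact cz_b 0 1 (by simp) (-2 * M + -e + -3) (2 * M + e + 2) ((Adj.inf (infix_get 2 rfl rfl) (inf_skip _ (inf_skip _ (inf_skip _ (inf_skip _ (inf_skip _ (inf_skip _ (List.infix_refl _))))))) : Adj (yBo M e) ((.b, 2 * M + e + 2)) ((.a, -2 * M + -e + -3))).symm) 0 (by omega)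
  · exact cz_b 1 2 (by simp [hh]) 0 0 ((wrapA rfl (Lst.skip _ (Lst.skip _ (rfl))) : Adj (yCo M e) ((.a, 0)) ((.b, 0)))) 0 (by omega)
  · exact cz_b 2 1 (by simp) (4 * M + 3 * e + 4) (2 * M + e + 2) ((wrapA rfl (Lst.skip _ (Lst.skip _ (Lst.skip _ (Lst.skip _ (rfl))))) : Adj (yDo M e) ((.b, 2 * M + e + 2)) ((.a, 4 * M + 3 * e + 4))).symm) 0 (by omega)

theorem yOaz {M e k ℓ : ℕ} {h : ZMod ℓ} (hh : h * 2 = 1) (hℓ : ℓ = 2 * k + 1) (hk : k = 4 * M + 2 * e + 5) (he : e ≤ 1) (d : ℤ) (hd : d = -1 ∨ d = 1) :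
    Cz ℓ (yOC M e) (![1, h, 1]) .a .zb (1 * (d : ZMod ℓ)) := by
  have hc : (-1 = d) ∨ (1 = d) := by omega
  rcases hc with h0 | h0
  · exact cz_b 0 1 (by simp) 1 0 ((zz_last (q := .a) (u := M + e + 1) (ε := 1) (N := M + e) (x := -M + -e) (p := .b) (inf_skip _ (inf_skip _ (inf_zz rfl rfl))) 1 (by omega) : Adj (yBo M e) ((.a, 1)) ((.zb, 0)))) 0 (by omega)
  · exact cz_b 0 1 (by simp) (-1) 0 ((Adj.inf (infix_get 0 rfl rfl) (inf_skip _ (inf_skip _ (inf_skip _ (inf_skip _ (inf_here _ _))))) : Adj (yBo M e) ((.zb, 0)) ((.a, -1))).symm) 0 (by omega)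

theorem yObz {M e k ℓ : ℕ} {h : ZMod ℓ} (hh : h * 2 = 1) (hℓ : ℓ = 2 * k + 1) (hk : k = 4 * M + 2 * e + 5) (he : e ≤ 1) (d : ℤ) (hd : d = 2 - k ∨ d = 1 - k) :
    Cz ℓ (yOC M e) (![1, h, 1]) .b .za (1 * (d : ZMod ℓ)) := by
  have hc : (-4 * M + -2 * e + -3 = d) ∨ (-4 * M + -2 * e + -4 = d) := by omega
  rcases hc with h0 | h0
  · exact cz_b 0 1 (by simp) (2 * M + e + 1) (-2 * M + -e + -2) ((Adj.inf (infix_get 0 rfl rfl) (inf_skip _ (inf_skip _ (inf_skip _ (inf_skip _ (inf_skip _ (inf_skip _ (List.infix_refl _))))))) : Adj (yBo M e) ((.b, 2 * M + e + 1)) ((.za, -2 * M + -e + -2)))) 0 (by omega)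
  · exact cz_b 0 1 (by simp) (2 * M + e + 2) (-2 * M + -e + -2) ((Adj.inf (infix_get 1 rfl rfl) (inf_skip _ (inf_skip _ (inf_skip _ (inf_skip _ (inf_skip _ (inf_skip _ (List.infix_refl _))))))) : Adj (yBo M e) ((.za, -2 * M + -e + -2)) ((.b, 2 * M + e + 2))).symm) 0 (by omega)

theorem yOaw {M e k ℓ : ℕ} {h : ZMod ℓ} (hh : h * 2 = 1) (hℓ : ℓ = 2 * k + 1) (hk : k = 4 * M + 2 * e + 5) (he : e ≤ 1) (d : ℤ)
    (h1 : -k ≤ d) (h2 : d ≤ k) :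
    Cz ℓ (yOC M e) (![1, h, 1]) .a .w (1 * (d : ZMod ℓ)) := by
  have hc : (2 * M + e + 3 = d) ∨ (0 = 2 * d) ∨ (0 ≤ d + -1 ∧ d + -1 ≤ 2 * (M + e)) ∨ (2 * M + 3 * e + 2 = d) ∨ (0 ≤ d + (-2 * M + -2 * e + -4) ∧ d + (-2 * M + -2 * e + -4) ≤ 2 * (3 * M + e + 3)) ∨ (0 ≤ (d + ℓ) + (-2 * M + -2 * e + -4) ∧ (d + ℓ) + (-2 * M + -2 * e + -4) ≤ 2 * (3 * M + e + 3)) := by omega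
  rcases hc with h0 | h0 | h0 | h0 | h0 | h0
  · exact cz_b 0 1 (by simp) (-2 * M + -e + -3) 0 ((Adj.inf (infix_get 3 rfl rfl) (inf_skip _ (inf_skip _ (inf_skip _ (inf_skip _ (inf_skip _ (inf_skip _ (List.infix_refl _))))))) : Adj (yBo M e) ((.a, -2 * M + -e + -3)) ((.w, 0)))) 0 (by omega)
  · exact cz_b 1 2 (by simp [hh]) 0 0 ((Adj.inf (infix_get 0 rfl rfl) (inf_skip _ (inf_skip _ (List.infix_refl _))) : Adj (yCo M e) ((.w, 0)) ((.a, 0))).symm) 0 (by omega)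
  · obtain ⟨x, y, h, ha⟩ := zz_cov (L := yDo M e) (q := .a) (u := 4 * M + 3 * e + 4) (ε := 1) (N := M + e)
      (x := 4 * M + 3 * e + 5) (p := .w) (v := (.w, 5 * M + 4 * e + 5)) (inf_zz rfl rfl) (d + -1) h0.1 (zw (by omega) (by omega))
    exact cz_b 2 1 (by simp) x y ha 0 (by omega)
  · exact cz_b 2 1 (by simp) (3 * M + e + 3) (5 * M + 4 * e + 5) ((Adj.inf (infix_get 0 rfl rfl) (inf_skip _ (inf_skip _ (inf_here _ _))) : Adj (yDo M e) ((.w, 5 * M + 4 * e + 5)) ((.a, 3 * M + e + 3))).symm) 0 (by omega)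
  · obtain ⟨x, y, h, ha⟩ := zz_cov (L := yDo M e) (q := .a) (u := 3 * M + e + 3) (ε := 1) (N := 3 * M + e + 3)
      (x := 5 * M + 3 * e + 7) (p := .w) (v := (.w, 8 * M + 4 * e + 10)) (inf_skip _ (inf_skip _ (inf_zz rfl rfl))) (d + (-2 * M + -2 * e + -4)) h0.1 (zw (by omega) (by omega))
    exact cz_b 2 1 (by simp) x y ha 0 (by omega)
  · obtain ⟨x, y, h, ha⟩ := zz_cov (L := yDo M e) (q := .a) (u := 3 * M + e + 3) (ε := 1) (N := 3 * M + e + 3)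
      (x := 5 * M + 3 * e + 7) (p := .w) (v := (.w, 8 * M + 4 * e + 10)) (inf_skip _ (inf_skip _ (inf_zz rfl rfl))) ((d + ℓ) + (-2 * M + -2 * e + -4)) h0.1 (zw (by omega) (by omega))
    exact cz_b 2 1 (by simp) x y ha 1 (by omega)

theorem yObw {M e k ℓ : ℕ} {h : ZMod ℓ} (hh : h * 2 = 1) (hℓ : ℓ = 2 * k + 1) (hk : k = 4 * M + 2 * e + 5) (he : e ≤ 1) (d : ℤ)
    (h1 : -k ≤ d) (h2 : d ≤ k) :
    Cz ℓ (yOC M e) (![1, h, 1]) .b .w (h * (d : ZMod ℓ)) := by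
  have hc : (2 * (2 * M + e + 3) = d + 1 * ℓ) ∨ (0 ≤ -d + (4 * M + 2 * e + 4) ∧ -d + (4 * M + 2 * e + 4) ≤ 2 * (4 * M + 2 * e + 4)) ∨ (2 * (6 * M + 3 * e + 8) = d + 1 * ℓ) := by omega
  rcases hc with h0 | h0 | h0
  · exact cz_a 0 2 (by simp [hh]) (-2 * M + -e + -3) 0 ((wrapA rfl (Lst.skip _ (Lst.skip _ (Lst.skip _ (Lst.skip _ (Lst.skip _ (Lst.skip _ (rfl))))))) : Adj (yBo M e) ((.w, 0)) ((.b, -2 * M + -e + -3))).symm) 1 (by omega)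
  · obtain ⟨x, y, h, ha⟩ := zz_cov (L := yCo M e) (q := .b) (u := 0) (ε := -1) (N := 4 * M + 2 * e + 4)
      (x := 4 * M + 2 * e + 4) (p := .w) (v := (.w, 0)) (inf_zz rfl rfl) (-d + (4 * M + 2 * e + 4)) h0.1 (zw (by omega) (by omega))
    exact cz_b 1 1 (by simp) x y ha 0 (by omega)
  · exact cz_a 2 2 (by simp [hh]) (2 * M + e + 2) (8 * M + 4 * e + 10) ((Adj.inf (infix_get 0 rfl rfl) (inf_skip _ (inf_skip _ (inf_skip _ (inf_skip _ (List.infix_refl _))))) : Adj (yDo M e) ((.w, 8 * M + 4 * e + 10)) ((.b, 2 * M + e + 2))).symm) 1 (by omega)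

theorem bi01 (b : Bool) : bi b = 0 ∨ bi b = 1 := by cases b <;> simp [bi]

theorem kk2 {ℓ k : ℕ} (hℓ : ℓ = 2 * k + 1) : (k : ZMod ℓ) * 2 = -1 := by
  have h : ((2 * k + 1 : ℕ) : ZMod ℓ) = 0 := by rw [← hℓ]; exact ZMod.natCast_self ℓ
  push_cast at h
  linear_combination h

theorem rho_card {ℓ k : ℕ} [NeZero ℓ] (hℓ : ℓ = 2 * k + 1) :
    (Finset.univ.filter fun x => rho k ℓ x = true).card = k := by
  have h2 := kk2 hℓ
  refine Eq.trans (Finset.card_bij' (t := Finset.range k) (fun x _ => (4 * x).val) (fun i _ => (k : ZMod ℓ) * k * (i : ℕ))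
    ?_ ?_ ?_ ?_) (Finset.card_range k)
  · intro x hx
    simpa [rho] using hx
  · intro i hi
    have hi' := Finset.mem_range.1 hi
    have e : 4 * ((k : ZMod ℓ) * k * (i : ℕ)) = (i : ℕ) := by
      linear_combination (i : ZMod ℓ) * (k * 2 - 1) * h2
    have : (i : ZMod ℓ).val = i := ZMod.val_cast_of_lt (by omega)
    simp only [rho, Finset.mem_filter, Finset.mem_univ, true_and, decide_eq_true_eq, e, this]
    exact hi'
  · intro x hx
    simp only [ZMod.natCast_val, ZMod.cast_id', id]
    linear_combination x * (k * 2 - 1) * h2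
  · intro i hi
    have hi' := Finset.mem_range.1 hi
    have e : 4 * ((k : ZMod ℓ) * k * (i : ℕ)) = (i : ℕ) := by
      linear_combination (i : ZMod ℓ) * (k * 2 - 1) * h2
    have : (i : ZMod ℓ).val = i := ZMod.val_cast_of_lt (by omega)
    simp only [e, this]

theorem rho_sep {ℓ k : ℕ} [NeZero ℓ] (hℓ : ℓ = 2 * k + 1) (x y : ZMod ℓ)
    (h : 4 * y = 4 * x + k) :
    bi (rho k ℓ x) + bi (rho k ℓ y) = 0 ∨ bi (rho k ℓ x) + bi (rho k ℓ y) = 1 := by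
  have key : ¬ ((4 * x).val < k ∧ (4 * y).val < k) := by
    rintro ⟨h1, h2⟩
    have hk : (k : ZMod ℓ).val = k := ZMod.val_cast_of_lt (by omega)
    rw [h, ZMod.val_add_of_lt (by omega)] at h2
    omega
  simp only [rho, bi, decide_eq_true_eq]
  by_cases h1 : (4 * x).val < k
  · have h2 : ¬ (4 * y).val < k := fun h2 => key ⟨h1, h2⟩
    simp [h1, h2]
  · by_cases h2 : (4 * y).val < k <;> simp [h1, h2]

theorem rho_fs {ℓ k : ℕ} [NeZero ℓ] (ρ : ZMod ℓ → Bool)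
    (hρ : (Finset.univ.filter fun x => ρ x = true).card = k) (s s' t : ZMod ℓ) (hs : s * s' = 1) :
    Fs (fun x => bi (ρ (s * x + t))) 0 1 ℓ = k := by
  have h := col_count ρ hρ ((List.range ℓ).map fun i : ℕ => s * ((i : ℤ) : ZMod ℓ) + t) (by simp) (by
    apply List.Nodup.map_on _ List.nodup_range
    intro x hx y hy h
    have hx := List.mem_range.1 hx
    have hy := List.mem_range.1 hy
    have := lift_inj (c := 0) (x := x) (y := y) hs (by omega) (by omega) (add_right_cancel h)
    omega)
  rw [← h]
  have key : ∀ n : ℕ, Fs (fun x => bi (ρ (s * x + t))) 0 1 n =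
      ((((List.range n).map fun i : ℕ => s * ((i : ℤ) : ZMod ℓ) + t).countP ρ : ℕ) : ℤ) := by
    intro n
    induction n with
    | zero => simp [Fs]
    | succ n ih =>
      rw [List.range_succ, List.map_append, List.countP_append]
      simp only [Fs] at ih ⊢
      rw [Finset.sum_range_succ, ih]
      push_cast
      congr 1
      cases hb : ρ (s * (n : ZMod ℓ) + t) <;> simp [bi, hb]
  exact key ℓ

theorem w0_of {ℓ : ℕ} {L : List (Kd × ℤ)} {s : ZMod ℓ}
    (h : ∀ u ∈ L, u.1 ≠ .A ∧ u.1 ≠ .B ∧ (u.1 = .w → u.2 = 0)) (x : ZMod ℓ) :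
    ((Kd.A, x) ∉ L.map (lift ℓ s) ∧ (Kd.B, x) ∉ L.map (lift ℓ s)) ∧
    ((Kd.w, x) ∈ L.map (lift ℓ s) → x = 0) := by
  refine ⟨⟨?_, ?_⟩, ?_⟩ <;>
  · intro hx
    obtain ⟨⟨p, y⟩, hy, e⟩ := List.mem_map.1 hx
    simp only [lift, Prod.mk.injEq] at e
    have := h _ hy
    simp_all

theorem nA_of {ℓ : ℕ} {L : List (Kd × ℤ)} {s : ZMod ℓ}
    (h : ∀ u ∈ L, u.1 ≠ .A ∧ u.1 ≠ .B) (x : ZMod ℓ) :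
    ((Kd.A, x) ∉ L.map (lift ℓ s) ∧ (Kd.B, x) ∉ L.map (lift ℓ s)) := by
  refine ⟨?_, ?_⟩ <;>
  · intro hx
    obtain ⟨⟨p, y⟩, hy, e⟩ := List.mem_map.1 hx
    simp only [lift, Prod.mk.injEq] at e
    have := h _ hy
    simp_all

theorem wadj {ℓ n : ℕ} {B : Fin n → List (Kd × ℤ)} {s : Fin n → ZMod ℓ} {p : Kd} {x : ℤ} (i : Fin n)
    (h : Adj (B i) (p, x) (.w, 0)) :
    ∃ i x, Adj ((fun i => (B i).map (lift ℓ (s i))) i) (p, x) (.w, 0) :=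
  ⟨i, s i * x, by simpa [lift] using h.map (lift ℓ (s i))⟩

section
variable {ℓ k n : ℕ} [NeZero ℓ] {B : Fin n → List (Kd × ℤ)} {s : Fin n → ZMod ℓ} {p q : Kd} {d1 d2 : ℤ}

theorem ab_of (hℓ : ℓ = 2 * k + 1) (h : ∀ d : ℤ, -k ≤ d → d ≤ k → d ≠ -1 → d ≠ 1 → d ≠ -d1 → d ≠ -d2 →
    Cz ℓ B s p q (1 * (d : ZMod ℓ))) (δ : ZMod ℓ)
    (h1 : δ ∉ [((-1 : ℤ) : ZMod ℓ), ((1 : ℤ) : ZMod ℓ)])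
    (h2 : -δ ∉ [(d1 : ZMod ℓ), (d2 : ZMod ℓ)]) :
    Cv (fun i => (B i).map (lift ℓ (s i))) p q δ := by
  obtain ⟨d, a, b, rfl⟩ := zrep hℓ δ
  have := h d a b (by rintro rfl; simp at h1) (by rintro rfl; simp at h1)
    (by rintro rfl; simp at h2) (by rintro rfl; simp at h2)
  rw [one_mul] at this
  exact this.cv

theorem az_of (h : ∀ d : ℤ, d = d1 ∨ d = d2 → Cz ℓ B s p q (1 * (d : ZMod ℓ))) (δ : ZMod ℓ)
    (h1 : δ ∈ [(d1 : ZMod ℓ), (d2 : ZMod ℓ)]) :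
    Cv (fun i => (B i).map (lift ℓ (s i))) p q δ := by
  have : δ = d1 ∨ δ = d2 := by simpa using h1
  rcases this with rfl | rfl
  · have := h d1 (Or.inl rfl); rw [one_mul] at this; exact this.cv
  · have := h d2 (Or.inr rfl); rw [one_mul] at this; exact this.cv

/-- Every residue is `u * d` with `d` in the symmetric window. -/
theorem urep (hℓ : ℓ = 2 * k + 1) (u u' : ZMod ℓ) (hu : u * u' = 1) (δ : ZMod ℓ) :
    ∃ d : ℤ, -k ≤ d ∧ d ≤ k ∧ u * (d : ZMod ℓ) = δ := by
  obtain ⟨d, a, b, e⟩ := zrep hℓ (u' * δ)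
  exact ⟨d, a, b, by rw [e]; linear_combination δ * hu⟩

theorem all_of (hℓ : ℓ = 2 * k + 1) (u u' : ZMod ℓ) (hu : u * u' = 1)
    (h : ∀ d : ℤ, -k ≤ d → d ≤ k → Cz ℓ B s p q (u * (d : ZMod ℓ))) (δ : ZMod ℓ) :
    Cv (fun i => (B i).map (lift ℓ (s i))) p q δ := by
  obtain ⟨d, a, b, rfl⟩ := urep hℓ u u' hu δ
  exact (h d a b).cv
end

theorem xED {M k ℓ : ℕ} [NeZero ℓ] (hℓ : ℓ = 2 * k + 1) (hk : k = 2 * M + 6) (ρ : ZMod ℓ → Bool)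
    (d1 d2 : ℤ) (hd1 : d1 = 3 - k) (hd2 : d2 = 2 - k) :
    L1D ρ k [((-1 : ℤ) : ZMod ℓ), ((1 : ℤ) : ZMod ℓ)] [(d1 : ZMod ℓ), (d2 : ZMod ℓ)] k (-2)
      (fun i => (xEC M i).map (lift ℓ ((fun _ => 1 : Fin 2 → ZMod ℓ) i))) where
  good i := by
    fin_cases i
    · exact (xBeG hℓ hk).bg ρ _ false 1 1 (by simp) 0 (by simp) fun t => xBeS (ℓ := ℓ) hk _ fun x => bi01 _
    · exact (xCeG hℓ hk).bg ρ _ false 1 1 (by simp) 0 (by simp) fun t => xCeS (ℓ := ℓ) hk _ fun x => bi01 _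
  nA i x := by
    fin_cases i
    · exact (w0_of xBeW x).1
    · exact (w0_of xCeW x).1
  w0 i x := by
    fin_cases i
    · exact (w0_of xBeW x).2
    · exact (w0_of xCeW x).2
  ff := by linear_combination -kk2 hℓ
  aa δ h := by
    obtain ⟨d, a, b, rfl⟩ := zrep hℓ δ
    by_cases h1 : d = k
    · left; rw [h1]; simp
    by_cases h2 : d = -k
    · right; left; rw [h2]; simp
    right; right
    have := xEaa hℓ hk d a b (by rintro rfl; simp at h) h1 h2
    rw [one_mul] at this
    exact this.cv
  bb δ h := by
    obtain ⟨d, a, b, rfl⟩ := zrep hℓ δ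
    have := xEbb hℓ hk d a b (by rintro rfl; simp at h)
    rw [one_mul] at this
    exact this.cv
  ab := ab_of hℓ fun d a b e1 e2 e3 e4 => xEab hℓ hk d a b e1 e2 (by omega) (by omega)
  az := az_of fun d h => xEaz hℓ hk d h
  bz := az_of fun d h => xEbz hℓ hk d (by omega)
  aw := wadj 1 ((wrapA rfl (Lst.skip _ (Lst.skip _ (Lst.skip _ (Lst.skip _ rfl)))) :
    Adj (xCe M) (.w, 0) (.a, 0)).symm)
  bw := wadj 1 (Adj.inf (infix_get 0 rfl rfl)
    (inf_skip _ (inf_skip _ (inf_skip _ (inf_skip _ (List.infix_refl _))))) : Adj (xCe M) (.b, 0) (.w, 0))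

theorem xOD {M e k ℓ : ℕ} [NeZero ℓ] (hℓ : ℓ = 2 * k + 1) (hk : k = 4 * M + 2 * e + 5) (he : e ≤ 1)
    (ρ : ZMod ℓ → Bool) (d1 d2 : ℤ) (hd1 : d1 = 2 - k) (hd2 : d2 = 1 - k) :
    L1D ρ k [((-1 : ℤ) : ZMod ℓ), ((1 : ℤ) : ZMod ℓ)] [(d1 : ZMod ℓ), (d2 : ZMod ℓ)] 1 1
      (fun i => (xOC M e i).map (lift ℓ ((![1, (k : ZMod ℓ)] : Fin 2 → ZMod ℓ) i))) where
  good i := by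
    fin_cases i
    · exact (xBoG hℓ hk he).bg ρ _ false 1 1 (by simp) 0 (by simp) fun t => xBoS (ℓ := ℓ) hk he _ fun x => bi01 _
    · exact (xCoG hℓ hk he).bg ρ _ false k (-2) (by linear_combination -kk2 hℓ) 0 (by simp) fun t =>
        xCoS (ℓ := ℓ) hk he _ fun x => bi01 _
  nA i x := by
    fin_cases i
    · exact (w0_of xBoW x).1
    · exact (w0_of xCoW x).1
  w0 i x := by
    fin_cases i
    · exact (w0_of xBoW x).2
    · exact (w0_of xCoW x).2
  ff := by simp
  aa δ h := by
    obtain ⟨d, a, b, rfl⟩ := urep hℓ (k : ZMod ℓ) (-2) (by linear_combination -kk2 hℓ) δ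
    by_cases h1 : d = 2
    · right; left; rw [h1]; push_cast; exact kk2 hℓ
    by_cases h2 : d = -2
    · left; rw [h2]; push_cast; linear_combination -kk2 hℓ
    right; right
    exact (xOaa (kk2 hℓ) hℓ hk he d a b (by rintro rfl; simp at h) h1 h2).cv
  bb δ h := by
    obtain ⟨d, a, b, rfl⟩ := urep hℓ (k : ZMod ℓ) (-2) (by linear_combination -kk2 hℓ) δ
    exact (xObb (kk2 hℓ) hℓ hk he d a b (by rintro rfl; simp at h)).cv
  ab := ab_of hℓ fun d a b e1 e2 e3 e4 => xOab (kk2 hℓ) hℓ hk he d a b e1 e2 (by omega) (by omega)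
  az := az_of fun d h => xOaz (kk2 hℓ) hℓ hk he d h
  bz := az_of fun d h => xObz (kk2 hℓ) hℓ hk he d (by omega)
  aw := wadj 1 ((wrapA rfl (Lst.skip _ (Lst.skip _ (Lst.skip _ (Lst.skip _ (Lst.skip _ (Lst.skip _
    (Lst.skip _ (Lst.skip _ rfl)))))))) :
    Adj (xCo M e) (.w, 0) (.a, 2 * (M : ℤ) + 2 * (e : ℤ) + (3))).symm)
  bw := wadj 1 (Adj.inf (infix_get 0 rfl rfl)
    (inf_skip _ (inf_skip _ (inf_skip _ (inf_skip _ (inf_skip _ (inf_skip _ (inf_skip _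
      (inf_skip _ (List.infix_refl _))))))))) :
    Adj (xCo M e) (.b, 2 * (M : ℤ) + 2 * (e : ℤ) + (2)) (.w, 0))

theorem kh2 {ℓ k : ℕ} (hℓ : ℓ = 2 * k + 1) : ((k : ZMod ℓ) + 1) * 2 = 1 := by
  linear_combination kk2 hℓ

theorem yED {M k ℓ : ℕ} [NeZero ℓ] (hℓ : ℓ = 2 * k + 1) (hk : k = 2 * M + 6)
    (d1 d2 : ℤ) (hd1 : d1 = 3 - k) (hd2 : d2 = 2 - k) :
    LLD (rho k ℓ) k [((-1 : ℤ) : ZMod ℓ), ((1 : ℤ) : ZMod ℓ)] [(d1 : ZMod ℓ), (d2 : ZMod ℓ)]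
      (fun i => (yEC M i).map (lift ℓ ((![1, (k : ZMod ℓ) + 1, (k : ZMod ℓ) + 1] : Fin 3 → ZMod ℓ) i))) where
  good i := by
    fin_cases i
    · exact (yBeG hℓ hk).bg _ _ true 1 1 (by simp) 1 (by simp) fun t => yBeS (ℓ := ℓ) hk _ fun x => bi01 _
    · exact (yCeG hℓ hk).bg _ _ true _ 2 (kh2 hℓ) 1 (by simp) fun t => yCeS (ℓ := ℓ) hk _ fun x => bi01 _
    · refine (yDeG hℓ hk).bg _ _ true _ 2 (kh2 hℓ) 1 (by simp) fun t => yDeS (ℓ := ℓ) hk _ ?_ ?_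
      · refine rho_sep hℓ _ _ ?_
        have h := kh2 hℓ
        have hk' : (k : ZMod ℓ) = 2 * M + 6 := by
          conv_lhs => rw [hk]
          push_cast; ring
        push_cast
        linear_combination 2 * ((M : ZMod ℓ) + 3) * h - hk'
      · have := rho_fs (rho k ℓ) (rho_card hℓ) _ 2 t (kh2 hℓ)
        rwa [show 4 * M + 13 = ℓ by omega]
  nA i x := by
    fin_cases i
    · exact nA_of yBeW x
    · exact nA_of yCeW x
    · exact nA_of yDeW x
  ab := ab_of hℓ fun d a b e1 e2 e3 e4 => yEab (kh2 hℓ) hℓ hk d a b e1 e2 (by omega) (by omega)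
  az := az_of fun d h => yEaz (kh2 hℓ) hℓ hk d h
  bz := az_of fun d h => yEbz (kh2 hℓ) hℓ hk d (by omega)
  aw := all_of hℓ _ 2 (kh2 hℓ) (yEaw (kh2 hℓ) hℓ hk)
  bw := all_of hℓ _ 2 (kh2 hℓ) (yEbw (kh2 hℓ) hℓ hk)

theorem yOD {M e k ℓ : ℕ} [NeZero ℓ] (hℓ : ℓ = 2 * k + 1) (hk : k = 4 * M + 2 * e + 5) (he : e ≤ 1)
    (d1 d2 : ℤ) (hd1 : d1 = 2 - k) (hd2 : d2 = 1 - k) :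
    LLD (rho k ℓ) k [((-1 : ℤ) : ZMod ℓ), ((1 : ℤ) : ZMod ℓ)] [(d1 : ZMod ℓ), (d2 : ZMod ℓ)]
      (fun i => (yOC M e i).map (lift ℓ ((![1, (k : ZMod ℓ) + 1, 1] : Fin 3 → ZMod ℓ) i))) where
  good i := by
    fin_cases i
    · exact (yBoG hℓ hk he).bg _ _ true 1 1 (by simp) 1 (by simp) fun t => yBoS (ℓ := ℓ) hk he _ fun x => bi01 _
    · exact (yCoG hℓ hk he).bg _ _ true _ 2 (kh2 hℓ) 1 (by simp) fun t => yCoS (ℓ := ℓ) hk he _ fun x => bi01 _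
    · have h := kk2 hℓ
      have hk' : (k : ZMod ℓ) = 4 * M + 2 * e + 5 := by
        conv_lhs => rw [hk]
        push_cast; ring
      refine (yDoG hℓ hk he).bg _ _ true 1 1 (by simp) 1 (by simp) fun t => yDoS (ℓ := ℓ) hk he _ ?_ ?_ ?_
      · intro h0
        refine rho_sep hℓ _ _ ?_
        rw [h0] at hk' ⊢
        push_cast at hk' ⊢
        linear_combination h - 3 * hk'
      · intro h0
        rw [add_comm]
        refine rho_sep hℓ _ _ ?_
        rw [h0] at hk' ⊢
        push_cast at hk' ⊢
        linear_combination -h + hk'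
      · have := rho_fs (rho k ℓ) (rho_card hℓ) 1 1 t (by simp)
        rwa [show 8 * M + 4 * e + 11 = ℓ by omega]
  nA i x := by
    fin_cases i
    · exact nA_of yBoW x
    · exact nA_of yCoW x
    · exact nA_of yDoW x
  ab := ab_of hℓ fun d a b e1 e2 e3 e4 => yOab (kh2 hℓ) hℓ hk he d a b e1 e2 (by omega) (by omega)
  az := az_of fun d h => yOaz (kh2 hℓ) hℓ hk he d h
  bz := az_of fun d h => yObz (kh2 hℓ) hℓ hk he d (by omega)
  aw := all_of hℓ 1 1 (by simp) (yOaw (kh2 hℓ) hℓ hk he)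
  bw := all_of hℓ _ 2 (kh2 hℓ) (yObw (kh2 hℓ) hℓ hk he)

theorem rlo3 : (Finset.univ.filter fun x => rlo 3 7 x = true).card = 3 := by decide +kernel

theorem rlo4 : (Finset.univ.filter fun x => rlo 4 9 x = true).card = 4 := by decide +kernel

theorem exMain {k ℓ : ℕ} [NeZero ℓ] (hℓ : ℓ = 2 * k + 1) (hk : 5 ≤ k) (d1 d2 : ℤ)
    (h : (k % 2 = 0 ∧ d1 = 3 - k ∧ d2 = 2 - k) ∨ (k % 2 = 1 ∧ d1 = 2 - k ∧ d2 = 1 - k)) :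
    ∃ B, MainD (rho k ℓ) k [((-1 : ℤ) : ZMod ℓ), ((1 : ℤ) : ZMod ℓ)] [(d1 : ZMod ℓ), (d2 : ZMod ℓ)] B := by
  rcases h with ⟨h0, h1, h2⟩ | ⟨h0, h1, h2⟩
  · by_cases h6 : k = 6
    · subst h6; subst hℓ; subst h1; subst h2
      exact ⟨mB6, by simpa using mD6⟩
    · obtain ⟨N, rfl⟩ : ∃ N, k = 2 * N + 8 := ⟨(k - 8) / 2, by omega⟩
      rw [show d1 = -2 * (N : ℤ) + (-5) by push_cast at h1; omega,
        show d2 = -2 * (N : ℤ) + (-6) by push_cast at h2; omega]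
      exact ⟨_, meD hℓ rfl (Nat.zero_le _) _⟩
  · by_cases h5 : k = 5
    · subst h5; subst hℓ; subst h1; subst h2
      exact ⟨mB5, by simpa using mD5⟩
    by_cases h7 : k = 7
    · subst h7; subst hℓ; subst h1; subst h2
      exact ⟨mB7, by simpa using mD7⟩
    · obtain ⟨N, rfl⟩ : ∃ N, k = 2 * N + 7 := ⟨(k - 7) / 2, by omega⟩
      rw [show d1 = -2 * (N : ℤ) + (-5) by push_cast at h1; omega,
        show d2 = -2 * (N : ℤ) + (-6) by push_cast at h2; omega]
      exact ⟨_, moD hℓ rfl (by omega) _⟩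

theorem both {k ℓ : ℕ} [NeZero ℓ] (hℓ : ℓ = 2 * k + 1) (hk : 3 ≤ k) (m : ℕ) :
    HasEquitable2Decomp (⊤ : SimpleGraph (Fin (2 * ℓ * m + 1))) ℓ ∧
    HasEquitable2Decomp (⊤ : SimpleGraph (Fin (2 * ℓ * m + ℓ))) ℓ := by
  by_cases h3 : k = 3
  · subst h3; subst hℓ
    have hc := rlo3
    exact ⟨final1 rfl (by omega) (rlo 3 7) hc _ _ _ _ _ _ mD3 uD3 m,
      finall rfl (by omega) (rlo 3 7) hc _ _ _ _ mD3 wD3 m⟩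
  by_cases h4 : k = 4
  · subst h4; subst hℓ
    have hc := rlo4
    exact ⟨final1 rfl (by omega) (rlo 4 9) hc _ _ _ _ _ _ mD4 uD4 m,
      finall rfl (by omega) (rlo 4 9) hc _ _ _ _ mD4 wD4 m⟩
  have hc := rho_card hℓ
  rcases Nat.mod_two_eq_zero_or_one k with h | h
  · obtain ⟨B, hB⟩ := exMain hℓ (by omega) (3 - k) (2 - k) (Or.inl ⟨h, rfl, rfl⟩)
    obtain ⟨M, hM⟩ : ∃ M, k = 2 * M + 6 := ⟨(k - 6) / 2, by omega⟩
    exact ⟨final1 hℓ (by omega) _ hc _ _ _ _ _ _ hB (xED hℓ hM _ _ _ rfl rfl) m,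
      finall hℓ (by omega) _ hc _ _ _ _ hB (yED hℓ hM _ _ rfl rfl) m⟩
  · obtain ⟨B, hB⟩ := exMain hℓ (by omega) (2 - k) (1 - k) (Or.inr ⟨h, rfl, rfl⟩)
    obtain ⟨M, e, hM, he⟩ : ∃ M e, k = 4 * M + 2 * e + 5 ∧ e ≤ 1 :=
      ⟨(k - 5) / 4, (k - 5) % 4 / 2, by omega, by omega⟩
    exact ⟨final1 hℓ (by omega) _ hc _ _ _ _ _ _ hB (xOD hℓ hM he _ _ _ rfl rfl) m,
      finall hℓ (by omega) _ hc _ _ _ _ hB (yOD hℓ hM he _ _ rfl rfl) m⟩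

end EqDec

theorem stmt0 (ℓ v : ℕ) (hℓ : 5 < ℓ) (hodd : Odd ℓ) (hv : 0 < v)
    (hmod : v % (2 * ℓ) = 1 ∨ v % (2 * ℓ) = ℓ) :
    letI : NeZero ℓ := ⟨by omega⟩
    HasEquitable2Decomp (⊤ : SimpleGraph (Fin v)) ℓ := by
  haveI : NeZero ℓ := ⟨by omega⟩
  obtain ⟨k, hk⟩ := hodd
  have hd := Nat.div_add_mod v (2 * ℓ)
  have hb := EqDec.both hk (by omega) (v / (2 * ℓ))
  rcases hmod with h | h <;> rw [h] at hd
  · have := hb.1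
    rwa [hd] at this
  · have := hb.2
    rwa [hd] at this
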